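/- Let k be a field of characteristic zero, X an r × s matrix of indeterminates with r < s, R = k[X], I the ideal of maximal minors, and d = r(s−r)+1. Then H^d_I(R) is isomorphic as an R-module to E_R(k), the injective hull of the residue field k over R; in particular, its socle is one-dimensional. -/

import Mathlib

/-- The ideal of `t × t` minors of a matrix over a commutative ring. -/
noncomputable def minorsIdeal {T α β : Type*} [CommRing T] (M : Matrix α β T) (t : ℕ) :
    Ideal T :=
  Ideal.span (Set.range fun p : (Fin t ↪ α) × (Fin t ↪ β) =>
    (M.submatrix (⇑p.1) (⇑p.2)).det)

/-- The polynomial ring `R = k[X]` in the entries of an `r × s` matrix `X` of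
indeterminates. -/
abbrev detPolyRing (k : Type) [Field k] (r s : ℕ) : Type := MvPolynomial (Fin r × Fin s) k

/-- The generic `r × s` matrix `X` of indeterminates. -/
noncomputable abbrev genericMatrix (k : Type) [Field k] (r s : ℕ) :
    Matrix (Fin r) (Fin s) (detPolyRing k r s) :=
  Matrix.of fun i j => MvPolynomial.X (i, j)

section

open CategoryTheory Limits Opposite

namespace LocCohTop

section
variable {V : Type*} [Category V] [Abelian V] {ι : Type*} {c : ComplexShape ι}

lemma homologyUnop_hom_naturality {K L : HomologicalComplex Vᵒᵖ c} (ψ : K ⟶ L) (i : ι) :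
    HomologicalComplex.homologyMap ((HomologicalComplex.unopFunctor V c).map ψ.op) i ≫
      (K.homologyUnop i).hom =
    (L.homologyUnop i).hom ≫ (HomologicalComplex.homologyMap ψ i).unop := by
  have h := HomologicalComplex.homologyOp_hom_naturality
    ((HomologicalComplex.unopFunctor V c).map ψ.op) i
  exact (congrArg Quiver.Hom.unop h).symm

end

variable {S : Type} [CommRing S] {X X' : ModuleCat.{0} S} (P : ProjectiveResolution X)
  (P' : ProjectiveResolution X') (Y : ModuleCat.{0} S) (n : ℕ)

/-- The complex of homs out of a projective resolution. -/
noncomputable abbrev homCx : CochainComplex (ModuleCat.{0} S) ℕ := P.complex.linearYonedaObj S Y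

noncomputable def extOfCycle : (homCx P Y).cycles n ⟶
    ((Ext S (ModuleCat.{0} S) n).obj (op X)).obj Y :=
  (homCx P Y).homologyπ n ≫ (P.isoExt n Y).inv

noncomputable def homOfCycle (x : (homCx P Y).cycles n) : P.complex.X n ⟶ Y :=
  (homCx P Y).iCycles n x

lemma extOfCycle_surjective : Function.Surjective (extOfCycle P Y n) := by
  rw [← ModuleCat.epi_iff_surjective]
  unfold extOfCycle
  infer_instance

noncomputable def homCxMap (φ : P'.complex ⟶ P.complex) : homCx P Y ⟶ homCx P' Y :=
  (HomologicalComplex.unopFunctor _ _).map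
    ((((linearYoneda S (ModuleCat.{0} S)).obj Y).rightOp.mapHomologicalComplex _).map φ).op

lemma extOfCycle_naturality (g : X' ⟶ X) (φ : P'.complex ⟶ P.complex)
    (comm : φ.f 0 ≫ P.π.f 0 = P'.π.f 0 ≫ g) :
    extOfCycle P Y n ≫ ((Ext S (ModuleCat.{0} S) n).map g.op).app Y =
      HomologicalComplex.cyclesMap (homCxMap P P' Y φ) n ≫ extOfCycle P' Y n := by
  have h := ProjectiveResolution.isoLeftDerivedObj_hom_naturality g P' P φ comm
    ((linearYoneda S (ModuleCat.{0} S)).obj Y).rightOp n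
  unfold extOfCycle
  rw [← HomologicalComplex.homologyπ_naturality_assoc, Category.assoc]
  congr 1
  have h2 := homologyUnop_hom_naturality
    ((((linearYoneda S (ModuleCat.{0} S)).obj Y).rightOp.mapHomologicalComplex _).map φ) n
  have h3 : (P.isoLeftDerivedObj ((linearYoneda S (ModuleCat S)).obj Y).rightOp n).hom.unop ≫
      ((Ext S (ModuleCat.{0} S) n).map g.op).app Y =
      (HomologicalComplex.homologyMap ((((linearYoneda S (ModuleCat.{0} S)).obj
          Y).rightOp.mapHomologicalComplex _).map φ) n).unop ≫
        (P'.isoLeftDerivedObj ((linearYoneda S (ModuleCat S)).obj Y).rightOp n).hom.unop :=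
    congrArg Quiver.Hom.unop h
  have e (Q : ModuleCat.{0} S) (P : ProjectiveResolution Q) : (P.isoExt (R := S) n Y).inv =
    (HomologicalComplex.homologyUnop _ n).hom ≫
      (P.isoLeftDerivedObj ((linearYoneda S (ModuleCat S)).obj Y).rightOp n).hom.unop := rfl
  rw [e, e]
  refine (Category.assoc _ _ _).trans ((congrArg (fun t => _ ≫ t) h3).trans ?_)
  refine (Category.assoc _ _ _).symm.trans (Eq.trans ?_ (Category.assoc _ _ _))
  exact congrArg (fun t => t ≫ _) h2.symm

lemma extOfCycle_eq_zero_iff (m : ℕ) (x : (homCx P Y).cycles (m + 1)) :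
    extOfCycle P Y (m + 1) x = 0 ↔ ∃ h : P.complex.X m ⟶ Y,
      P.complex.d (m + 1) m ≫ h = homOfCycle P Y (m + 1) x := by
  have hc := (ShortComplex.exact_of_g_is_cokernel (ShortComplex.mk _ _
    ((homCx P Y).toCycles_comp_homologyπ m (m + 1)))
    ((homCx P Y).homologyIsCokernel m (m + 1) (by simp)))
  have inj : Function.Injective ((homCx P Y).iCycles (m + 1)) :=
    (ModuleCat.mono_iff_injective _).1 inferInstance
  have hi (h : (homCx P Y).X m) : (homCx P Y).iCycles (m + 1)
      ((homCx P Y).toCycles m (m + 1) h) = (homCx P Y).d m (m + 1) h := by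
    rw [← ConcreteCategory.comp_apply, HomologicalComplex.toCycles_i]
  have hz (h : (homCx P Y).X m) : (homCx P Y).homologyπ (m + 1)
      ((homCx P Y).toCycles m (m + 1) h) = 0 := by
    rw [← ConcreteCategory.comp_apply, HomologicalComplex.toCycles_comp_homologyπ]
    rfl
  have inj2 : Function.Injective (P.isoExt (R := S) (m + 1) Y).inv :=
    (ModuleCat.mono_iff_injective _).1 inferInstance
  have h0 : extOfCycle P Y (m + 1) x = 0 ↔ (homCx P Y).homologyπ (m + 1) x = 0 := by
    unfold extOfCycle
    rw [ConcreteCategory.comp_apply, map_eq_zero_iff _ inj2]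
  rw [h0]
  constructor
  · intro h
    obtain ⟨y, hy⟩ := (ShortComplex.moduleCat_exact_iff _).1 hc x h
    exact ⟨y, (hi y).symm.trans (congrArg _ hy)⟩
  · rintro ⟨h, hh⟩
    have : x = (homCx P Y).toCycles m (m + 1) h := inj (hh.symm.trans (hi h).symm)
    exact this ▸ hz h

lemma homOfCycle_map (φ : P'.complex ⟶ P.complex) (x : (homCx P Y).cycles n) :
    homOfCycle P' Y n (HomologicalComplex.cyclesMap (homCxMap P P' Y φ) n x) =
      φ.f n ≫ homOfCycle P Y n x := by
  unfold homOfCycle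
  rw [← ConcreteCategory.comp_apply, HomologicalComplex.cyclesMap_i]
  rfl

lemma d_comp_homOfCycle (x : (homCx P Y).cycles n) :
    P.complex.d (n + 1) n ≫ homOfCycle P Y n x = 0 := by
  have := congrArg (fun t => t x) (congrArg ModuleCat.Hom.hom
    ((homCx P Y).iCycles_d n (n + 1)))
  exact this

lemma exists_homOfCycle_eq (f : P.complex.X n ⟶ Y) (hf : P.complex.d (n + 1) n ≫ f = 0) :
    ∃ x, homOfCycle P Y n x = f := by
  have hc := (ShortComplex.exact_of_f_is_kernel (ShortComplex.mk _ _
    ((homCx P Y).iCycles_d n (n + 1)))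
    ((homCx P Y).cyclesIsKernel n (n + 1) (by simp)))
  obtain ⟨y, hy⟩ := (ShortComplex.moduleCat_exact_iff _).1 hc f hf
  exact ⟨y, hy⟩

end LocCohTop

end

namespace LocCohTop

section Torsion
variable {S : Type*} [CommRing S]

/-- The `J`-power torsion submodule. -/
def tor (J : Ideal S) (M : Type*) [AddCommGroup M] [Module S M] : Submodule S M where
  carrier := {m | ∃ n : ℕ, ∀ x ∈ J ^ n, x • m = 0}
  zero_mem' := ⟨0, fun x _ => smul_zero x⟩
  add_mem' := by
    rintro a b ⟨n, hn⟩ ⟨m, hm⟩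
    refine ⟨n + m, fun x hx => ?_⟩
    rw [smul_add, hn x (Ideal.pow_le_pow_right (Nat.le_add_right _ _) hx),
      hm x (Ideal.pow_le_pow_right (Nat.le_add_left _ _) hx), add_zero]
  smul_mem' := by
    rintro r a ⟨n, hn⟩
    exact ⟨n, fun x hx => by rw [smul_comm, hn x hx, smul_zero]⟩

variable {M M' : Type*} [AddCommGroup M] [Module S M] [AddCommGroup M'] [Module S M']

lemma map_mem_tor {J : Ideal S} (g : M →ₗ[S] M') {m : M} (hm : m ∈ tor J M) :
    g m ∈ tor J M' := by
  obtain ⟨n, hn⟩ := hm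
  exact ⟨n, fun x hx => by rw [← map_smul, hn x hx, map_zero]⟩

lemma tor_bot : tor (⊥ : Ideal S) M = ⊤ := by
  refine eq_top_iff.2 fun m _ => ⟨1, fun x hx => ?_⟩
  rw [pow_one, Ideal.mem_bot] at hx
  rw [hx, zero_smul]

lemma pow_sup_le (J J' : Ideal S) (n m : ℕ) : (J ⊔ J') ^ (n + m) ≤ J ^ n ⊔ J' ^ m := by
  exact Ideal.sup_pow_add_le_pow_sup_pow

lemma mem_tor_sup_iff {J : Ideal S} {f : S} {m : M} :
    m ∈ tor (J ⊔ Ideal.span {f}) M ↔ m ∈ tor J M ∧ ∃ n : ℕ, f ^ n • m = 0 := by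
  constructor
  · rintro ⟨n, hn⟩
    exact ⟨⟨n, fun x hx => hn x (Ideal.pow_right_mono le_sup_left n hx)⟩, n,
      hn _ (Ideal.pow_mem_pow (Ideal.mem_sup_right (Ideal.mem_span_singleton_self f)) n)⟩
  · rintro ⟨⟨n, hn⟩, p, hp⟩
    refine ⟨n + p, fun x hx => ?_⟩
    obtain ⟨a, ha, b, hb, rfl⟩ := Submodule.mem_sup.1 (pow_sup_le _ _ n p hx)
    rw [Ideal.span_singleton_pow, Ideal.mem_span_singleton] at hb
    obtain ⟨c, rfl⟩ := hb
    rw [add_smul, hn a ha, mul_comm, mul_smul, hp, smul_zero, add_zero]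

lemma exists_pow_le_annihilator {J : Ideal S} [Module.Finite S M] (g : M →ₗ[S] M')
    (hg : ∀ m, g m ∈ tor J M') : ∃ n : ℕ, ∀ x ∈ J ^ n, ∀ m, x • g m = 0 := by
  obtain ⟨s, hs⟩ := Module.Finite.fg_top (R := S) (M := M)
  choose n hn using hg
  refine ⟨s.sup n, fun x hx m => ?_⟩
  have hm : m ∈ Submodule.span S (s : Set M) := hs ▸ Submodule.mem_top
  induction hm using Submodule.span_induction with
  | mem m h => exact hn m x (Ideal.pow_le_pow_right (Finset.le_sup h) hx)
  | zero => simp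
  | add a b _ _ ha hb => rw [map_add, smul_add, ha, hb, add_zero]
  | smul r a _ ha => rw [map_smul, smul_comm, ha, smul_zero]

end Torsion

section Injective
variable {S : Type} [CommRing S] [IsNoetherianRing S]

lemma injective_tor (J : Ideal S) (Q : Type) [AddCommGroup Q] [Module S Q]
    [Module.Injective S Q] : Module.Injective S (tor J Q) := by
  apply Module.Baer.injective
  intro a g
  obtain ⟨n, hn⟩ := exists_pow_le_annihilator (J := J) ((tor J Q).subtype ∘ₗ g)
    (fun m => (g m).2)
  obtain ⟨k, hk⟩ := Ideal.exists_pow_inf_eq_pow_smul J a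
  have hle : J ^ (n + k) ⊓ a ≤ J ^ n • a := by
    have := hk (n + k) (by lia)
    rw [Nat.add_sub_cancel] at this
    simp only [smul_eq_mul, Ideal.mul_top] at this
    rw [this]
    exact Ideal.mul_mono_right inf_le_right
  let p : a →ₗ[S] S ⧸ (J ^ (n + k)) := (J ^ (n + k)).mkQ ∘ₗ a.subtype
  let g' := (tor J Q).subtype ∘ₗ g
  have hker : LinearMap.ker p ≤ LinearMap.ker g' := by
    intro x hx
    have hx1 : (x : S) ∈ J ^ (n + k) := by
      simpa [p, Ideal.Quotient.eq_zero_iff_mem] using hx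
    have hx2 := hle ⟨hx1, x.2⟩
    have key : J ^ n • a ≤ Submodule.map a.subtype (LinearMap.ker g') := by
      refine Submodule.smul_le.2 fun r hr m hm => ⟨r • ⟨m, hm⟩, ?_, rfl⟩
      rw [SetLike.mem_coe, LinearMap.mem_ker, map_smul]
      exact hn r hr _
    obtain ⟨y, hy, hyx⟩ := key hx2
    exact (Subtype.ext hyx : y = x) ▸ hy
  obtain ⟨h, hh⟩ := Module.Injective.out ((LinearMap.ker p).liftQ p le_rfl)
    (LinearMap.ker_eq_bot.1 (Submodule.ker_liftQ_eq_bot _ _ _ le_rfl))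
    ((LinearMap.ker p).liftQ g' hker)
  refine ⟨LinearMap.codRestrict _ (h ∘ₗ (J ^ (n + k)).mkQ) fun c => ⟨n + k, fun x hx => ?_⟩,
    fun x hx => ?_⟩
  · rw [← map_smul, LinearMap.comp_apply]
    have : (J ^ (n + k)).mkQ (x • c) = 0 := by
      rw [Submodule.mkQ_apply, Submodule.Quotient.mk_eq_zero]
      exact Ideal.mul_mem_right _ _ hx
    rw [this, map_zero]
  · have := hh (Submodule.Quotient.mk ⟨x, hx⟩)
    exact Subtype.ext this

omit [IsNoetherianRing S] in
lemma exists_smul_eq_of_injective [IsDomain S] (Q : Type) [AddCommGroup Q] [Module S Q]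
    [Module.Injective S Q] (f : S) (hf : f ≠ 0) (y : Q) : ∃ y', f • y' = y := by
  obtain ⟨h, hh⟩ := Module.Injective.out (LinearMap.mulLeft S f)
    (mul_right_injective₀ hf) (LinearMap.toSpanSingleton S Q y)
  exact ⟨h 1, by have := hh 1; simpa [← map_smul] using this⟩

lemma exists_smul_eq_of_mem_tor [IsDomain S] (J : Ideal S) {Q : Type} [AddCommGroup Q]
    [Module S Q] [Module.Injective S Q] {f : S} (hf : f ≠ 0) {y : Q} (hy : y ∈ tor J Q) :
    ∃ y' ∈ tor J Q, f • y' = y := by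
  have := injective_tor J Q
  obtain ⟨y', h⟩ := exists_smul_eq_of_injective (tor J Q) f hf ⟨y, hy⟩
  exact ⟨y', y'.2, congrArg Subtype.val h⟩

end Injective
end LocCohTop

namespace LocCohTop

section Cech
variable {S : Type*} [CommRing S] {K : Type*} [AddCommGroup K] [Module S K]

/-- The elements that some power of `f` multiplies into `A`. -/
def sat (f : S) (A : Submodule S K) : Submodule S K where
  carrier := {c | ∃ m : ℕ, f ^ m • c ∈ A}
  zero_mem' := ⟨0, by simp⟩
  add_mem' := by
    rintro a b ⟨n, hn⟩ ⟨m, hm⟩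
    refine ⟨n + m, ?_⟩
    rw [smul_add]
    refine A.add_mem ?_ ?_
    · rw [pow_add, mul_comm, mul_smul]; exact A.smul_mem _ hn
    · rw [pow_add, mul_smul]; exact A.smul_mem _ hm
  smul_mem' := by
    rintro r a ⟨n, hn⟩
    exact ⟨n, by rw [smul_comm]; exact A.smul_mem _ hn⟩

lemma le_sat (f : S) (A : Submodule S K) : A ≤ sat f A := fun c hc => ⟨0, by simpa using hc⟩

lemma sat_mono (f : S) {A A' : Submodule S K} (h : A ≤ A') : sat f A ≤ sat f A' :=
  fun _ ⟨m, hm⟩ => ⟨m, h hm⟩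

/-- Numerators: the localisation of `A₀` at the elements of a list. -/
def topA (A₀ : Submodule S K) : List S → Submodule S K
  | [] => A₀
  | f :: L => sat f (topA A₀ L)

/-- The sum of the localisations omitting one element of the list. -/
def topB (A₀ : Submodule S K) : List S → Submodule S K
  | [] => ⊥
  | f :: L => sat f (topB A₀ L) ⊔ topA A₀ L

lemma topB_le_topA (A₀ : Submodule S K) : ∀ L, topB A₀ L ≤ topA A₀ L
  | [] => bot_le
  | f :: L => sup_le (sat_mono f (topB_le_topA A₀ L)) (le_sat f _)

/-- The ideal generated by a list. -/
def listIdeal : List S → Ideal S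
  | [] => ⊥
  | f :: L => listIdeal L ⊔ Ideal.span {f}

lemma listIdeal_eq (L : List S) : listIdeal L = Ideal.span {f | f ∈ L} := by
  induction L with
  | nil => simp [listIdeal]
  | cons f L ih =>
    rw [listIdeal, ih, ← Ideal.span_union]
    congr 1
    ext x
    simp

end Cech

section Corr
variable {S : Type} [CommRing S] [IsNoetherianRing S] [IsDomain S]
  {K : Type} [AddCommGroup K] [Module S K]
  {Q : ℕ → Type} [∀ n, AddCommGroup (Q n)] [∀ n, Module S (Q n)]
  (d : ∀ n, Q n →ₗ[S] Q (n + 1))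

/-- Boundaries of torsion elements. -/
def torBd (J : Ideal S) : ∀ n, Submodule S (Q n)
  | 0 => ⊥
  | n + 1 => (tor J (Q n)).map (d n)

/-- A correspondence inducing an isomorphism between the `n`-th cohomology of the `J`-torsion
of `Q` and `A / B`. -/
structure IsCorr (J : Ideal S) (n : ℕ) (Γ : Submodule S (Q n × K)) (A B : Submodule S K) :
    Prop where
  fst_iff : ∀ z, (∃ a, (z, a) ∈ Γ) ↔ z ∈ tor J (Q n) ∧ d n z = 0
  snd_iff : ∀ a, (∃ z, (z, a) ∈ Γ) ↔ a ∈ A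
  right_zero : ∀ z, (z, 0) ∈ Γ ↔ z ∈ torBd d J n
  left_zero : ∀ a, (0, a) ∈ Γ ↔ a ∈ B

variable {d}

lemma exists_eq_d [∀ n, Module.Injective S (Q n)]
    (hex : ∀ n z, d (n + 1) z = 0 → ∃ y, d n y = z) (hdd : ∀ n z, d (n + 1) (d n z) = 0)
    (L : List S) (hL : ∀ f ∈ L, f ≠ 0) :
    ∀ n, L.length ≤ n → ∀ z ∈ tor (listIdeal L) (Q (n + 1)), d (n + 1) z = 0 →
      ∃ y ∈ tor (listIdeal L) (Q n), d n y = z := by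
  induction L with
  | nil =>
    intro n _ z _ h
    obtain ⟨y, hy⟩ := hex n z h
    exact ⟨y, by rw [listIdeal, tor_bot]; trivial, hy⟩
  | cons f L ih =>
    intro n hn z hz h
    have hf : f ≠ 0 := hL f (by simp)
    replace ih := ih fun g hg => hL g (by simp [hg])
    rw [listIdeal, mem_tor_sup_iff] at hz
    obtain ⟨hz, m, hm⟩ := hz
    obtain ⟨n, rfl⟩ : ∃ n', n = n' + 1 := ⟨n - 1, by simp at hn; lia⟩
    simp only [List.length_cons, add_le_add_iff_right] at hn
    obtain ⟨y, hy, rfl⟩ := ih (n + 1) (by lia) z hz h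
    obtain ⟨x, hx, hxy⟩ := ih n hn (f ^ m • y) (Submodule.smul_mem _ _ hy)
      (by rw [map_smul, hm])
    obtain ⟨x', hx', hxx⟩ := exists_smul_eq_of_mem_tor (listIdeal L) (pow_ne_zero m hf) hx
    refine ⟨y - d n x', ?_, by rw [map_sub, hdd, sub_zero]⟩
    rw [listIdeal, mem_tor_sup_iff]
    refine ⟨sub_mem hy (map_mem_tor _ hx'), m, ?_⟩
    rw [smul_sub, ← map_smul, hxx, hxy, sub_self]

lemma exists_torsion_of_smul_mem_torBd [∀ n, Module.Injective S (Q n)]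
    (hdd : ∀ n z, d (n + 1) (d n z) = 0) {J : Ideal S} {f : S} (hf : f ≠ 0) {m : ℕ} {n : ℕ}
    {y : Q n} (hy : y ∈ tor J (Q n)) (h : f ^ m • y ∈ torBd d J n) :
    ∃ y' ∈ tor J (Q n), f ^ m • y' = 0 ∧ d n y' = d n y := by
  cases n with
  | zero => exact ⟨y, hy, h, rfl⟩
  | succ n =>
    obtain ⟨x, hx, hxy⟩ := h
    obtain ⟨x', hx', rfl⟩ := exists_smul_eq_of_mem_tor J (pow_ne_zero m hf) hx
    refine ⟨y - d n x', sub_mem hy (map_mem_tor _ hx'), ?_, by rw [map_sub, hdd, sub_zero]⟩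
    rw [smul_sub, ← hxy, map_smul, sub_self]

lemma exists_isCorr [∀ n, Module.Injective S (Q n)]
    (hex : ∀ n z, d (n + 1) z = 0 → ∃ y, d n y = z) (hdd : ∀ n z, d (n + 1) (d n z) = 0)
    (ε : S →ₗ[S] Q 0) (hε : Function.Injective ε) (hε' : ∀ z, d 0 z = 0 ↔ ∃ s, ε s = z)
    (φ : S →ₗ[S] K) (hφ : Function.Injective φ)
    (hK : ∀ f : S, f ≠ 0 → Function.Bijective fun c : K => f • c)
    (L : List S) (hL : ∀ f ∈ L, f ≠ 0) :
    ∃ Γ : Submodule S (Q L.length × K), IsCorr d (listIdeal L) L.length Γ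
      (topA (LinearMap.range φ) L) (topB (LinearMap.range φ) L) := by
  induction L with
  | nil =>
    refine ⟨LinearMap.range (ε.prod φ), ?_, ?_, ?_, ?_⟩
    · intro z
      simp only [List.length_nil, listIdeal, tor_bot, Submodule.mem_top, true_and, hε']
      constructor
      · rintro ⟨a, s, hs⟩
        exact ⟨s, congrArg Prod.fst hs⟩
      · rintro ⟨s, hs⟩
        exact ⟨φ s, s, Prod.ext hs rfl⟩
    · intro a
      constructor
      · rintro ⟨a, s, hs⟩
        exact ⟨s, congrArg Prod.snd hs⟩
      · rintro ⟨s, hs⟩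
        exact ⟨ε s, s, Prod.ext rfl hs⟩
    · intro z
      constructor
      · rintro ⟨s, hs⟩
        have h1 : φ s = 0 := congrArg Prod.snd hs
        have h2 : ε s = z := congrArg Prod.fst hs
        rw [(map_eq_zero_iff φ hφ).1 h1, map_zero] at h2
        exact h2.symm
      · rintro (rfl : z = 0)
        exact zero_mem _
    · intro z
      constructor
      · rintro ⟨s, hs⟩
        have h1 : φ s = z := congrArg Prod.snd hs
        have h2 : ε s = 0 := congrArg Prod.fst hs
        rw [(map_eq_zero_iff ε hε).1 h2, map_zero] at h1
        exact h1.symm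
      · rintro (rfl : z = 0)
        exact zero_mem _
  | cons f L ih =>
    have hf : f ≠ 0 := hL f (by simp)
    have hL' : ∀ g ∈ L, g ≠ 0 := fun g hg => hL g (by simp [hg])
    obtain ⟨Γ, hΓ⟩ := ih hL'
    have hpow (m n : ℕ) (y : Q L.length) (c : K) (h : (f ^ m • y, f ^ m • c) ∈ Γ) :
        (f ^ (n + m) • y, f ^ (n + m) • c) ∈ Γ := by
      rw [pow_add, mul_smul, mul_smul]
      exact Γ.smul_mem (f ^ n) h
    let Γ' : Submodule S (Q (L.length + 1) × K) :=
      { carrier := {p | ∃ y ∈ tor (listIdeal L) (Q L.length), d _ y = p.1 ∧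
          ∃ m : ℕ, (f ^ m • y, f ^ m • p.2) ∈ Γ}
        zero_mem' := ⟨0, zero_mem _, map_zero _, 0, by
          simpa using (show ((0 : Q L.length), (0 : K)) ∈ Γ from Γ.zero_mem)⟩
        add_mem' := by
          rintro p q ⟨y, hy, hyp, m, hm⟩ ⟨z, hz, hzq, n, hn⟩
          refine ⟨y + z, add_mem hy hz, by rw [map_add, hyp, hzq]; rfl, n + m, ?_⟩
          have h1 := hpow m n _ _ hm
          have h2 := hpow n m _ _ hn
          rw [add_comm m n] at h2
          have := Γ.add_mem h1 h2
          simpa [smul_add] using this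
        smul_mem' := by
          rintro r p ⟨y, hy, hyp, m, hm⟩
          refine ⟨r • y, Submodule.smul_mem _ _ hy, by rw [map_smul, hyp]; rfl, m, ?_⟩
          rw [smul_comm, Prod.smul_snd, smul_comm _ r p.2]
          exact Γ.smul_mem r hm }
    have mem (p) : p ∈ Γ' ↔ ∃ y ∈ tor (listIdeal L) (Q L.length), d _ y = p.1 ∧
          ∃ m : ℕ, (f ^ m • y, f ^ m • p.2) ∈ Γ := Iff.rfl
    refine ⟨Γ', ?_, ?_, ?_, ?_⟩
    · intro z
      refine Iff.trans ?_ (and_congr mem_tor_sup_iff Iff.rfl).symm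
      constructor
      · rintro ⟨a, y, hy, hyz, m, hm⟩
        obtain rfl : d _ y = z := hyz
        refine ⟨⟨map_mem_tor _ hy, m, ?_⟩, hdd _ _⟩
        rw [← map_smul]
        exact ((hΓ.fst_iff _).1 ⟨_, hm⟩).2
      · rintro ⟨⟨hz, m, hm⟩, hdz⟩
        obtain ⟨y, hy, rfl⟩ := exists_eq_d hex hdd L hL' _ le_rfl z hz hdz
        obtain ⟨b, hb⟩ := (hΓ.fst_iff (f ^ m • y)).2
          ⟨Submodule.smul_mem _ _ hy, by rw [map_smul, hm]⟩
        obtain ⟨c, rfl⟩ := (hK _ (pow_ne_zero m hf)).2 b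
        exact ⟨c, y, hy, rfl, m, hb⟩
    · intro a
      constructor
      · rintro ⟨z, y, hy, hyz, m, hm⟩
        exact ⟨m, (hΓ.snd_iff _).1 ⟨_, hm⟩⟩
      · rintro ⟨m, hm⟩
        obtain ⟨z, hz⟩ := (hΓ.snd_iff _).2 hm
        obtain ⟨y, hy, rfl⟩ := exists_smul_eq_of_mem_tor (listIdeal L) (pow_ne_zero m hf)
          ((hΓ.fst_iff z).1 ⟨_, hz⟩).1
        exact ⟨d _ y, y, hy, rfl, m, hz⟩
    · intro z
      constructor
      · rintro ⟨y, hy, hyz, m, hm⟩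
        obtain rfl : d _ y = z := hyz
        simp only [smul_zero, hΓ.right_zero] at hm
        obtain ⟨y', hy', h0, hyy⟩ := exists_torsion_of_smul_mem_torBd hdd hf hy hm
        exact ⟨y', mem_tor_sup_iff.2 ⟨hy', m, h0⟩, hyy⟩
      · rintro ⟨y, hy, rfl⟩
        obtain ⟨hy, m, hm⟩ := mem_tor_sup_iff.1 hy
        refine ⟨y, hy, rfl, m, ?_⟩
        simpa [hm] using (show ((0 : Q L.length), (0 : K)) ∈ Γ from Γ.zero_mem)
    · intro a
      constructor
      · rintro ⟨y, hy, hyz, m, hm⟩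
        obtain ⟨b, hb⟩ := (hΓ.fst_iff y).2 ⟨hy, hyz⟩
        have h1 : f ^ m • (a - b) ∈ topB (LinearMap.range φ) L := by
          rw [← hΓ.left_zero]
          have := Γ.sub_mem hm (Γ.smul_mem (f ^ m) hb)
          simpa [smul_sub] using this
        rw [← sub_add_cancel a b]
        exact Submodule.add_mem_sup ⟨m, h1⟩ ((hΓ.snd_iff _).1 ⟨_, hb⟩)
      · intro ha
        obtain ⟨b, ⟨m, hm⟩, c, hc, rfl⟩ := Submodule.mem_sup.1 ha
        have h2 : (0, b) ∈ Γ' := ⟨0, zero_mem _, map_zero _, m, by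
          rw [smul_zero]; exact (hΓ.left_zero _).2 hm⟩
        have h3 : (0, c) ∈ Γ' := by
          obtain ⟨z, hz⟩ := (hΓ.snd_iff _).2 hc
          obtain ⟨h4, h5⟩ := (hΓ.fst_iff z).1 ⟨_, hz⟩
          exact ⟨z, h4, h5, 0, by simpa using hz⟩
        have := Γ'.add_mem h2 h3
        simpa using this

end Corr
end LocCohTop

section

open CategoryTheory Limits Opposite

namespace LocCohTop

section ExtRep
variable {S : Type} [CommRing S] {X X' : ModuleCat.{0} S} {Y : ModuleCat.{0} S}
  (P : ProjectiveResolution X) (P' : ProjectiveResolution X') (R : InjectiveResolution Y)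

lemma homOfCycle_add (n : ℕ) (x y : (homCx P Y).cycles n) :
    homOfCycle P Y n (x + y) = homOfCycle P Y n x + homOfCycle P Y n y :=
  map_add ((homCx P Y).iCycles n).hom x y

lemma extMk_congr {n : ℕ} {f g : P.complex.X n ⟶ Y} (h : f = g) (m : ℕ) (hm : n + 1 = m)
    (hf : P.complex.d m n ≫ f = 0) (hg : P.complex.d m n ≫ g = 0) :
    P.extMk f m hm hf = P.extMk g m hm hg := by
  subst h; rfl

/-- The class `e` of `Ext`, computed by projective resolutions, is represented by the
morphism `g` to an injective resolution. -/
def ExtRep {n : ℕ} (e : ((Ext S (ModuleCat.{0} S) n).obj (op X)).obj Y)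
    (g : X ⟶ R.cocomplex.X n) : Prop :=
  ∃ (hg : g ≫ R.cocomplex.d n (n + 1) = 0) (x : (homCx P Y).cycles n),
    extOfCycle P Y n x = e ∧
    P.extMk (homOfCycle P Y n x) (n + 1) rfl (d_comp_homOfCycle P Y n x) =
      R.extMk g (n + 1) rfl hg

variable {P R} {n : ℕ} {e e' : ((Ext S (ModuleCat.{0} S) n).obj (op X)).obj Y}
    {g g' : X ⟶ R.cocomplex.X n}

lemma ExtRep.add (h : ExtRep P R e g) (h' : ExtRep P R e' g') :
    ExtRep P R (e + e') (g + g') := by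
  obtain ⟨hg, x, hx, hh⟩ := h
  obtain ⟨hg', x', hx', hh'⟩ := h'
  refine ⟨by rw [Preadditive.add_comp, hg, hg', add_zero], x + x', by rw [map_add, hx, hx'], ?_⟩
  rw [← R.add_extMk _ _ _ _ hg hg', ← hh, ← hh', P.add_extMk]
  exact extMk_congr P (homOfCycle_add P n x x') _ _ _ _

lemma ExtRep.map {P' : ProjectiveResolution X'} (h : ExtRep P R e g) (f : X' ⟶ X) :
    ExtRep P' R (((Ext S (ModuleCat.{0} S) n).map f.op).app Y e) (f ≫ g) := by
  obtain ⟨hg, x, hx, hh⟩ := h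
  let φ := ProjectiveResolution.lift f P' P
  have hφ : φ.f 0 ≫ P.π.f 0 = P'.π.f 0 ≫ f := ProjectiveResolution.lift_commutes_zero f P' P
  refine ⟨by rw [Category.assoc, hg, comp_zero],
    HomologicalComplex.cyclesMap (homCxMap P P' Y φ) n x, ?_, ?_⟩
  · have := congrArg (fun t => t x) (congrArg ModuleCat.Hom.hom
      (extOfCycle_naturality P P' Y n f φ hφ))
    rw [← hx]
    exact this.symm
  · rw [← R.mk₀_comp_extMk _ _ _ hg, ← hh,
      P.mk₀_comp_extMk _ _ _ _ (R' := P') (g := f) ⟨φ, hφ⟩]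
    exact extMk_congr P' (homOfCycle_map P P' Y n φ x) _ _ _ _

lemma ExtRep.smul (h : ExtRep P R e g) (r : S) : ExtRep P R (r • e) (r • g) := by
  obtain ⟨hg, x, hx, hh⟩ := h
  have hφ : (r • 𝟙 P.complex : P.complex ⟶ P.complex).f 0 ≫ P.π.f 0 = P.π.f 0 ≫ (r • 𝟙 X) := by
    refine (Linear.smul_comp _ _ _ r (𝟙 _) (P.π.f 0)).trans
      (Eq.trans ?_ (Linear.comp_smul _ _ _ (P.π.f 0) r (𝟙 X)).symm)
    exact congrArg (fun t => r • t) ((Category.id_comp _).trans (Category.comp_id _).symm)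
  refine ⟨by rw [Linear.smul_comp, hg, smul_zero], r • x, by rw [map_smul, hx], ?_⟩
  have h1 := P.mk₀_comp_extMk (homOfCycle P Y n x) (n + 1) rfl (d_comp_homOfCycle P Y n x)
    (R' := P) (g := r • 𝟙 X) ⟨r • 𝟙 _, hφ⟩
  rw [hh, R.mk₀_comp_extMk] at h1
  have h2 : (r • 𝟙 P.complex : P.complex ⟶ P.complex).f n ≫ homOfCycle P Y n x =
      homOfCycle P Y n (r • x) := by
    have := map_smul ((homCx P Y).iCycles n).hom r x
    refine Eq.trans ?_ this.symm
    simp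
    rfl
  have h3 : (r • 𝟙 X) ≫ g = r • g := by simp
  rw [extMk_congr P h2.symm _ _ _ (by rw [h2]; exact d_comp_homOfCycle P Y n _)]
  rw [← h1]
  simp only [h3]

variable (P R) in
lemma exists_extRep_left (e : ((Ext S (ModuleCat.{0} S) n).obj (op X)).obj Y) :
    ∃ g, ExtRep P R e g := by
  obtain ⟨x, hx⟩ := extOfCycle_surjective P Y n e
  obtain ⟨g, hg, h⟩ := R.extMk_surjective
    (P.extMk (homOfCycle P Y n x) (n + 1) rfl (d_comp_homOfCycle P Y n x)) (n + 1) rfl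
  exact ⟨g, hg, x, hx, h.symm⟩

variable (P) in
lemma exists_extRep_right (hg : g ≫ R.cocomplex.d n (n + 1) = 0) :
    ∃ e, ExtRep P R e g := by
  obtain ⟨f, hf, h⟩ := P.extMk_surjective (R.extMk g (n + 1) rfl hg) (n + 1) rfl
  obtain ⟨x, hx⟩ := exists_homOfCycle_eq P Y n f hf
  exact ⟨_, hg, x, rfl, (extMk_congr P hx _ _ _ hf).trans h⟩

lemma ExtRep.eq_zero_iff {p : ℕ} {e : ((Ext S (ModuleCat.{0} S) (p + 1)).obj (op X)).obj Y}
    {g : X ⟶ R.cocomplex.X (p + 1)} (h : ExtRep P R e g) :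
    e = 0 ↔ ∃ y, y ≫ R.cocomplex.d p (p + 1) = g := by
  obtain ⟨hg, x, hx, hh⟩ := h
  rw [← R.extMk_eq_zero_iff g _ rfl hg p rfl, ← hh, P.extMk_eq_zero_iff _ _ _ _ p rfl, ← hx,
    extOfCycle_eq_zero_iff]

end ExtRep
end LocCohTop

end

section

open CategoryTheory Limits Opposite

namespace LocCohTop

section Legs
variable {S : Type} [CommRing S] (J : Ideal S) (n : ℕ) (Y : ModuleCat.{0} S)

/-- The cyclic module defined by a power of an ideal. -/
abbrev quotPow (t : ℕ) : ModuleCat.{0} S := ModuleCat.of S (S ⧸ J ^ t)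

/-- The projection between the cyclic modules defined by powers of an ideal. -/
def quotPowMap {t t' : ℕ} (h : t ≤ t') : quotPow J t' ⟶ quotPow J t :=
  ModuleCat.ofHom (Submodule.mapQ _ _ LinearMap.id (Ideal.pow_le_pow_right h))

/-- The canonical map to local cohomology from an `Ext` module. -/
noncomputable def leg (t : ℕ) : ((Ext S (ModuleCat.{0} S) n).obj (op (quotPow J t))).obj Y ⟶
    (localCohomology J n).obj Y :=
  (colimit.ι (localCohomology.diagram (localCohomology.idealPowersDiagram J) n) (op (op t))).app Y

noncomputable def isColimitLeg : IsColimit (((evaluation _ _).obj Y).mapCocone (colimit.cocone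
    (localCohomology.diagram (localCohomology.idealPowersDiagram J) n))) :=
  isColimitOfPreserves ((evaluation _ _).obj Y) (colimit.isColimit _)

lemma exists_leg_eq (c : (localCohomology J n).obj Y) : ∃ t e, leg J n Y t e = c := by
  obtain ⟨j, e, h⟩ := Concrete.isColimit_exists_rep _ (isColimitLeg J n Y) c
  exact ⟨j.unop.unop, e, h⟩

lemma exists_map_eq_of_leg_eq {t t' : ℕ} {e e'} (h : leg J n Y t e = leg J n Y t' e') :
    ∃ (u : ℕ) (h : t ≤ u) (h' : t' ≤ u),
      ((Ext S (ModuleCat.{0} S) n).map (quotPowMap J h).op).app Y e =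
      ((Ext S (ModuleCat.{0} S) n).map (quotPowMap J h').op).app Y e' := by
  obtain ⟨k, f, g, h⟩ := Concrete.isColimit_exists_of_rep_eq _ (isColimitLeg J n Y)
    (i := op (op t)) (j := op (op t')) e e' h
  exact ⟨k.unop.unop, f.unop.unop.le, g.unop.unop.le, h⟩

lemma leg_map {t u : ℕ} (h : t ≤ u) (e) :
    leg J n Y u (((Ext S (ModuleCat.{0} S) n).map (quotPowMap J h).op).app Y e) =
      leg J n Y t e := by
  have h1 := colimit.w (localCohomology.diagram (localCohomology.idealPowersDiagram J) n)
    (homOfLE h).op.op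
  have h2 := congrArg (fun a => a.app Y) h1
  exact congrArg (fun a => a e) (congrArg ModuleCat.Hom.hom h2)

end Legs

section LocRep
variable {S : Type} [CommRing S] (J : Ideal S) {Y : ModuleCat.{0} S}
  (R : InjectiveResolution Y)

/-- A class in local cohomology is represented by an element of an injective resolution. -/
def LocRep {n : ℕ} (c : (localCohomology J n).obj Y) (z : R.cocomplex.X n) : Prop :=
  ∃ t e g, leg J n Y t e = c ∧ ExtRep (projectiveResolution (quotPow J t)) R e g ∧
    g (Ideal.Quotient.mk _ 1) = z

variable {J R} {n : ℕ} {c c' : (localCohomology J n).obj Y} {z z' : R.cocomplex.X n}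

lemma quotPow_hom_apply {t : ℕ} {N : ModuleCat.{0} S} (g : quotPow J t ⟶ N) (s : S) :
    g (Ideal.Quotient.mk _ s) = s • g (Ideal.Quotient.mk _ 1) := by
  rw [← map_smul]
  congr 1
  change _ = Submodule.Quotient.mk _
  simp

lemma smul_quotPow_hom_one {t : ℕ} {N : ModuleCat.{0} S} (g : quotPow J t ⟶ N) {x : S}
    (hx : x ∈ J ^ t) : x • g (Ideal.Quotient.mk _ 1) = 0 := by
  rw [← quotPow_hom_apply, Ideal.Quotient.eq_zero_iff_mem.2 hx, map_zero]

lemma exists_quotPow_hom {t : ℕ} {N : ModuleCat.{0} S} (z : N) (hz : ∀ x ∈ J ^ t, x • z = 0) :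
    ∃ g : quotPow J t ⟶ N, g (Ideal.Quotient.mk _ 1) = z := by
  refine ⟨ModuleCat.ofHom (Submodule.liftQ (J ^ t) (LinearMap.toSpanSingleton S N z) ?_), ?_⟩
  · intro x hx
    exact hz x hx
  · exact one_smul S z

lemma quotPow_hom_ext {t : ℕ} {N : ModuleCat.{0} S} {g g' : quotPow J t ⟶ N}
    (h : g (Ideal.Quotient.mk _ 1) = g' (Ideal.Quotient.mk _ 1)) : g = g' := by
  refine ModuleCat.hom_ext (LinearMap.ext fun x => ?_)
  obtain ⟨s, rfl⟩ := Ideal.Quotient.mk_surjective x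
  exact (quotPow_hom_apply g s).trans ((congrArg _ h).trans (quotPow_hom_apply g' s).symm)

lemma LocRep.exists_of_le (h : LocRep J R c z) : ∃ t, ∀ u, t ≤ u → ∃ e g, leg J n Y u e = c ∧
    ExtRep (projectiveResolution (quotPow J u)) R e g ∧ g (Ideal.Quotient.mk _ 1) = z := by
  obtain ⟨t, e, g, he, hg, hz⟩ := h
  refine ⟨t, fun u hu => ⟨_, _, (leg_map J n Y hu e).trans he, hg.map (quotPowMap J hu), hz⟩⟩

lemma LocRep.add (h : LocRep J R c z) (h' : LocRep J R c' z') : LocRep J R (c + c') (z + z') := by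
  obtain ⟨t, h⟩ := h.exists_of_le
  obtain ⟨t', h'⟩ := h'.exists_of_le
  obtain ⟨e, g, he, hg, hz⟩ := h (max t t') (le_max_left _ _)
  obtain ⟨e', g', he', hg', hz'⟩ := h' (max t t') (le_max_right _ _)
  refine ⟨_, e + e', g + g', by rw [map_add, he, he'], hg.add hg', ?_⟩
  rw [← hz, ← hz']
  rfl

lemma LocRep.smul (h : LocRep J R c z) (r : S) : LocRep J R (r • c) (r • z) := by
  obtain ⟨t, e, g, he, hg, hz⟩ := h
  refine ⟨_, r • e, r • g, by rw [map_smul, he], hg.smul r, ?_⟩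
  rw [← hz]
  rfl

variable (J R) in
lemma exists_locRep_left (c : (localCohomology J n).obj Y) : ∃ z, LocRep J R c z := by
  obtain ⟨t, e, he⟩ := exists_leg_eq J n Y c
  obtain ⟨g, hg⟩ := exists_extRep_left (projectiveResolution (quotPow J t)) R e
  exact ⟨_, t, e, g, he, hg, rfl⟩

lemma LocRep.mem (h : LocRep J R c z) :
    z ∈ tor J (R.cocomplex.X n) ∧ R.cocomplex.d n (n + 1) z = 0 := by
  obtain ⟨t, e, g, he, ⟨hg, -⟩, rfl⟩ := h
  refine ⟨⟨t, fun x hx => smul_quotPow_hom_one g hx⟩, ?_⟩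
  rw [← ConcreteCategory.comp_apply, hg]
  rfl

lemma exists_locRep_right (h : z ∈ tor J (R.cocomplex.X n))
    (h' : R.cocomplex.d n (n + 1) z = 0) : ∃ c, LocRep J R c z := by
  obtain ⟨t, ht⟩ := h
  obtain ⟨g, rfl⟩ := exists_quotPow_hom z ht
  obtain ⟨e, he⟩ := exists_extRep_right (projectiveResolution (quotPow J t)) (g := g)
    (quotPow_hom_ext (by rw [ConcreteCategory.comp_apply, h']; rfl))
  exact ⟨_, t, e, g, rfl, he, rfl⟩

lemma LocRep.eq_zero_iff {p : ℕ} {c : (localCohomology J (p + 1)).obj Y}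
    {z : R.cocomplex.X (p + 1)} (h : LocRep J R c z) :
    c = 0 ↔ ∃ y ∈ tor J (R.cocomplex.X p), R.cocomplex.d p (p + 1) y = z := by
  constructor
  · rintro rfl
    obtain ⟨t, e, g, he, hg, rfl⟩ := h
    obtain ⟨u, hu, hu', h2⟩ := exists_map_eq_of_leg_eq J (p + 1) Y (t := t) (t' := t) (e' := 0)
      (he.trans (map_zero _).symm)
    rw [map_zero] at h2
    obtain ⟨y, hy⟩ := ((hg.map (P' := projectiveResolution (quotPow J u))
      (quotPowMap J hu)).eq_zero_iff).1 h2
    refine ⟨y (Ideal.Quotient.mk _ 1), ⟨u, fun x hx => smul_quotPow_hom_one y hx⟩, ?_⟩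
    rw [← ConcreteCategory.comp_apply, hy]
    rfl
  · rintro ⟨y, ⟨u, hu⟩, rfl⟩
    obtain ⟨t, h⟩ := h.exists_of_le
    obtain ⟨e, g, rfl, hg, hz⟩ := h (max t u) (le_max_left _ _)
    obtain ⟨y', hy'⟩ := exists_quotPow_hom (J := J) (t := max t u) y
      fun x hx => hu x (Ideal.pow_le_pow_right (le_max_right _ _) hx)
    have : e = 0 := hg.eq_zero_iff.2 ⟨y', quotPow_hom_ext (by
      rw [ConcreteCategory.comp_apply, hy', hz])⟩
    rw [this, map_zero]

end LocRep
end LocCohTop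

end

section

open CategoryTheory Limits Opposite

namespace LocCohTop

section
variable {S : Type} [CommRing S] {K : Type} [AddCommGroup K] [Module S K]

/-- The top Čech cohomology with respect to a list. -/
abbrev TopQ (A₀ : Submodule S K) (L : List S) : Type :=
  topA A₀ L ⧸ (topB A₀ L).submoduleOf (topA A₀ L)

lemma equiv_of_correspondence {C : Type} [AddCommGroup C] [Module S C] (Γ : Submodule S (C × K))
    (A B : Submodule S K) (h1 : ∀ c, ∃ a, (c, a) ∈ Γ) (h2 : ∀ a, (∃ c, (c, a) ∈ Γ) ↔ a ∈ A)
    (h3 : ∀ c, (c, 0) ∈ Γ → c = 0) (h4 : ∀ a, (0, a) ∈ Γ ↔ a ∈ B) :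
    Nonempty (C ≃ₗ[S] A ⧸ B.submoduleOf A) := by
  choose f hf using h1
  have key (c a a') (h : (c, a) ∈ Γ) (h' : (c, a') ∈ Γ) : a - a' ∈ B := by
    rw [← h4]
    simpa using Γ.sub_mem h h'
  let F : C →ₗ[S] A ⧸ B.submoduleOf A :=
    { toFun := fun c => Submodule.Quotient.mk ⟨f c, (h2 _).1 ⟨c, hf c⟩⟩
      map_add' := fun c c' => by
        rw [← Submodule.Quotient.mk_add, Submodule.Quotient.eq]
        exact key (c + c') _ _ (hf _) (Γ.add_mem (hf c) (hf c'))
      map_smul' := fun r c => by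
        rw [RingHom.id_apply, ← Submodule.Quotient.mk_smul, Submodule.Quotient.eq]
        exact key (r • c) _ _ (hf _) (Γ.smul_mem r (hf c)) }
  refine ⟨LinearEquiv.ofBijective F ⟨?_, ?_⟩⟩
  · rw [← LinearMap.ker_eq_bot, LinearMap.ker_eq_bot']
    intro c hc
    have : f c ∈ B := (Submodule.Quotient.mk_eq_zero (B.submoduleOf A)).1 hc
    apply h3
    simpa using Γ.sub_mem (hf c) ((h4 _).2 this)
  · intro q
    obtain ⟨⟨a, ha⟩, rfl⟩ := Submodule.Quotient.mk_surjective _ q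
    obtain ⟨c, hc⟩ := (h2 a).2 ha
    exact ⟨c, (Submodule.Quotient.eq _).2 (key c _ _ (hf c) hc)⟩

end

section
variable {S : Type} [CommRing S] [IsNoetherianRing S] [IsDomain S]
  {K : Type} [AddCommGroup K] [Module S K]

theorem exists_localCohomology_equiv (φ : S →ₗ[S] K) (hφ : Function.Injective φ)
    (hK : ∀ f : S, f ≠ 0 → Function.Bijective fun c : K => f • c)
    (L : List S) (hL : ∀ f ∈ L, f ≠ 0) (hne : L ≠ []) :
    Nonempty ((localCohomology (listIdeal L) L.length).obj (ModuleCat.of S S) ≃ₗ[S]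
      TopQ (LinearMap.range φ) L) := by
  obtain ⟨p, hp⟩ : ∃ p, L.length = p + 1 :=
    ⟨L.length - 1, by have := List.length_pos_iff.2 hne; lia⟩
  let R := injectiveResolution (ModuleCat.of S S)
  let Q : ℕ → Type := fun n => R.cocomplex.X n
  let d : ∀ n, Q n →ₗ[S] Q (n + 1) := fun n => (R.cocomplex.d n (n + 1)).hom
  have hinj (n) : Module.Injective S (Q n) :=
    (Module.injective_iff_injective_object S (Q n)).2 (R.injective n)
  have hdd (n : ℕ) (z : Q n) : d (n + 1) (d n z) = 0 := by
    have := R.cocomplex.d_comp_d n (n + 1) (n + 2)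
    exact congrArg (fun t => t.hom z) this
  have hex (n : ℕ) (z : Q (n + 1)) (h : d (n + 1) z = 0) : ∃ y, d n y = z :=
    (ShortComplex.moduleCat_exact_iff _).1 (R.exact_succ n) z h
  let ε : S →ₗ[S] Q 0 := (R.ι.f 0).hom
  have hε : Function.Injective ε := (ModuleCat.mono_iff_injective (R.ι.f 0)).1 inferInstance
  have hε' (z : Q 0) : d 0 z = 0 ↔ ∃ s, ε s = z := by
    constructor
    · intro h
      exact (ShortComplex.moduleCat_exact_iff _).1 R.exact₀ z h
    · rintro ⟨s, rfl⟩
      have := R.ι_f_zero_comp_complex_d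
      exact congrArg (fun t => t.hom s) this
  obtain ⟨Γ, hΓ⟩ := exists_isCorr (d := d) hex hdd ε hε hε' φ hφ hK L hL
  let Γ' : Submodule S ((localCohomology (listIdeal L) L.length).obj (ModuleCat.of S S) × K) :=
    { carrier := {q | ∃ z : Q L.length, LocRep (listIdeal L) R q.1 z ∧ (z, q.2) ∈ Γ}
      zero_mem' := ⟨0, by
        obtain ⟨z, hz⟩ := exists_locRep_left (listIdeal L) R
          (0 : (localCohomology (listIdeal L) L.length).obj (ModuleCat.of S S))
        have := hz.smul 0
        rw [zero_smul, zero_smul] at this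
        exact this, Γ.zero_mem⟩
      add_mem' := by
        rintro q q' ⟨z, hz, h⟩ ⟨z', hz', h'⟩
        exact ⟨z + z', hz.add hz', Γ.add_mem h h'⟩
      smul_mem' := by
        rintro r q ⟨z, hz, h⟩
        exact ⟨r • z, hz.smul r, Γ.smul_mem r h⟩ }
  have hzero (c) (z : Q L.length) (h : LocRep (listIdeal L) R c z) :
      c = 0 ↔ z ∈ torBd d (listIdeal L) L.length := by
    clear_value Γ'
    clear hΓ Γ' Γ
    revert c z
    rw [hp]
    intro c z h
    rw [h.eq_zero_iff]
    rfl
  refine equiv_of_correspondence Γ' _ _ ?_ ?_ ?_ ?_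
  · intro c
    obtain ⟨z, hz⟩ := exists_locRep_left (listIdeal L) R c
    obtain ⟨a, ha⟩ := (hΓ.fst_iff z).2 hz.mem
    exact ⟨a, z, hz, ha⟩
  · intro a
    rw [← hΓ.snd_iff]
    constructor
    · rintro ⟨c, z, -, h⟩
      exact ⟨z, h⟩
    · rintro ⟨z, h⟩
      obtain ⟨h1, h2⟩ := (hΓ.fst_iff z).1 ⟨a, h⟩
      obtain ⟨c, hc⟩ := exists_locRep_right h1 h2
      exact ⟨c, z, hc, h⟩
  · rintro c ⟨z, hz, h⟩
    exact (hzero c z hz).2 ((hΓ.right_zero z).1 h)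
  · intro a
    constructor
    · rintro ⟨z, hz, h⟩
      have h1 := (hΓ.right_zero z).2 ((hzero _ z hz).1 rfl)
      rw [← hΓ.left_zero]
      simpa using Γ.sub_mem h h1
    · intro h
      exact ⟨0, (zero_mem Γ' : _).elim fun z hz => by
        have := hz.1.smul 0
        rw [zero_smul, zero_smul] at this
        exact this, (hΓ.left_zero a).2 h⟩

theorem exists_localCohomology_equiv_of_radical_eq (φ : S →ₗ[S] K) (hφ : Function.Injective φ)
    (hK : ∀ f : S, f ≠ 0 → Function.Bijective fun c : K => f • c)
    (L : List S) (hL : ∀ f ∈ L, f ≠ 0) (hne : L ≠ []) (I : Ideal S)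
    (hI : I.radical = (listIdeal L).radical) (n : ℕ) (hn : n = L.length) :
    Nonempty ((localCohomology I n).obj (ModuleCat.of S S) ≃ₗ[S]
      TopQ (LinearMap.range φ) L) := by
  subst hn
  obtain ⟨e⟩ := exists_localCohomology_equiv φ hφ hK L hL hne
  exact ⟨((localCohomology.isoOfSameRadical hI L.length).app
    (ModuleCat.of S S)).toLinearEquiv.trans e⟩

end
end LocCohTop

end

namespace LocCohTop

section Pivot

/-- In a family of finite sets with the exchange property there is a strict minimizer of every
injective weight. -/
lemma exists_strict_minimizer {ι : Type*} [Fintype ι] [DecidableEq ι] (P : Finset ι → Prop)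
    (hex : ∀ S S', P S → P S' → ∀ j ∈ S, j ∉ S' → ∃ i ∈ S', i ∉ S ∧ P (insert i (S.erase j)))
    (w : ι → ℤ) (hw : Function.Injective w) (hP : ∃ S, P S) :
    ∃ S, P S ∧ ∀ S', P S' → S' ≠ S → ∑ i ∈ S, w i < ∑ i ∈ S', w i := by
  classical
  have huniq : ∀ S S', P S → P S' → (∀ T, P T → ∑ i ∈ S, w i ≤ ∑ i ∈ T, w i) →
      (∀ T, P T → ∑ i ∈ S', w i ≤ ∑ i ∈ T, w i) → S' = S := by
    intro S S' hS hS' hm hm'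
    by_contra hne
    have hne' : (symmDiff S S').Nonempty := by
      rw [Finset.nonempty_iff_ne_empty, Ne, ← Finset.bot_eq_empty, symmDiff_eq_bot]
      exact fun h => hne h.symm
    obtain ⟨j, hj, hjm⟩ := Finset.exists_max_image _ w hne'
    have key : ∀ S S', P S → P S' → (∀ T, P T → ∑ i ∈ S, w i ≤ ∑ i ∈ T, w i) → j ∈ S → j ∉ S' →
        (∀ i ∈ symmDiff S S', w i ≤ w j) → False := by
      intro S S' hS hS' hm hjS hjS' hjm
      obtain ⟨i, hi, hiS, hPi⟩ := hex S S' hS hS' j hjS hjS'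
      have h1 := hm _ hPi
      rw [Finset.sum_insert (by simp [hiS]), ← Finset.add_sum_erase S w hjS] at h1
      have h2 := hjm i (by simp [Finset.mem_symmDiff, hi, hiS])
      have h3 : w i ≠ w j := fun h => hiS (hw h ▸ hjS)
      omega
    rcases Finset.mem_symmDiff.1 hj with ⟨h1, h2⟩ | ⟨h1, h2⟩
    · exact key S S' hS hS' hm h1 h2 hjm
    · exact key S' S hS' hS hm' h1 h2 fun i hi => hjm i (by rwa [symmDiff_comm])
  obtain ⟨S0, hS0⟩ := hP
  obtain ⟨S, hS, hSm⟩ := Finset.exists_min_image (Finset.univ.filter P) (fun S => ∑ i ∈ S, w i)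
    ⟨S0, by simpa using hS0⟩
  simp only [Finset.mem_filter, Finset.mem_univ, true_and] at hS hSm
  refine ⟨S, hS, fun S' hS' hne => lt_of_le_of_ne (hSm _ hS') fun h => hne ?_⟩
  exact huniq S S' hS hS' hSm fun T hT => h ▸ hSm T hT

variable {r s : ℕ}

/-- The sum of the maximal minors whose columns add up to `t` plus the least possible value. -/
noncomputable def minorSum {T : Type*} [CommRing T] (M : Matrix (Fin r) (Fin s) T) (t : ℕ) : T :=
  ∑ S : Fin r ↪o Fin s with ∑ i, (S i : ℕ) = t + ∑ i : Fin r, (i : ℕ), (M.submatrix id S).det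

variable {F : Type*} [Field F]

/-- Column bases of a matrix. -/
def IsColBasis (M : Matrix (Fin r) (Fin s) F) (S : Finset (Fin s)) : Prop :=
  S.card = r ∧ LinearIndepOn F M.col (S : Set (Fin s))

lemma IsColBasis.span_eq {M : Matrix (Fin r) (Fin s) F} {S : Finset (Fin s)}
    (h : IsColBasis M S) : Submodule.span F (M.col '' S) = ⊤ := by
  apply Submodule.eq_top_of_finrank_eq
  have h2 := finrank_span_eq_card h.2
  rw [← Set.image_eq_range] at h2
  simpa [h.1] using h2

lemma IsColBasis.exchange {M : Matrix (Fin r) (Fin s) F} (S S' : Finset (Fin s))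
    (h : IsColBasis M S) (h' : IsColBasis M S') (j : Fin s) (hj : j ∈ S) (hj' : j ∉ S') :
    ∃ i ∈ S', i ∉ S ∧ IsColBasis M (insert i (S.erase j)) := by
  have hlt : Submodule.span F (M.col '' (S.erase j)) ≠ ⊤ := by
    intro htop
    have h1 := h.2.notMem_span (i := j) hj
    rw [← Finset.coe_erase, htop] at h1
    exact h1 trivial
  have : ∃ i ∈ S', M.col i ∉ Submodule.span F (M.col '' (S.erase j)) := by
    by_contra! hc
    apply hlt
    rw [eq_top_iff, ← h'.span_eq, Submodule.span_le]
    rintro _ ⟨i, hi, rfl⟩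
    exact hc i hi
  obtain ⟨i, hi, hiS⟩ := this
  have hiS' : i ∉ S := fun hh => hiS (Submodule.subset_span ⟨i,
    Finset.mem_coe.2 (Finset.mem_erase.2 ⟨fun e => hj' (e ▸ hi), hh⟩), rfl⟩)
  refine ⟨i, hi, hiS', ?_, ?_⟩
  · rw [Finset.card_insert_of_notMem (by simp [hiS']), Finset.card_erase_of_mem hj, h.1]
    have := Finset.card_pos.2 ⟨j, hj⟩
    have := h.1
    omega
  · rw [Finset.coe_insert]
    exact (h.2.mono (by simp)).insert hiS

lemma isColBasis_map (M : Matrix (Fin r) (Fin s) F) (e : Fin r ↪o Fin s) :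
    IsColBasis M (Finset.univ.map e.toEmbedding) ↔ (M.submatrix id e).det ≠ 0 := by
  rw [IsColBasis, Finset.card_map, Finset.card_univ, Fintype.card_fin, ← isUnit_iff_ne_zero,
    ← Matrix.isUnit_iff_isUnit_det, ← Matrix.linearIndependent_cols_iff_isUnit]
  simp only [true_and, Finset.coe_map, Finset.coe_univ, Set.image_univ]
  exact linearIndepOn_range_iff e.injective M.col

lemma exists_orderEmb_of_card {S : Finset (Fin s)} (h : S.card = r) :
    ∃ e : Fin r ↪o Fin s, Finset.univ.map e.toEmbedding = S :=
  ⟨S.orderEmbOfFin h, S.map_orderEmbOfFin_univ h⟩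

lemma sum_map_orderEmb (w : Fin s → ℤ) (e : Fin r ↪o Fin s) :
    ∑ i ∈ Finset.univ.map e.toEmbedding, w i = ∑ i, w (e i) := by
  rw [Finset.sum_map]; rfl

lemma map_orderEmb_injective {e e' : Fin r ↪o Fin s}
    (h : Finset.univ.map e.toEmbedding = Finset.univ.map e'.toEmbedding) : e = e' := by
  have hc : (Finset.univ.map e'.toEmbedding).card = r := by simp
  exact (Finset.orderEmbOfFin_unique' hc (f := e) fun x => by rw [← h]; simp).trans
    (Finset.orderEmbOfFin_unique' hc (f := e') fun x => by simp).symm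

lemma orderEmb_add_le (e : Fin r ↪o Fin s) (i j : Fin r) (hij : i ≤ j) :
    (e i : ℕ) + (j - i : ℕ) ≤ e j := by
  obtain ⟨i, hi⟩ := i
  obtain ⟨j, hj⟩ := j
  simp only [Fin.mk_le_mk] at hij ⊢
  induction j, hij using Nat.le_induction with
  | base => simp
  | succ j hij ih =>
    have h1 := ih (by omega)
    have h2 : e ⟨j, by omega⟩ < e ⟨j + 1, hj⟩ := e.strictMono (by simp)
    have h3 : (e ⟨j, by omega⟩ : ℕ) < e ⟨j + 1, hj⟩ := h2
    omega

lemma le_orderEmb (e : Fin r ↪o Fin s) (i : Fin r) : (i : ℕ) ≤ e i := by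
  have hr := i.2
  have := orderEmb_add_le e ⟨0, by omega⟩ i (by simp [Fin.le_def])
  simp only at this
  omega

lemma orderEmb_le (e : Fin r ↪o Fin s) (i : Fin r) : (e i : ℕ) ≤ (s - r) + i := by
  have hr := i.2
  have := orderEmb_add_le e i ⟨r - 1, by omega⟩ (by simp [Fin.le_def]; omega)
  have := (e ⟨r - 1, by omega⟩).2
  simp only at *
  omega

lemma sum_le_sum_orderEmb (e : Fin r ↪o Fin s) : ∑ i : Fin r, (i : ℕ) ≤ ∑ i, (e i : ℕ) :=
  Finset.sum_le_sum fun i _ => le_orderEmb e i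

lemma sum_orderEmb_le (e : Fin r ↪o Fin s) :
    ∑ i, (e i : ℕ) ≤ r * (s - r) + ∑ i : Fin r, (i : ℕ) := by
  have := Finset.sum_le_sum fun i (_ : i ∈ Finset.univ) => orderEmb_le e i
  rw [Finset.sum_add_distrib] at this
  simpa using this

lemma coe_orderEmb_of_sum_eq (e : Fin r ↪o Fin s)
    (h : ∑ i, (e i : ℕ) = ∑ i : Fin r, (i : ℕ)) (i : Fin r) : (e i : ℕ) = i :=
  ((Finset.sum_eq_sum_iff_of_le fun i _ => le_orderEmb e i).1 h.symm i (Finset.mem_univ i)).symm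

/-- Some sum of minors reduces to the minor of the basis of strictly minimal weight. -/
lemma exists_minorSum_eq_det (M : Matrix (Fin r) (Fin s) F) (w : Fin s → ℤ)
    (hw : Function.Injective w)
    (hww : ∀ e e' : Fin r ↪o Fin s, ∑ i, (e i : ℕ) = ∑ i, (e' i : ℕ) →
      ∑ i, w (e i) = ∑ i, w (e' i))
    (h : ∃ e : Fin r ↪o Fin s, (M.submatrix id e).det ≠ 0) :
    ∃ e : Fin r ↪o Fin s, (M.submatrix id e).det ≠ 0 ∧
      minorSum M (∑ i, (e i : ℕ) - ∑ i : Fin r, (i : ℕ)) = (M.submatrix id e).det ∧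
      ∀ e' : Fin r ↪o Fin s, (M.submatrix id e').det ≠ 0 → e' ≠ e →
        ∑ i, w (e i) < ∑ i, w (e' i) := by
  obtain ⟨e0, he0⟩ := h
  obtain ⟨S, hS, hmin⟩ := exists_strict_minimizer (IsColBasis M) IsColBasis.exchange w hw
    ⟨_, (isColBasis_map M e0).2 he0⟩
  obtain ⟨e, rfl⟩ := exists_orderEmb_of_card hS.1
  have h3 : ∀ e' : Fin r ↪o Fin s, (M.submatrix id e').det ≠ 0 → e' ≠ e →
      ∑ i, w (e i) < ∑ i, w (e' i) := fun e' he' hne => by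
    have := hmin _ ((isColBasis_map M e').2 he') fun hh => hne (map_orderEmb_injective hh)
    rwa [sum_map_orderEmb, sum_map_orderEmb] at this
  refine ⟨e, (isColBasis_map M e).1 hS, ?_, h3⟩
  rw [minorSum, Nat.sub_add_cancel (sum_le_sum_orderEmb e)]
  refine Finset.sum_eq_single_of_mem e (by simp) fun e' he' hne => ?_
  by_contra h0
  have := h3 e' h0 hne
  rw [hww e' e (by simpa using he')] at this
  exact lt_irrefl _ this

lemma exists_minorSum_ne_zero (M : Matrix (Fin r) (Fin s) F)
    (h : ∃ e : Fin r ↪o Fin s, (M.submatrix id e).det ≠ 0) :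
    ∃ t ≤ r * (s - r), minorSum M t ≠ 0 := by
  obtain ⟨e, he, h1, -⟩ := exists_minorSum_eq_det M (fun i => (i : ℕ))
    (fun i j h => by simpa [Fin.ext_iff] using h) (fun e e' h => by exact_mod_cast h) h
  refine ⟨_, ?_, h1 ▸ he⟩
  have := sum_orderEmb_le e
  omega

lemma exists_det_ne_zero_of_minorSum (M : Matrix (Fin r) (Fin s) F) (t : ℕ)
    (h : minorSum M t ≠ 0) : ∃ e : Fin r ↪o Fin s, (M.submatrix id e).det ≠ 0 := by
  obtain ⟨e, -, he⟩ := Finset.exists_ne_zero_of_sum_ne_zero h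
  exact ⟨e, he⟩

lemma entry_eq_zero_of_minorSum (M : Matrix (Fin r) (Fin s) F) (h0 : minorSum M 0 ≠ 0)
    (h : ∀ t, 1 ≤ t → t ≤ r * (s - r) → minorSum M t = 0) (i : Fin r) (j : Fin s)
    (hj : r ≤ j) : M i j = 0 := by
  obtain ⟨e, he, h1, h2⟩ := exists_minorSum_eq_det M (fun i => -((i : ℕ) : ℤ))
    (fun i j h => by simpa [Fin.ext_iff] using h)
    (fun e e' h => by
      rw [Finset.sum_neg_distrib, Finset.sum_neg_distrib]; congr 1; exact_mod_cast h)
    (exists_det_ne_zero_of_minorSum M 0 h0)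
  have hsum : ∑ i, (e i : ℕ) = ∑ i : Fin r, (i : ℕ) := by
    by_contra hne
    have h3 := sum_le_sum_orderEmb e
    have h4 := sum_orderEmb_le e
    exact he (h1 ▸ h _ (by omega) (by omega))
  have huniq (S : Finset (Fin s)) (hS : IsColBasis M S) : j ∉ S := by
    obtain ⟨e', rfl⟩ := exists_orderEmb_of_card hS.1
    have : e' = e := by
      by_contra hne
      have h3 := h2 e' ((isColBasis_map M e').1 hS) hne
      rw [Finset.sum_neg_distrib, Finset.sum_neg_distrib, neg_lt_neg_iff] at h3
      have h4 := sum_le_sum_orderEmb e'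
      rw [← hsum] at h4
      have : ∑ i, (e' i : ℕ) < ∑ i, (e i : ℕ) := by exact_mod_cast h3
      omega
    subst this
    simp only [Finset.mem_map, Finset.mem_univ, true_and, not_exists]
    rintro i rfl
    have h5 := coe_orderEmb_of_sum_eq e' hsum i
    have : (e' i : ℕ) = (e'.toEmbedding i : Fin s) := rfl
    omega
  by_contra hne
  have hcol : M.col j ≠ 0 := fun hc => hne (congrFun hc i)
  obtain ⟨b, -, hb, hspan, hind⟩ := exists_linearIndepOn_extension
    (s := ({j} : Set (Fin s))) (t := Set.univ) (v := M.col) (K := F)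
    (by simpa using hcol) (Set.subset_univ _)
  classical
  refine huniq b.toFinset ⟨?_, by simpa using hind⟩ (by simpa using hb)
  have h3 := (isColBasis_map M e).2 he
  have h4 : Submodule.span F (M.col '' b) = ⊤ := by
    rw [eq_top_iff, ← h3.span_eq, Submodule.span_le]
    exact (Set.image_mono (Set.subset_univ _)).trans hspan
  have h5 := finrank_span_eq_card hind
  rw [← Set.image_eq_range, h4] at h5
  rw [Set.toFinset_card, ← h5]
  simp

end Pivot

end LocCohTop

namespace LocCohTop

section MinorSums

variable {r s : ℕ} {T : Type*} [CommRing T]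

lemma map_minorSum {U : Type*} [CommRing U] (f : T →+* U) (M : Matrix (Fin r) (Fin s) T) (t : ℕ) :
    f (minorSum M t) = minorSum (M.map f) t := by
  simp only [minorSum, map_sum, RingHom.map_det]
  rfl

lemma minorsIdeal_submatrix_perm (M : Matrix (Fin r) (Fin s) T) (σ : Equiv.Perm (Fin s)) :
    minorsIdeal (M.submatrix id σ) r = minorsIdeal M r := by
  unfold minorsIdeal
  congr 1
  ext x
  constructor
  · rintro ⟨⟨p, q⟩, rfl⟩
    exact ⟨⟨p, q.trans σ.toEmbedding⟩, rfl⟩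
  · rintro ⟨⟨p, q⟩, rfl⟩
    exact ⟨⟨p, q.trans σ.symm.toEmbedding⟩, by simp [Function.comp_def]⟩

lemma minorSum_mem_minorsIdeal (M : Matrix (Fin r) (Fin s) T) (t : ℕ) :
    minorSum M t ∈ minorsIdeal M r :=
  sum_mem fun e _ => Ideal.subset_span ⟨⟨Function.Embedding.refl _, e.toEmbedding⟩, rfl⟩

lemma exists_orderEmb_of_embedding {F : Type*} [Field F] (M : Matrix (Fin r) (Fin s) F)
    (p : Fin r ↪ Fin r) (q : Fin r ↪ Fin s) (h : (M.submatrix p q).det ≠ 0) :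
    ∃ e : Fin r ↪o Fin s, (M.submatrix id e).det ≠ 0 := by
  have h1 : (M.submatrix id q).det ≠ 0 := by
    let σ := Equiv.ofBijective p (Finite.injective_iff_bijective.1 p.injective)
    have h2 := Matrix.det_permute σ (M.submatrix id q)
    intro h3
    rw [h3, mul_zero] at h2
    exact h h2
  have hb : IsColBasis M (Finset.univ.map q) := by
    rw [IsColBasis, Finset.card_map, Finset.card_univ, Fintype.card_fin]
    simp only [true_and, Finset.coe_map, Finset.coe_univ, Set.image_univ]
    rw [← isUnit_iff_ne_zero, ← Matrix.isUnit_iff_isUnit_det,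
      ← Matrix.linearIndependent_cols_iff_isUnit] at h1
    exact (linearIndepOn_range_iff q.injective M.col).2 h1
  obtain ⟨e, he⟩ := exists_orderEmb_of_card hb.1
  exact ⟨e, (isColBasis_map M e).1 (he ▸ hb)⟩

/-- The tail of the list of sums of minors. -/
noncomputable def tailSums (M : Matrix (Fin r) (Fin s) T) : List T :=
  (List.range (r * (s - r))).map fun t => minorSum M (t + 1)

lemma length_tailSums (M : Matrix (Fin r) (Fin s) T) : (tailSums M).length = r * (s - r) := by
  simp [tailSums]

lemma mem_tailSums {M : Matrix (Fin r) (Fin s) T} {f : T} :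
    f ∈ tailSums M ↔ ∃ t, 1 ≤ t ∧ t ≤ r * (s - r) ∧ minorSum M t = f := by
  simp only [tailSums, List.mem_map, List.mem_range]
  constructor
  · rintro ⟨t, ht, rfl⟩
    exact ⟨t + 1, by omega, by omega, rfl⟩
  · rintro ⟨t, h1, ht, rfl⟩
    exact ⟨t - 1, by omega, by rw [Nat.sub_add_cancel h1]⟩

lemma radical_span_minorSum (M : Matrix (Fin r) (Fin s) T) :
    (minorsIdeal M r).radical = (Ideal.span {f | f ∈ minorSum M 0 :: tailSums M}).radical := by
  apply le_antisymm
  · rw [Ideal.radical_le_radical_iff, Ideal.radical_eq_sInf (Ideal.span _)]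
    refine le_sInf fun P ⟨hP, hprime⟩ => ?_
    rw [minorsIdeal, Ideal.span_le]
    rintro _ ⟨⟨p, q⟩, rfl⟩
    by_contra hne
    let f : T →+* FractionRing (T ⧸ P) := (algebraMap _ _).comp (Ideal.Quotient.mk P)
    have hf (x : T) : f x = 0 ↔ x ∈ P := by
      rw [RingHom.comp_apply, IsFractionRing.to_map_eq_zero_iff, Ideal.Quotient.eq_zero_iff_mem]
    have h1 : ((M.map f).submatrix p q).det ≠ 0 := by
      rw [Matrix.submatrix_map]
      change (f.mapMatrix _).det ≠ 0
      rw [← RingHom.map_det, Ne, hf]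
      exact hne
    obtain ⟨t, ht, ht0⟩ := exists_minorSum_ne_zero (M.map f) (exists_orderEmb_of_embedding _ p q h1)
    rw [← map_minorSum, Ne, hf] at ht0
    refine ht0 (hP (Ideal.subset_span ?_))
    rcases Nat.eq_zero_or_pos t with rfl | h
    · exact List.mem_cons_self
    · exact List.mem_cons_of_mem _ (mem_tailSums.2 ⟨t, h, ht, rfl⟩)
  · rw [Ideal.radical_le_radical_iff]
    refine le_trans ?_ Ideal.le_radical
    rw [Ideal.span_le]
    intro x hx
    rcases List.mem_cons.1 hx with rfl | hx
    · exact minorSum_mem_minorsIdeal M 0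
    · obtain ⟨t, -, -, rfl⟩ := mem_tailSums.1 hx
      exact minorSum_mem_minorsIdeal M t

lemma entry_mul_minorSum_mem_radical (M : Matrix (Fin r) (Fin s) T) (i : Fin r) (j : Fin s)
    (hj : r ≤ j) :
    M i j * minorSum M 0 ∈ (Ideal.span {f | f ∈ tailSums M}).radical := by
  rw [Ideal.radical_eq_sInf, Submodule.mem_sInf]
  rintro P ⟨hP, hprime⟩
  by_contra hne
  let f : T →+* FractionRing (T ⧸ P) := (algebraMap _ _).comp (Ideal.Quotient.mk P)
  have hf (x : T) : f x = 0 ↔ x ∈ P := by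
    rw [RingHom.comp_apply, IsFractionRing.to_map_eq_zero_iff, Ideal.Quotient.eq_zero_iff_mem]
  have h0 : minorSum (M.map f) 0 ≠ 0 := by
    rw [← map_minorSum, Ne, hf]
    exact fun h => hne (Ideal.mul_mem_left P _ h)
  have := entry_eq_zero_of_minorSum (M.map f) h0 (fun t h1 h2 => by
    rw [← map_minorSum, hf]
    exact hP (Ideal.subset_span (mem_tailSums.2 ⟨t, h1, h2, rfl⟩))) i j hj
  rw [Matrix.map_apply, hf] at this
  exact hne (Ideal.mul_mem_right _ P this)

lemma exists_orderEmb_sum_eq (hrs : r ≤ s) (t : ℕ) (ht : t ≤ r * (s - r)) :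
    ∃ e : Fin r ↪o Fin s, ∑ i, (e i : ℕ) = t + ∑ i : Fin r, (i : ℕ) := by
  induction t with
  | zero => exact ⟨Fin.castLEOrderEmb hrs, by simp⟩
  | succ t ih =>
    obtain ⟨e, he⟩ := ih (by omega)
    have hex : ∃ i : Fin r, (e i : ℕ) < (s - r) + i := by
      by_contra! hc
      have := Finset.sum_le_sum fun i (_ : i ∈ Finset.univ) => hc i
      rw [Finset.sum_add_distrib, he] at this
      simp only [Finset.sum_const, Finset.card_univ, Fintype.card_fin, smul_eq_mul] at this
      omega
    obtain ⟨i, hi, himax⟩ := Finset.exists_max_image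
      (Finset.univ.filter fun i : Fin r => (e i : ℕ) < (s - r) + i) id (by
        obtain ⟨i, hi⟩ := hex
        exact ⟨i, by simpa using hi⟩)
    simp only [Finset.mem_filter, Finset.mem_univ, true_and, id] at hi himax
    have hi' := i.2
    let x : Fin s := ⟨e i + 1, by omega⟩
    have hmono : StrictMono (Function.update e i x) := by
      intro a b hab
      have hlt : (e a : ℕ) < e b := e.strictMono hab
      by_cases ha : a = i
      · subst ha
        have hb : ¬ b ≤ a := not_le.2 hab
        have h1 : ¬ (e b : ℕ) < (s - r) + b := fun h => hb (himax b h)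
        rw [Function.update_self, Function.update_of_ne hab.ne', Fin.lt_def]
        change (e a : ℕ) + 1 < e b
        have : (a : ℕ) < b := hab
        omega
      · rw [Function.update_of_ne ha]
        by_cases hb : b = i
        · subst hb
          rw [Function.update_self, Fin.lt_def]
          change (e a : ℕ) < (e b : ℕ) + 1
          omega
        · rw [Function.update_of_ne hb]
          exact hlt
    refine ⟨OrderEmbedding.ofStrictMono _ hmono, ?_⟩
    rw [← Finset.add_sum_erase _ _ (Finset.mem_univ i)] at he ⊢
    have h2 : ∑ a ∈ Finset.univ.erase i, ((OrderEmbedding.ofStrictMono _ hmono a : Fin s) : ℕ) =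
        ∑ a ∈ Finset.univ.erase i, (e a : ℕ) := Finset.sum_congr rfl fun a ha => by
      change ((Function.update e i x a : Fin s) : ℕ) = _
      rw [Function.update_of_ne (Finset.ne_of_mem_erase ha)]
    have h3 : ((OrderEmbedding.ofStrictMono _ hmono i : Fin s) : ℕ) = e i + 1 := by
      change ((Function.update e i x i : Fin s) : ℕ) = _
      rw [Function.update_self]
    rw [h2, h3]
    omega

lemma exists_matrix_minorSum_eq_one (hrs : r ≤ s) (t : ℕ) (ht : t ≤ r * (s - r)) :
    ∃ M : Matrix (Fin r) (Fin s) T, minorSum M t = 1 := by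
  obtain ⟨e, he⟩ := exists_orderEmb_sum_eq hrs t ht
  refine ⟨Matrix.of fun i j => if j = e i then 1 else 0, ?_⟩
  rw [minorSum, Finset.sum_eq_single_of_mem e (by simp [he])]
  · have : (Matrix.of fun i j => if j = e i then (1 : T) else 0).submatrix id e = 1 := by
      ext i j
      simp [Matrix.one_apply, eq_comm]
    rw [this, Matrix.det_one]
  · intro e' _ hne
    have : ∃ j, ∀ i, e' j ≠ e i := by
      by_contra! hc
      refine hne (map_orderEmb_injective (Finset.eq_of_subset_of_card_le ?_ (by simp)))
      intro x hx
      obtain ⟨j, -, rfl⟩ := Finset.mem_map.1 hx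
      obtain ⟨i, hi⟩ := hc j
      exact Finset.mem_map.2 ⟨i, Finset.mem_univ _, hi.symm⟩
    obtain ⟨j, hj⟩ := this
    exact Matrix.det_eq_zero_of_column_eq_zero j fun i => by simp [hj i]

lemma minorSum_genericMatrix_ne_zero (k : Type) [Field k] (hrs : r ≤ s) (t : ℕ)
    (ht : t ≤ r * (s - r)) : minorSum (genericMatrix k r s) t ≠ 0 := by
  obtain ⟨M, hM⟩ := exists_matrix_minorSum_eq_one (T := k) hrs t ht
  intro h
  have := congrArg (MvPolynomial.eval fun p => M p.1 p.2) h
  rw [map_minorSum, map_zero] at this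
  have h2 : (genericMatrix k r s).map (MvPolynomial.eval fun p => M p.1 p.2) = M := by
    ext i j
    simp
  rw [h2, hM] at this
  exact one_ne_zero this

end MinorSums

end LocCohTop

namespace LocCohTop
open MvPolynomial

section Rise
variable {A : Type*} [Ring A]

/-- Rising factorials in a ring. -/
def rise (T : A) : ℕ → A
  | 0 => 1
  | n + 1 => (T + n) * rise T n

lemma rise_succ' (T : A) : ∀ n, rise T (n + 1) = T * rise (T + 1) n
  | 0 => by simp [rise]
  | n + 1 => by
    rw [rise, rise_succ' T n, rise, ← mul_assoc, ← mul_assoc]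
    congr 1
    push_cast
    rw [add_mul, mul_add, add_mul, mul_add, (Nat.cast_commute n T).eq]
    noncomm_ring

lemma rise_mul_of_comm {T X T' : A} (h : T * X = X * T') : ∀ n, rise T n * X = X * rise T' n
  | 0 => by simp [rise]
  | n + 1 => by
    rw [rise, rise, mul_assoc, rise_mul_of_comm h n, ← mul_assoc, ← mul_assoc, add_mul, h,
      mul_add, (Nat.cast_commute n X).eq]

end Rise

variable {k : Type} [Field k] {σ : Type} [Fintype σ]

/-- Commuting derivations on a module over a polynomial ring, lifting the partial derivatives. -/
structure WeylAction (k : Type) [Field k] (σ : Type) (H : Type) [AddCommGroup H]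
    [Module (MvPolynomial σ k) H] where
  D : σ → Module.End ℤ H
  leibniz : ∀ i (f : MvPolynomial σ k) (h : H), D i (f • h) = pderiv i f • h + f • D i h
  comm : ∀ i j h, D i (D j h) = D j (D i h)

variable {H : Type} [AddCommGroup H] [Module (MvPolynomial σ k) H]

/-- Iterated nilpotency under the variables. -/
def VarNil (k : Type) [Field k] (σ : Type) {H : Type} [AddCommGroup H]
    [Module (MvPolynomial σ k) H] : ℕ → H → Prop
  | 0, h => h = 0
  | n + 1, h => ∀ i : σ, VarNil k σ n ((X i : MvPolynomial σ k) • h)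

/-- The annihilator of all variables in a module. -/
def soc (k : Type) [Field k] (σ : Type) (H : Type) [AddCommGroup H]
    [Module (MvPolynomial σ k) H] : Submodule (MvPolynomial σ k) H where
  carrier := {h | ∀ i : σ, (X i : MvPolynomial σ k) • h = 0}
  zero_mem' := fun i => smul_zero _
  add_mem' := fun ha hb i => by rw [smul_add, ha, hb, add_zero]
  smul_mem' := fun r h hh i => by rw [smul_comm, hh, smul_zero]

omit [Fintype σ] in
lemma mem_soc {h : H} : h ∈ soc k σ H ↔ ∀ i : σ, (X i : MvPolynomial σ k) • h = 0 := Iff.rfl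

omit [Fintype σ] in
lemma exists_soc_of_varNil (V : Submodule (MvPolynomial σ k) H) : ∀ (n : ℕ) {h : H},
    VarNil k σ n h → h ∈ V → h ≠ 0 → ∃ u ∈ V, u ∈ soc k σ H ∧ u ≠ 0
  | 0, h, hn, _, h0 => (h0 hn).elim
  | n + 1, h, hn, hV, h0 => by
    by_cases hs : h ∈ soc k σ H
    · exact ⟨h, hV, hs, h0⟩
    · rw [mem_soc] at hs
      push Not at hs
      obtain ⟨i, hi⟩ := hs
      exact exists_soc_of_varNil V n (hn i) (V.smul_mem _ hV) hi

omit [Fintype σ] in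
lemma varNil_iff (n : ℕ) (h : H) : VarNil k σ n h ↔
    ∀ x ∈ (Ideal.span (Set.range X) : Ideal (MvPolynomial σ k)) ^ n, x • h = 0 := by
  induction n generalizing h with
  | zero =>
    rw [VarNil, pow_zero]
    constructor
    · rintro rfl x -
      exact smul_zero x
    · intro hx
      simpa using hx 1 (by simp)
  | succ n ih =>
    simp only [VarNil, ih]
    constructor
    · intro hh x hx
      rw [pow_succ] at hx
      refine Submodule.mul_induction_on hx ?_ fun a b ha hb => by rw [add_smul, ha, hb, add_zero]
      intro a ha b hb
      refine Submodule.span_induction (p := fun b _ => (a * b) • h = 0) ?_ (by simp)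
        (fun x y _ _ hx hy => by rw [mul_add, add_smul, hx, hy, add_zero])
        (fun c x _ hx => by rw [smul_eq_mul, mul_left_comm, mul_smul, hx, smul_zero]) hb
      rintro _ ⟨i, rfl⟩
      rw [mul_smul]
      exact hh i a ha
    · intro hh i x hx
      rw [← mul_smul]
      exact hh _ (pow_succ (Ideal.span (Set.range (X : σ → MvPolynomial σ k))) n ▸
        Ideal.mul_mem_mul hx (Ideal.subset_span ⟨i, rfl⟩))

lemma varNil_of_pow (n : ℕ) (h : H) (m : σ → ℕ) (hm : ∑ i, m i = n)
    (hX : ∀ i, (X i : MvPolynomial σ k) ^ m i • h = 0) : VarNil k σ (n + 1) h := by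
  classical
  have h0 (n : ℕ) : VarNil k σ n (0 : H) := by
    rw [varNil_iff]
    simp
  induction n generalizing h m with
  | zero =>
    intro i
    have : m i = 0 := by
      have := Finset.sum_eq_zero_iff.1 hm i (Finset.mem_univ i)
      exact this
    have h1 := hX i
    rw [this, pow_zero, one_smul] at h1
    rw [h1, smul_zero]
    exact h0 0
  | succ n ih =>
    intro i
    cases hi : m i with
    | zero =>
      have h1 := hX i
      rw [hi, pow_zero, one_smul] at h1
      rw [h1, smul_zero]
      exact h0 _
    | succ a =>
      refine ih _ (Function.update m i a) ?_ ?_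
      · rw [Finset.sum_update_of_mem (Finset.mem_univ i)]
        have := Finset.add_sum_erase Finset.univ m (Finset.mem_univ i)
        rw [Finset.sdiff_singleton_eq_erase]
        lia
      · intro j
        by_cases hj : j = i
        · subst hj
          rw [Function.update_self, ← mul_smul, ← pow_succ, ← hi, hX]
        · rw [Function.update_of_ne hj, smul_comm, hX, smul_zero]

namespace WeylAction
variable (W : WeylAction k σ H)

/-- Multiplication by a variable. -/
noncomputable def mulX (k : Type) [Field k] {σ : Type} (H : Type) [AddCommGroup H]
    [Module (MvPolynomial σ k) H] (i : σ) : Module.End ℤ H :=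
  (DistribSMul.toAddMonoidHom H (X i : MvPolynomial σ k)).toIntLinearMap

/-- The sum of all `∂ᵢ xᵢ`. -/
noncomputable def euler : Module.End ℤ H := ∑ i, W.D i * mulX k H i

omit [Fintype σ] in
lemma D_mul_mulX_self (i : σ) : W.D i * mulX k H i = mulX k H i * W.D i + 1 := by
  ext h
  change W.D i ((X i : MvPolynomial σ k) • h) = (X i : MvPolynomial σ k) • W.D i h + h
  rw [W.leibniz, pderiv_X_self, one_smul, add_comm]

omit [Fintype σ] in
lemma D_mul_mulX_of_ne {i j : σ} (hij : j ≠ i) :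
    W.D i * mulX k H j = mulX k H j * W.D i := by
  ext h
  change W.D i ((X j : MvPolynomial σ k) • h) = (X j : MvPolynomial σ k) • W.D i h
  rw [W.leibniz, pderiv_X_of_ne hij, zero_smul, zero_add]

omit [Fintype σ] in
lemma mulX_comm (i j : σ) : mulX k H i * mulX k H j = mulX k H j * mulX k H i := by
  ext h
  exact smul_comm (X i : MvPolynomial σ k) (X j : MvPolynomial σ k) h

omit [Fintype σ] in
lemma D_comm (i j : σ) : W.D i * W.D j = W.D j * W.D i := by
  ext h
  exact W.comm i j h

lemma euler_mul_mulX (j : σ) : W.euler * mulX k H j = mulX k H j * (W.euler + 1) := by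
  classical
  rw [euler, mul_add, mul_one, Finset.sum_mul, Finset.mul_sum,
    ← Finset.add_sum_erase _ _ (Finset.mem_univ j),
    ← Finset.add_sum_erase _ (fun i => mulX k H j * (W.D i * mulX k H i)) (Finset.mem_univ j)]
  have h1 : ∑ i ∈ Finset.univ.erase j, W.D i * mulX k H i * mulX k H j =
      ∑ i ∈ Finset.univ.erase j, mulX k H j * (W.D i * mulX k H i) := by
    refine Finset.sum_congr rfl fun i hi => ?_
    rw [mul_assoc, mulX_comm, ← mul_assoc, W.D_mul_mulX_of_ne (Finset.ne_of_mem_erase hi).symm,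
      mul_assoc]
  rw [h1, W.D_mul_mulX_self, add_mul, one_mul, mul_add, mul_one, mul_assoc,
    W.D_mul_mulX_self, mul_add, mul_one]
  abel

lemma D_mul_euler (j : σ) : W.D j * W.euler = (W.euler + 1) * W.D j := by
  classical
  rw [euler, add_mul, one_mul, Finset.sum_mul, Finset.mul_sum,
    ← Finset.add_sum_erase _ _ (Finset.mem_univ j),
    ← Finset.add_sum_erase _ (fun i => W.D i * mulX k H i * W.D j) (Finset.mem_univ j)]
  have h1 : ∑ i ∈ Finset.univ.erase j, W.D j * (W.D i * mulX k H i) =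
      ∑ i ∈ Finset.univ.erase j, W.D i * mulX k H i * W.D j := by
    refine Finset.sum_congr rfl fun i hi => ?_
    rw [mul_assoc, ← W.D_mul_mulX_of_ne (Finset.ne_of_mem_erase hi), ← mul_assoc, ← mul_assoc,
      D_comm]
  have h2 : W.D j * (W.D j * mulX k H j) = W.D j * mulX k H j * W.D j + W.D j := by
    conv_lhs => rw [D_mul_mulX_self, mul_add, mul_one, ← mul_assoc]
  rw [h1, h2]
  abel

lemma euler_apply (h : H) : W.euler h = ∑ i, W.D i ((X i : MvPolynomial σ k) • h) := by
  rw [euler, LinearMap.sum_apply]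
  rfl

lemma euler_eq_zero {u : H} (hu : u ∈ soc k σ H) : W.euler u = 0 := by
  rw [euler_apply]
  exact Finset.sum_eq_zero fun i _ => by rw [hu i, map_zero]

lemma rise_mul_mulX (n : ℕ) (i : σ) (h : H) :
    rise W.euler n ((X i : MvPolynomial σ k) • h) =
      (X i : MvPolynomial σ k) • rise (W.euler + 1) n h :=
  congrArg (fun t : Module.End ℤ H => t h) (rise_mul_of_comm (W.euler_mul_mulX i) n)

lemma rise_succ_apply (n : ℕ) (h : H) :
    rise (W.euler + 1) (n + 1) h =
      W.euler (rise (W.euler + 1) n h) + ((n + 1 : ℕ) : ℤ) • rise (W.euler + 1) n h := by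
  rw [rise, add_assoc, ← Nat.cast_one, ← Nat.cast_add, Nat.add_comm 1 n]
  change W.euler _ + ((n + 1 : ℕ) : Module.End ℤ H) _ = _
  congr 1
  rw [Module.End.natCast_apply, natCast_zsmul]

lemma rise_euler_eq_zero : ∀ (n : ℕ) {h : H}, VarNil k σ n h → rise W.euler n h = 0
  | 0, h, hn => hn
  | n + 1, h, hn => by
    rw [rise_succ']
    refine W.euler_eq_zero fun i => ?_
    rw [← rise_mul_mulX]
    exact rise_euler_eq_zero n (hn i)

lemma rise_mem_soc (n : ℕ) {h : H} (hn : VarNil k σ (n + 1) h) :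
    rise (W.euler + 1) n h ∈ soc k σ H := fun i => by
  rw [← rise_mul_mulX]
  exact W.rise_euler_eq_zero n (hn i)

lemma rise_sub_mem (V : Submodule ℤ H) (h : H) (hV : ∀ n, W.euler (rise (W.euler + 1) n h) ∈ V)
    (n : ℕ) : rise (W.euler + 1) n h - ((n.factorial : ℕ) : ℤ) • h ∈ V := by
  induction n with
  | zero => simp [rise]
  | succ n ih =>
    rw [rise_succ_apply, Nat.factorial_succ, Nat.cast_mul, mul_smul, add_sub_assoc, ← smul_sub]
    exact add_mem (hV n) (V.smul_mem _ ih)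

/-- The sum of the images of the derivations. -/
def imD (W : WeylAction k σ H) : Submodule ℤ H := ⨆ i, LinearMap.range (W.D i)

omit [Fintype σ] in
lemma D_mem_imD (i : σ) (h : H) : W.D i h ∈ W.imD :=
  Submodule.mem_iSup_of_mem i ⟨h, rfl⟩

omit [Fintype σ] in
lemma D_smul_C (i : σ) (c : k) (h : H) :
    W.D i ((C c : MvPolynomial σ k) • h) = (C c : MvPolynomial σ k) • W.D i h := by
  rw [W.leibniz, pderiv_C, zero_smul, zero_add]

omit [Fintype σ] in
lemma C_smul_mem_imD (c : k) {h : H} (hh : h ∈ W.imD) :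
    (C c : MvPolynomial σ k) • h ∈ W.imD := by
  have : W.imD ≤ W.imD.comap (DistribSMul.toAddMonoidHom H
      (C c : MvPolynomial σ k)).toIntLinearMap := by
    conv_lhs => rw [imD]
    refine iSup_le fun i => ?_
    rintro _ ⟨h, rfl⟩
    change (C c : MvPolynomial σ k) • W.D i h ∈ W.imD
    rw [← W.D_smul_C]
    exact W.D_mem_imD _ _
  exact this hh

omit [Fintype σ] in
lemma eq_C_smul_of_zsmul [CharZero k] (n : ℕ) (h : H) :
    (C ((n.factorial : k)⁻¹) : MvPolynomial σ k) • (((n.factorial : ℕ) : ℤ) • h) = h := by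
  rw [← Int.cast_smul_eq_zsmul (MvPolynomial σ k), ← mul_smul]
  have h1 : ((((n.factorial : ℕ) : ℤ) : MvPolynomial σ k)) = C (n.factorial : k) := by simp
  rw [h1, ← C_mul, inv_mul_cancel₀ (by exact_mod_cast n.factorial_ne_zero), C_1, one_smul]

/-- A stable submodule containing the socle contains all torsion elements. -/
lemma mem_of_soc_le [CharZero k] (V : Submodule (MvPolynomial σ k) H)
    (hV : ∀ i, ∀ h ∈ V, W.D i h ∈ V) (hs : soc k σ H ≤ V) (n : ℕ) {h : H}
    (hn : VarNil k σ n h) : h ∈ V := by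
  induction n generalizing h with
  | zero => exact (show h = 0 from hn) ▸ V.zero_mem
  | succ n ih =>
    have h1 := W.rise_sub_mem V.toAddSubgroup.toIntSubmodule h (fun m => by
      rw [euler_apply]
      refine sum_mem fun i _ => hV _ _ ?_
      have : ∀ m, ∀ h : H, (∀ i, (X i : MvPolynomial σ k) • h ∈ V) →
          ∀ i, (X i : MvPolynomial σ k) • rise (W.euler + 1) m h ∈ V := by
        intro m
        induction m with
        | zero => exact fun h hh => hh
        | succ m ihm =>
          intro h hh i
          rw [rise_succ_apply, smul_add, smul_comm _ (_ : ℤ)]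
          refine add_mem (V.smul_mem _ ?_) (V.toAddSubgroup.zsmul_mem (ihm h hh i) _)
          rw [euler_apply]
          exact sum_mem fun j _ => hV _ _ (ihm h hh j)
      exact this m h (fun i => ih (hn i)) i) n
    have h2 := sub_mem (hs (W.rise_mem_soc n hn)) h1
    rw [sub_sub_cancel] at h2
    rw [← eq_C_smul_of_zsmul (k := k) (σ := σ) n h]
    exact V.smul_mem _ h2

lemma euler_mem_imD (h : H) : W.euler h ∈ W.imD := by
  rw [euler_apply]
  exact sum_mem fun i _ => W.D_mem_imD _ _

lemma exists_soc_sub_mem_imD [CharZero k] (n : ℕ) {h : H} (hn : VarNil k σ n h) :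
    ∃ u ∈ soc k σ H, h - u ∈ W.imD := by
  cases n with
  | zero => exact ⟨0, zero_mem _, by rw [(show h = 0 from hn), sub_zero]; exact zero_mem _⟩
  | succ n =>
    have h1 := W.rise_sub_mem W.imD h (fun m => W.euler_mem_imD _) n
    have h2 := W.C_smul_mem_imD ((n.factorial : k)⁻¹) (neg_mem h1)
    rw [neg_sub, smul_sub, eq_C_smul_of_zsmul (k := k) (σ := σ)] at h2
    exact ⟨_, (soc k σ H).smul_mem _ (W.rise_mem_soc n hn), h2⟩

lemma eq_zero_of_mem_soc_of_mem_imD [CharZero k] (htor : ∀ h : H, ∃ n, VarNil k σ n h)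
    {u : H} (hu : u ∈ soc k σ H) (hu' : u ∈ W.imD) : u = 0 := by
  have hmono : ∀ {n m : ℕ} {h : H}, n ≤ m → VarNil k σ n h → VarNil k σ m h := by
    intro n m h hnm hh
    rw [varNil_iff] at hh ⊢
    exact fun x hx => hh x (Ideal.pow_le_pow_right hnm hx)
  have key : ∀ v ∈ W.imD, ∃ n, ∀ m, n ≤ m → rise (W.euler + 1) m v = 0 := by
    intro v hv
    refine Submodule.iSup_induction _ (motive := fun v => ∃ n, ∀ m, n ≤ m →
      rise (W.euler + 1) m v = 0) hv ?_ ⟨0, fun m _ => map_zero _⟩ ?_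
    · rintro i _ ⟨h, rfl⟩
      obtain ⟨n, hn⟩ := htor h
      refine ⟨n, fun m hm => ?_⟩
      have h1 := congrArg (fun t : Module.End ℤ H => t h)
        (rise_mul_of_comm (W.D_mul_euler i).symm m)
      have h2 : rise (W.euler + 1) m (W.D i h) = W.D i (rise W.euler m h) := h1
      rw [h2, W.rise_euler_eq_zero m (hmono hm hn), map_zero]
    · rintro a b ⟨n, hn⟩ ⟨m, hm⟩
      exact ⟨max n m, fun p hp => by
        rw [map_add, hn p (le_of_max_le_left hp), hm p (le_of_max_le_right hp), add_zero]⟩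
  obtain ⟨n, hn⟩ := key u hu'
  have hsoc : ∀ m, rise (W.euler + 1) m u ∈ soc k σ H := by
    intro m
    induction m with
    | zero => exact hu
    | succ m ih =>
      rw [rise_succ_apply, W.euler_eq_zero ih, zero_add]
      exact (soc k σ H).toAddSubgroup.zsmul_mem ih _
  have h1 := W.rise_sub_mem ⊥ u (fun m => W.euler_eq_zero (hsoc m)) n
  rw [hn n le_rfl, zero_sub, Submodule.mem_bot, neg_eq_zero] at h1
  rw [← eq_C_smul_of_zsmul (k := k) (σ := σ) n u, h1, smul_zero]

end WeylAction
end LocCohTop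

namespace LocCohTop
open MvPolynomial

section CoInd
variable (k : Type) [Field k] (σ : Type)

variable {k σ} in
lemma pderiv_pderiv_comm (i j : σ) (f : MvPolynomial σ k) :
    pderiv i (pderiv j f) = pderiv j (pderiv i f) := by
  classical
  have h : ⁅pderiv (R := k) i, pderiv j⁆ =
      (0 : Derivation k (MvPolynomial σ k) (MvPolynomial σ k)) := by
    apply derivation_ext
    intro l
    simp [Derivation.commutator_apply, pderiv_X, Pi.single_apply, apply_ite]
  have := DFunLike.congr_fun h f
  rwa [Derivation.commutator_apply, Derivation.zero_apply, sub_eq_zero] at this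

/-- The `k`-linear functionals on the polynomial ring. -/
def CoInd : Type := MvPolynomial σ k →ₗ[k] k

noncomputable instance : AddCommGroup (CoInd k σ) :=
  inferInstanceAs (AddCommGroup (MvPolynomial σ k →ₗ[k] k))

variable {k σ}

noncomputable instance : Module (MvPolynomial σ k) (CoInd k σ) where
  smul f ψ := (show MvPolynomial σ k →ₗ[k] k from ψ) ∘ₗ LinearMap.mulLeft k f
  one_smul ψ := LinearMap.ext fun g => congrArg ψ.toFun (one_mul g)
  mul_smul f f' ψ := LinearMap.ext fun g => congrArg ψ.toFun
    (show f * f' * g = f' * (f * g) by ring)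
  smul_zero f := rfl
  smul_add f ψ ψ' := rfl
  add_smul f f' ψ := LinearMap.ext fun g =>
    (congrArg ψ.toFun (add_mul f f' g)).trans (LinearMap.map_add ψ _ _)
  zero_smul ψ := LinearMap.ext fun g =>
    (congrArg ψ.toFun (zero_mul g)).trans (LinearMap.map_zero ψ)

/-- Evaluation of a functional. -/
def CoInd.ev (ψ : CoInd k σ) : MvPolynomial σ k →ₗ[k] k := ψ

lemma CoInd.smul_ev (f g : MvPolynomial σ k) (ψ : CoInd k σ) : (f • ψ).ev g = ψ.ev (f * g) := rfl

lemma CoInd.zero_ev (g : MvPolynomial σ k) : (0 : CoInd k σ).ev g = 0 := rfl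

lemma CoInd.ext {ψ ψ' : CoInd k σ} (h : ∀ g, ψ.ev g = ψ'.ev g) : ψ = ψ' := LinearMap.ext h

instance : Module.Injective (MvPolynomial σ k) (CoInd k σ) := by
  apply Module.Baer.injective
  intro I g
  let g0 : I →ₗ[k] k :=
    { toFun := fun x => (g x).ev 1
      map_add' := fun x y => by rw [map_add]; rfl
      map_smul' := fun c x => by
        have : c • x = (C c : MvPolynomial σ k) • x := by
          ext1
          rw [Submodule.coe_smul_of_tower, Submodule.coe_smul_of_tower, smul_eq_C_mul, smul_eq_mul]
        rw [this, map_smul, CoInd.smul_ev, mul_one, RingHom.id_apply, ← mul_one (C c),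
          ← smul_eq_C_mul, map_smul] }
  obtain ⟨F, hF⟩ := LinearMap.exists_extend (p := I.restrictScalars k) g0
  let F' : CoInd k σ := F
  refine ⟨LinearMap.toSpanSingleton _ (CoInd k σ) F', fun x hx => CoInd.ext fun f => ?_⟩
  rw [LinearMap.toSpanSingleton_apply, CoInd.smul_ev]
  have h1 := congrArg (fun t => t ⟨x * f, I.mul_mem_right f hx⟩) hF
  have h2 : (⟨x * f, I.mul_mem_right f hx⟩ : I) = f • ⟨x, hx⟩ :=
    Subtype.ext (mul_comm x f)
  refine Eq.trans (b := (g ⟨x * f, I.mul_mem_right f hx⟩).ev 1) h1 ?_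
  rw [h2, map_smul, CoInd.smul_ev, mul_one]

/-- The action of derivations on functionals. -/
noncomputable def coIndAction : WeylAction k σ (CoInd k σ) where
  D i :=
    { toFun := fun ψ => (-(ψ.ev ∘ₗ (pderiv i).toLinearMap) : MvPolynomial σ k →ₗ[k] k)
      map_add' := fun ψ ψ' => CoInd.ext fun g => by
        change -(ψ.ev _ + ψ'.ev _) = -ψ.ev _ + -ψ'.ev _
        rw [neg_add]
      map_smul' := fun n ψ => CoInd.ext fun g => by
        change -(n • (ψ.ev _)) = n • (-ψ.ev _)
        rw [smul_neg] }
  leibniz i f ψ := CoInd.ext fun g => by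
    change -ψ.ev (f * pderiv i g) = ψ.ev (pderiv i f * g) + -ψ.ev (pderiv i (f * g))
    rw [Derivation.leibniz, smul_eq_mul, smul_eq_mul, map_add, mul_comm g]
    ring
  comm i j ψ := CoInd.ext fun g => by
    change - -ψ.ev (pderiv j (pderiv i g)) = - -ψ.ev (pderiv i (pderiv j g))
    rw [pderiv_pderiv_comm]

lemma coIndAction_ev (i : σ) (ψ : CoInd k σ) (g : MvPolynomial σ k) :
    (coIndAction.D i ψ).ev g = -ψ.ev (pderiv i g) := rfl

lemma ev_of_mem_soc {ψ : CoInd k σ} (hψ : ψ ∈ soc k σ (CoInd k σ)) (f : MvPolynomial σ k) :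
    ψ.ev f = constantCoeff f * ψ.ev 1 := by
  induction f using MvPolynomial.induction_on with
  | C a =>
    rw [← mul_one (C a), ← smul_eq_C_mul, map_smul]
    simp
  | add p q hp hq => rw [map_add, hp, hq, map_add, add_mul]
  | mul_X p i _ =>
    have : ψ.ev (X i * p) = 0 := by rw [← CoInd.smul_ev, hψ i, CoInd.zero_ev]
    rw [mul_comm, this]
    simp

end CoInd

variable {k : Type} [Field k] [CharZero k] {σ : Type} [Fintype σ]
  {H : Type} [AddCommGroup H] [Module (MvPolynomial σ k) H] (W : WeylAction k σ H)

/-- The socle is at most one-dimensional if the coinvariants are. -/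
lemma exists_soc_generator (htor : ∀ h : H, ∃ n, VarNil k σ n h) (w : H)
    (hw : ∀ h : H, ∃ c : k, h - (C c : MvPolynomial σ k) • w ∈ W.imD) (hH : ∃ h : H, h ≠ 0) :
    ∃ u ∈ soc k σ H, u ≠ 0 ∧ (∀ h : H, ∃ c : k, h - (C c : MvPolynomial σ k) • u ∈ W.imD) ∧
      ∀ v ∈ soc k σ H, ∃ c : k, v = (C c : MvPolynomial σ k) • u := by
  obtain ⟨h, hh⟩ := hH
  obtain ⟨n, hn⟩ := htor h
  obtain ⟨u, -, hu, hu0⟩ := exists_soc_of_varNil ⊤ n hn trivial hh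
  have hu' : u ∉ W.imD := fun h => hu0 (W.eq_zero_of_mem_soc_of_mem_imD htor hu h)
  obtain ⟨a, ha⟩ := hw u
  have ha0 : a ≠ 0 := by
    rintro rfl
    apply hu'
    simpa using ha
  have h1 (h : H) : ∃ c : k, h - (C c : MvPolynomial σ k) • u ∈ W.imD := by
    obtain ⟨c, hc⟩ := hw h
    refine ⟨c * a⁻¹, ?_⟩
    have h2 := sub_mem hc (W.C_smul_mem_imD (c * a⁻¹) ha)
    rw [smul_sub, ← mul_smul, ← C_mul, mul_assoc, inv_mul_cancel₀ ha0, mul_one] at h2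
    convert h2 using 1
    abel
  refine ⟨u, hu, hu0, h1, fun v hv => ?_⟩
  obtain ⟨c, hc⟩ := h1 v
  exact ⟨c, sub_eq_zero.1 (W.eq_zero_of_mem_soc_of_mem_imD htor
    (sub_mem hv ((soc k σ H).smul_mem _ hu)) hc)⟩

/-- The coinvariants are at most one-dimensional if the socle is. -/
lemma exists_coinvariant_generator (htor : ∀ h : H, ∃ n, VarNil k σ n h)
    (hs : ∃ u : H, ∀ v ∈ soc k σ H, ∃ c : k, v = (C c : MvPolynomial σ k) • u) :
    ∃ w : H, ∀ h : H, ∃ c : k, h - (C c : MvPolynomial σ k) • w ∈ W.imD := by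
  obtain ⟨u, hu⟩ := hs
  refine ⟨u, fun h => ?_⟩
  obtain ⟨n, hn⟩ := htor h
  obtain ⟨v, hv, hvh⟩ := W.exists_soc_sub_mem_imD n hn
  obtain ⟨c, rfl⟩ := hu v hv
  exact ⟨c, hvh⟩

/-- A torsion module over the Weyl algebra with one-dimensional coinvariants is injective. -/
theorem exists_equiv_coInd (htor : ∀ h : H, ∃ n, VarNil k σ n h) (u : H) (hu : u ∈ soc k σ H)
    (hu0 : u ≠ 0) (h1 : ∀ h : H, ∃ c : k, h - (C c : MvPolynomial σ k) • u ∈ W.imD)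
    (h2 : ∀ v ∈ soc k σ H, ∃ c : k, v = (C c : MvPolynomial σ k) • u) :
    Nonempty (H ≃ₗ[MvPolynomial σ k]
      tor (Ideal.span (Set.range X) : Ideal (MvPolynomial σ k)) (CoInd k σ)) := by
  have hu' : u ∉ W.imD := fun h => hu0 (W.eq_zero_of_mem_soc_of_mem_imD htor hu h)
  have huniq (c : k) (hc : (C c : MvPolynomial σ k) • u ∈ W.imD) : c = 0 := by
    by_contra h0
    apply hu'
    have := W.C_smul_mem_imD c⁻¹ hc
    rwa [← mul_smul, ← C_mul, inv_mul_cancel₀ h0, C_1, one_smul] at this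
  have hval (h : H) (c c' : k) (hc : h - (C c : MvPolynomial σ k) • u ∈ W.imD)
      (hc' : h - (C c' : MvPolynomial σ k) • u ∈ W.imD) : c = c' := by
    have := sub_mem hc' hc
    rw [sub_sub_sub_cancel_left, ← sub_smul, ← C_sub] at this
    exact sub_eq_zero.1 (huniq _ this)
  choose φ hφ using h1
  have φadd (h h') : φ (h + h') = φ h + φ h' := hval (h + h') _ _ (hφ _) (by
    have := add_mem (hφ h) (hφ h')
    rw [C_add, add_smul]
    convert this using 1
    abel)
  have φsmul (c h) : φ ((C c : MvPolynomial σ k) • h) = c * φ h := hval _ _ _ (hφ _) (by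
    have := W.C_smul_mem_imD c (hφ h)
    rwa [smul_sub, ← mul_smul, ← C_mul] at this)
  have φD (i h) : φ (W.D i h) = 0 := hval _ _ _ (hφ _) (by
    simpa using W.D_mem_imD i h)
  have φu : φ u = 1 := hval _ _ _ (hφ _) (by simp)
  let Φ : H →ₗ[MvPolynomial σ k] CoInd k σ :=
    { toFun := fun h => ({ toFun := fun f => φ (f • h)
                           map_add' := fun f g => by rw [add_smul, φadd]
                           map_smul' := fun c f => by
                            rw [smul_eq_C_mul, mul_smul, φsmul]; rfl } :
                            MvPolynomial σ k →ₗ[k] k)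
      map_add' := fun h h' => CoInd.ext fun g => by
        change φ (g • (h + h')) = φ (g • h) + φ (g • h')
        rw [smul_add, φadd]
      map_smul' := fun f h => CoInd.ext fun g => by
        change φ (g • f • h) = φ ((f * g) • h)
        rw [← mul_smul, mul_comm] }
  have Φev (h : H) (f : MvPolynomial σ k) : (Φ h).ev f = φ (f • h) := rfl
  have ΦD (i : σ) (h : H) : Φ (W.D i h) = coIndAction.D i (Φ h) := CoInd.ext fun g => by
    rw [coIndAction_ev, Φev, Φev, eq_neg_iff_add_eq_zero, ← φadd, add_comm, ← W.leibniz, φD]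
  have hinj : Function.Injective Φ := by
    rw [← LinearMap.ker_eq_bot, Submodule.eq_bot_iff]
    intro h hh
    by_contra h0
    obtain ⟨n, hn⟩ := htor h
    obtain ⟨v, hvk, hv, hv0⟩ := exists_soc_of_varNil _ n hn hh h0
    obtain ⟨c, rfl⟩ := h2 v hv
    have h3 : (Φ ((C c : MvPolynomial σ k) • u)).ev 1 = 0 := by
      rw [LinearMap.mem_ker.1 hvk]; rfl
    rw [Φev, one_smul, φsmul, φu, mul_one] at h3
    rw [h3, C_0, zero_smul] at hv0
    exact hv0 rfl
  have hrange : LinearMap.range Φ =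
      tor (Ideal.span (Set.range X) : Ideal (MvPolynomial σ k)) (CoInd k σ) := by
    apply le_antisymm
    · rintro _ ⟨h, rfl⟩
      obtain ⟨n, hn⟩ := htor h
      rw [varNil_iff] at hn
      exact map_mem_tor Φ ⟨n, hn⟩
    · rintro ψ ⟨n, hn⟩
      refine coIndAction.mem_of_soc_le (LinearMap.range Φ) ?_ ?_ n ((varNil_iff n ψ).2 hn)
      · rintro i _ ⟨h, rfl⟩
        exact ⟨_, ΦD i h⟩
      · intro ψ hψ
        refine ⟨(C (ψ.ev 1) : MvPolynomial σ k) • u, CoInd.ext fun f => ?_⟩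
        have h4 : Φ u ∈ soc k σ (CoInd k σ) := fun i => by
          rw [← map_smul, hu i, map_zero]
        have h5 := ev_of_mem_soc h4 f
        rw [Φev, Φev, one_smul, φu, mul_one] at h5
        rw [ev_of_mem_soc hψ f, Φev, ← mul_smul, mul_comm, mul_smul, φsmul, h5, mul_comm]
  exact ⟨(LinearEquiv.ofInjective Φ hinj).trans (LinearEquiv.ofEq _ _ hrange)⟩

end LocCohTop

namespace LocCohTop

section TopQuotient

variable {S : Type} [CommRing S] {K : Type} [AddCommGroup K] [Module S K]
  {A₀ : Submodule S K} {L : List S}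

/-- The class of an element in the top quotient. -/
def TopQ.mk {A₀ : Submodule S K} {L : List S} (c : K) (hc : c ∈ topA A₀ L) : TopQ A₀ L :=
  Submodule.Quotient.mk ⟨c, hc⟩

lemma TopQ.exists_mk (q : TopQ A₀ L) : ∃ c hc, q = TopQ.mk c hc := by
  obtain ⟨⟨c, hc⟩, rfl⟩ := Submodule.Quotient.mk_surjective _ q
  exact ⟨c, hc, rfl⟩

lemma TopQ.mk_eq_zero {c : K} {hc : c ∈ topA A₀ L} :
    TopQ.mk c hc = 0 ↔ c ∈ topB A₀ L := by
  rw [TopQ.mk, Submodule.Quotient.mk_eq_zero]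
  rfl

lemma TopQ.mk_add {c c' : K} (hc : c ∈ topA A₀ L) (hc' : c' ∈ topA A₀ L) :
    TopQ.mk (c + c') (add_mem hc hc') = TopQ.mk c hc + TopQ.mk c' hc' := rfl

lemma TopQ.mk_sub {c c' : K} (hc : c ∈ topA A₀ L) (hc' : c' ∈ topA A₀ L) :
    TopQ.mk (c - c') (sub_mem hc hc') = TopQ.mk c hc - TopQ.mk c' hc' := rfl

lemma TopQ.mk_smul (f : S) {c : K} (hc : c ∈ topA A₀ L) :
    TopQ.mk (f • c) ((topA A₀ L).smul_mem f hc) = f • TopQ.mk c hc := rfl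

lemma TopQ.mk_eq_mk {c c' : K} {hc : c ∈ topA A₀ L} {hc' : c' ∈ topA A₀ L} :
    TopQ.mk c hc = TopQ.mk c' hc' ↔ c - c' ∈ topB A₀ L := by
  rw [← sub_eq_zero, ← TopQ.mk_sub, TopQ.mk_eq_zero]

lemma exists_prod_pow_smul_mem_of_mem_topA {c : K} (hc : c ∈ topA A₀ L) :
    ∃ N, ∀ n ≥ N, L.prod ^ n • c ∈ A₀ := by
  induction L generalizing c with
  | nil =>
    have : c ∈ A₀ := hc
    exact ⟨0, fun n _ => by simpa using this⟩
  | cons f L ih =>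
    obtain ⟨m, hm⟩ := hc
    obtain ⟨N, hN⟩ := ih hm
    refine ⟨max N m, fun n hn => ?_⟩
    have h1 := A₀.smul_mem (f ^ (n - m)) (hN n (le_trans (le_max_left _ _) hn))
    convert h1 using 1
    rw [List.prod_cons, mul_pow, ← mul_smul, ← mul_smul]
    congr 1
    rw [← Nat.sub_add_cancel (le_trans (le_max_right N m) hn), pow_add, Nat.add_sub_cancel]
    ring

lemma mem_topA_of_prod_pow_smul_mem {c : K} (n : ℕ) (h : L.prod ^ n • c ∈ A₀) :
    c ∈ topA A₀ L := by
  induction L generalizing c with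
  | nil => simpa [topA] using h
  | cons f L ih =>
    refine ⟨n, ih ?_⟩
    rwa [← mul_smul, mul_comm, ← mul_pow, ← List.prod_cons]

lemma exists_prod_pow_smul_mem_of_mem_topB {c : K} (hc : c ∈ topB A₀ L) :
    ∃ N, ∀ n ≥ N, L.prod ^ n • c ∈ Ideal.span {g | ∃ f ∈ L, g = f ^ n} • A₀ := by
  induction L generalizing c with
  | nil =>
    have : c = 0 := hc
    subst this
    exact ⟨0, fun n _ => by simp⟩
  | cons f L ih =>
    obtain ⟨x, ⟨m, hx⟩, y, hy, rfl⟩ := Submodule.mem_sup.1 hc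
    obtain ⟨N, hN⟩ := ih hx
    obtain ⟨N', hN'⟩ := exists_prod_pow_smul_mem_of_mem_topA hy
    refine ⟨max (max N m) N', fun n hn => ?_⟩
    have h1 : N ≤ n := by omega
    have h2 : m ≤ n := by omega
    have h3 : N' ≤ n := by omega
    rw [smul_add]
    refine add_mem ?_ ?_
    · have hle : Ideal.span {g | ∃ f ∈ L, g = f ^ n} • A₀ ≤
          Ideal.span {g | ∃ h ∈ f :: L, g = h ^ n} • A₀ := by
        refine Submodule.smul_mono_left (Ideal.span_mono ?_)
        rintro g ⟨h, hh, rfl⟩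
        exact ⟨h, List.mem_cons_of_mem _ hh, rfl⟩
      have h4 := Submodule.smul_mem _ (f ^ (n - m)) (hle (hN n h1))
      convert h4 using 1
      rw [List.prod_cons, mul_pow, ← mul_smul, ← mul_smul]
      congr 1
      rw [← Nat.sub_add_cancel h2, pow_add, Nat.add_sub_cancel]
      ring
    · rw [List.prod_cons, mul_pow, mul_smul]
      exact Submodule.smul_mem_smul (Ideal.subset_span ⟨f, List.mem_cons_self, rfl⟩) (hN' n h3)

lemma exists_pow_smul_mem_topB {c : K} (hc : c ∈ topA A₀ L) {f : S} (hf : f ∈ L) :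
    ∃ m, f ^ m • c ∈ topB A₀ L := by
  induction L generalizing c with
  | nil => simp at hf
  | cons h L ih =>
    obtain ⟨n, hn⟩ := hc
    rcases List.mem_cons.1 hf with rfl | hf
    · exact ⟨n, Submodule.mem_sup_right hn⟩
    · obtain ⟨m, hm⟩ := ih hn hf
      refine ⟨m, Submodule.mem_sup_left ⟨n, ?_⟩⟩
      rwa [smul_comm]

lemma exists_pow_smul_mem_topB_of_mem_radical {c : K} (hc : c ∈ topA A₀ L) {z : S}
    (hz : z ∈ (Ideal.span {f | f ∈ L}).radical) : ∃ m, z ^ m • c ∈ topB A₀ L := by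
  let J : Ideal S := (topB A₀ L).comap (LinearMap.toSpanSingleton S K c)
  have hJ : (Ideal.span {f | f ∈ L}).radical ≤ J.radical := by
    rw [Ideal.radical_le_radical_iff, Ideal.span_le]
    intro f hf
    exact exists_pow_smul_mem_topB hc hf
  exact hJ hz

lemma exists_pow_smul_mem_topB_cons {f z : S} {c : K} (hc : c ∈ topA A₀ (f :: L))
    (hz : z * f ∈ (Ideal.span {f | f ∈ L}).radical) : ∃ m, z ^ m • c ∈ topB A₀ (f :: L) := by
  obtain ⟨n, hn⟩ := hc
  obtain ⟨m, hm⟩ := exists_pow_smul_mem_topB_of_mem_radical hn hz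
  refine ⟨m, Submodule.mem_sup_left ⟨m + n, ?_⟩⟩
  convert hm using 1
  rw [← mul_smul, ← mul_smul]
  congr 1
  ring

variable {d : Module.End ℤ K} {δ : S → S} (hd : ∀ f c, d (f • c) = δ f • c + f • d c)
include hd

lemma sat_stable {A : Submodule S K} (hA : ∀ c ∈ A, d c ∈ A) (f : S) {c : K}
    (hc : c ∈ sat f A) : d c ∈ sat f A := by
  obtain ⟨m, hm⟩ := hc
  refine ⟨m + 1, ?_⟩
  induction m generalizing c with
  | zero => exact A.smul_mem _ (hA _ (by simpa using hm))
  | succ m ih =>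
    have h1 : f ^ m • f • c ∈ A := by rwa [← mul_smul, ← pow_succ]
    have h2 := ih h1
    rw [hd, smul_add, smul_comm] at h2
    have h3 := sub_mem h2 (A.smul_mem (δ f) hm)
    rwa [add_sub_cancel_left, ← mul_smul, ← pow_succ] at h3

lemma topA_stable (hA : ∀ c ∈ A₀, d c ∈ A₀) {c : K} (hc : c ∈ topA A₀ L) : d c ∈ topA A₀ L := by
  induction L generalizing c with
  | nil => exact hA c hc
  | cons f L ih => exact sat_stable hd (fun c hc => ih hc) f hc

lemma topB_stable (hA : ∀ c ∈ A₀, d c ∈ A₀) {c : K} (hc : c ∈ topB A₀ L) : d c ∈ topB A₀ L := by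
  induction L generalizing c with
  | nil =>
    have : c = 0 := hc
    subst this
    rw [map_zero]
    exact zero_mem _
  | cons f L ih =>
    obtain ⟨x, hx, y, hy, rfl⟩ := Submodule.mem_sup.1 hc
    rw [map_add]
    exact add_mem (Submodule.mem_sup_left (sat_stable hd (fun c hc => ih hc) f hx))
      (Submodule.mem_sup_right (topA_stable hd hA hy))

end TopQuotient

section TopQAction

variable {k : Type} [Field k] {σ : Type} {K : Type} [AddCommGroup K]
  [Module (MvPolynomial σ k) K]

/-- The action of the Weyl algebra on the top quotient. -/
noncomputable def topQAction (W : WeylAction k σ K) (A₀ : Submodule (MvPolynomial σ k) K)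
    (hA₀ : ∀ i, ∀ c ∈ A₀, W.D i c ∈ A₀) (L : List (MvPolynomial σ k)) :
    WeylAction k σ (TopQ A₀ L) := by
  have hA (i) (c) (hc : c ∈ topA A₀ L) := topA_stable (W.leibniz i) (hA₀ i) hc
  have hB (i) (c) (hc : c ∈ topB A₀ L) := topB_stable (W.leibniz i) (hA₀ i) hc
  let D0 (i : σ) (q : TopQ A₀ L) : TopQ A₀ L := TopQ.mk (W.D i q.out.1) (hA i _ q.out.2)
  have hD0 (i) (c : K) (hc : c ∈ topA A₀ L) :
      D0 i (TopQ.mk c hc) = TopQ.mk (W.D i c) (hA i c hc) := by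
    refine TopQ.mk_eq_mk.2 ?_
    rw [← map_sub]
    refine hB i _ ?_
    rw [← TopQ.mk_eq_mk (hc := (Quotient.out (TopQ.mk c hc)).2) (hc' := hc)]
    exact Quotient.out_eq _
  exact
    { D := fun i =>
        { toFun := D0 i
          map_add' := fun q q' => by
            obtain ⟨c, hc, rfl⟩ := q.exists_mk
            obtain ⟨c', hc', rfl⟩ := q'.exists_mk
            rw [← TopQ.mk_add, hD0, hD0, hD0, ← TopQ.mk_add]
            congr 1
            exact map_add _ _ _
          map_smul' := fun n q => by
            obtain ⟨c, hc, rfl⟩ := q.exists_mk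
            change D0 i (TopQ.mk (n • c) _) = _
            rw [hD0, hD0]
            refine TopQ.mk_eq_mk.2 ?_
            rw [map_smul, RingHom.id_apply, sub_self]
            exact zero_mem _ }
      leibniz := fun i f q => by
        obtain ⟨c, hc, rfl⟩ := q.exists_mk
        change D0 i (TopQ.mk (f • c) _) = _ + f • D0 i _
        rw [hD0, hD0, ← TopQ.mk_smul, ← TopQ.mk_smul, ← TopQ.mk_add]
        congr 1
        exact W.leibniz i f c
      comm := fun i j q => by
        obtain ⟨c, hc, rfl⟩ := q.exists_mk
        change D0 i (D0 j _) = D0 j (D0 i _)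
        rw [hD0 j, hD0 i, hD0 i, hD0 j]
        congr 1
        exact W.comm i j c }

lemma topQAction_mk (W : WeylAction k σ K) (A₀ : Submodule (MvPolynomial σ k) K)
    (hA₀ : ∀ i, ∀ c ∈ A₀, W.D i c ∈ A₀) (L : List (MvPolynomial σ k)) (i : σ) (c : K)
    (hc : c ∈ topA A₀ L) :
    (topQAction W A₀ hA₀ L).D i (TopQ.mk c hc) =
      TopQ.mk (W.D i c) (topA_stable (W.leibniz i) (hA₀ i) hc) := by
  refine TopQ.mk_eq_mk.2 ?_
  rw [← map_sub]
  refine topB_stable (W.leibniz i) (hA₀ i) ?_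
  rw [← TopQ.mk_eq_mk (hc := (Quotient.out (TopQ.mk c hc)).2) (hc' := hc)]
  exact Quotient.out_eq _

lemma mk_mem_imD (W : WeylAction k σ K) (A₀ : Submodule (MvPolynomial σ k) K)
    (hA₀ : ∀ i, ∀ c ∈ A₀, W.D i c ∈ A₀) (L : List (MvPolynomial σ k)) (i : σ) (c : K)
    (hc : c ∈ topA A₀ L) (hc' : W.D i c ∈ topA A₀ L) :
    TopQ.mk (W.D i c) hc' ∈ (topQAction W A₀ hA₀ L).imD := by
  rw [← topQAction_mk W A₀ hA₀ L i c hc]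
  exact (topQAction W A₀ hA₀ L).D_mem_imD i _

end TopQAction

end LocCohTop

namespace LocCohTop
open scoped TensorProduct

section FractionDerivation

variable {R K : Type} [CommRing R] [IsDomain R] [Field K] [Algebra R K] [IsFractionRing R K]

omit [IsDomain R] in
lemma exists_derivation_extend (δ : Derivation ℤ R R) :
    ∃ D : Derivation ℤ K K, ∀ f, D (algebraMap R K f) = algebraMap R K (δ f) := by
  have := Algebra.FormallyEtale.of_isLocalization (Rₘ := K) (nonZeroDivisors R)
  let d0 : Derivation ℤ R K := (Algebra.linearMap R K).compDer δ
  let l : K ⊗[R] Ω[R⁄ℤ] →ₗ[K] K := LinearMap.liftBaseChange K d0.liftKaehlerDifferential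
  refine ⟨(l ∘ₗ (KaehlerDifferential.tensorKaehlerEquivOfFormallyEtale ℤ R K).symm.toLinearMap).compDer
    (KaehlerDifferential.D ℤ K), fun f => ?_⟩
  change l ((KaehlerDifferential.tensorKaehlerEquivOfFormallyEtale ℤ R K).symm
    (KaehlerDifferential.D ℤ K (algebraMap R K f))) = _
  rw [KaehlerDifferential.tensorKaehlerEquivOfFormallyEtale_symm_D_algebraMap,
    LinearMap.liftBaseChange_tmul, one_smul, Derivation.liftKaehlerDifferential_comp_D]
  rfl

lemma derivation_eq_of_algebraMap {D D' : Derivation ℤ K K}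
    (h : ∀ f, D (algebraMap R K f) = D' (algebraMap R K f)) : D = D' := by
  ext x
  obtain ⟨a, b, hb, rfl⟩ := IsFractionRing.div_surjective (A := R) x
  have hb0 : algebraMap R K b ≠ 0 := IsFractionRing.to_map_ne_zero_of_mem_nonZeroDivisors hb
  have h1 : algebraMap R K b * (algebraMap R K a / algebraMap R K b) = algebraMap R K a := by
    field_simp
  have h2 := congrArg D h1
  have h3 := congrArg D' h1
  rw [Derivation.leibniz, h, h] at h2
  rw [Derivation.leibniz, ← h2] at h3
  have h4 := add_right_cancel h3
  exact (mul_left_cancel₀ hb0 h4).symm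

end FractionDerivation

section WeylOfDerivations

open MvPolynomial

variable {k : Type} [Field k] {σ : Type} {K : Type} [Field K] [Algebra (MvPolynomial σ k) K]

/-- Commuting derivations extending the partial derivatives. -/
structure ExtDer (k : Type) [Field k] (σ : Type) (K : Type) [Field K]
    [Algebra (MvPolynomial σ k) K] where
  D : σ → Derivation ℤ K K
  map : ∀ i f, D i (algebraMap (MvPolynomial σ k) K f) = algebraMap _ K (pderiv i f)
  comm : ∀ i j x, D i (D j x) = D j (D i x)

/-- The action of the Weyl algebra defined by derivations. -/
noncomputable def ExtDer.action (E : ExtDer k σ K) : WeylAction k σ K where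
  D i := (E.D i).toLinearMap
  leibniz i f h := by
    change E.D i (f • h) = _ + f • E.D i h
    simp only [Algebra.smul_def (R := MvPolynomial σ k)]
    rw [Derivation.leibniz, E.map, smul_eq_mul, smul_eq_mul, add_comm, mul_comm h]
  comm := E.comm

lemma ExtDer.action_D (E : ExtDer k σ K) (i : σ) (c : K) : E.action.D i c = E.D i c := rfl

lemma ExtDer.stable (E : ExtDer k σ K) (i : σ) :
    ∀ c ∈ LinearMap.range (Algebra.linearMap (MvPolynomial σ k) K),
      E.action.D i c ∈ LinearMap.range (Algebra.linearMap (MvPolynomial σ k) K) := by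
  rintro _ ⟨f, rfl⟩
  exact ⟨pderiv i f, (E.map i f).symm⟩

/-- The extension of the partial derivatives to the field of fractions. -/
lemma exists_extDer [IsFractionRing (MvPolynomial σ k) K] : Nonempty (ExtDer k σ K) := by
  choose D hD using fun i => exists_derivation_extend (K := K)
    ((pderiv (R := k) (σ := σ) i).restrictScalars ℤ)
  refine ⟨D, hD, fun i j x => ?_⟩
  have h : ⁅D i, D j⁆ = 0 := by
    refine derivation_eq_of_algebraMap (R := MvPolynomial σ k) fun f => ?_
    rw [Derivation.commutator_apply, hD, hD, hD, hD, Derivation.zero_apply, sub_eq_zero]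
    exact congrArg _ (pderiv_pderiv_comm i j f)
  have := DFunLike.congr_fun h x
  rwa [Derivation.commutator_apply, Derivation.zero_apply, sub_eq_zero] at this

end WeylOfDerivations

end LocCohTop

namespace LocCohTop
open MvPolynomial

section Erase

variable {S : Type} [CommRing S] {K : Type} [AddCommGroup K] [Module S K]
  {A₀ : Submodule S K}

lemma mem_topB_of_mem_topA_erase [DecidableEq S] {f : S} {L : List S} (hf : f ∈ L) {c : K}
    (hc : c ∈ topA A₀ (L.erase f)) : c ∈ topB A₀ L := by
  induction L generalizing c with
  | nil => simp at hf
  | cons h L ih =>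
    by_cases hh : h = f
    · subst hh
      rw [List.erase_cons_head] at hc
      exact Submodule.mem_sup_right hc
    · rw [List.erase_cons_tail (by simpa using hh)] at hc
      obtain ⟨m, hm⟩ := hc
      have hf' : f ∈ L := by
        rcases List.mem_cons.1 hf with h1 | h1
        · exact absurd h1.symm hh
        · exact h1
      exact Submodule.mem_sup_left ⟨m, ih hf' hm⟩

end Erase

variable {k : Type} [Field k] [CharZero k] {τ : Type} [Fintype τ] {K : Type} [Field K]
  [Algebra (MvPolynomial τ k) K]

/-- The list of variables. -/
noncomputable def varList (k : Type) [Field k] (τ : Type) [Fintype τ] :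
    List (MvPolynomial τ k) :=
  Finset.univ.toList.map X

omit [CharZero k] in
lemma mem_varList {f : MvPolynomial τ k} : f ∈ varList k τ ↔ ∃ i, X i = f := by
  simp [varList]

omit [CharZero k] in
lemma setOf_mem_varList : {f | f ∈ varList k τ} = Set.range (X : τ → MvPolynomial τ k) := by
  ext f
  exact mem_varList

/-- Laurent monomials. -/
noncomputable def laurent (k : Type) [Field k] {τ : Type} [Fintype τ] (K : Type) [Field K]
    [Algebra (MvPolynomial τ k) K] (e : τ → ℤ) : K :=
  ∏ i, (algebraMap (MvPolynomial τ k) K (X i)) ^ e i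

variable (hinj : Function.Injective (algebraMap (MvPolynomial τ k) K))
include hinj

omit [CharZero k] [Fintype τ] in
lemma algebraMap_X_ne_zero (i : τ) : algebraMap (MvPolynomial τ k) K (X i) ≠ 0 := by
  rw [Ne, map_eq_zero_iff _ hinj]
  exact X_ne_zero i

omit [CharZero k] in
lemma der_laurent [DecidableEq τ] (E : ExtDer k τ K) (i : τ) (e : τ → ℤ) :
    E.D i (laurent k K (e + Pi.single i 1)) = ((e i + 1 : ℤ) : K) * laurent k K e := by
  have hx := algebraMap_X_ne_zero hinj i
  have hsplit (e : τ → ℤ) : laurent k K e = (algebraMap (MvPolynomial τ k) K (X i)) ^ e i *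
      ∏ j ∈ Finset.univ.erase i, (algebraMap (MvPolynomial τ k) K (X j)) ^ e j :=
    (Finset.mul_prod_erase _ _ (Finset.mem_univ i)).symm
  have hrest : E.D i (∏ j ∈ Finset.univ.erase i,
      (algebraMap (MvPolynomial τ k) K (X j)) ^ e j) = 0 := by
    refine Finset.prod_induction _ (fun x => E.D i x = 0) (fun a b ha hb => ?_) ?_ fun j hj => ?_
    · rw [Derivation.leibniz, ha, hb, smul_zero, smul_zero, add_zero]
    · exact Derivation.map_one_eq_zero _
    · rw [Derivation.leibniz_zpow, E.map, pderiv_X_of_ne (Finset.ne_of_mem_erase hj), map_zero,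
        smul_zero, smul_zero]
  have hrest' : ∏ j ∈ Finset.univ.erase i,
      (algebraMap (MvPolynomial τ k) K (X j)) ^ (e + Pi.single i 1 : τ → ℤ) j =
      ∏ j ∈ Finset.univ.erase i, (algebraMap (MvPolynomial τ k) K (X j)) ^ e j :=
    Finset.prod_congr rfl fun j hj => by
      rw [Pi.add_apply, Pi.single_eq_of_ne (Finset.ne_of_mem_erase hj), add_zero]
  rw [hsplit, hrest', Derivation.leibniz, hrest, smul_zero, zero_add, Derivation.leibniz_zpow,
    E.map, pderiv_X_self, map_one, hsplit e, Pi.add_apply, Pi.single_eq_same, add_sub_cancel_right]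
  simp only [smul_eq_mul, mul_one, zsmul_eq_mul]
  ring

omit [CharZero k] in
lemma laurent_add (e e' : τ → ℤ) : laurent k K (e + e') = laurent k K e * laurent k K e' := by
  rw [laurent, laurent, laurent, ← Finset.prod_mul_distrib]
  exact Finset.prod_congr rfl fun i _ => by
    rw [Pi.add_apply, zpow_add₀ (algebraMap_X_ne_zero hinj i)]

omit [CharZero k] hinj in
lemma algebraMap_monomial (a : τ →₀ ℕ) (c : k) :
    algebraMap (MvPolynomial τ k) K (monomial a c) =
      algebraMap (MvPolynomial τ k) K (C c) * laurent k K (fun i => (a i : ℤ)) := by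
  rw [monomial_eq, Finsupp.prod_fintype _ _ (by simp), map_mul, map_prod, laurent]
  simp

omit [CharZero k] in
lemma laurent_mem (e : τ → ℤ) :
    laurent k K e ∈ topA (LinearMap.range (Algebra.linearMap (MvPolynomial τ k) K))
      (varList k τ) := by
  have hz : ∀ n : ℕ, algebraMap (MvPolynomial τ k) K ((varList k τ).prod ^ n) =
      laurent k K (fun _ : τ => (n : ℤ)) := by
    intro n
    rw [varList, Finset.prod_map_toList, map_pow, map_prod, laurent, ← Finset.prod_pow]
    simp
  obtain ⟨n, hn⟩ : ∃ n : ℕ, ∀ i, 0 ≤ (n : ℤ) + e i := by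
    refine ⟨∑ i, (e i).natAbs, fun i => ?_⟩
    have : (e i).natAbs ≤ ∑ i, (e i).natAbs :=
      Finset.single_le_sum (f := fun i => (e i).natAbs) (fun _ _ => Nat.zero_le _)
        (Finset.mem_univ i)
    omega
  refine mem_topA_of_prod_pow_smul_mem n ?_
  rw [Algebra.smul_def, hz, ← laurent_add hinj]
  refine ⟨monomial (Finsupp.equivFunOnFinite.symm fun i => ((n : ℤ) + e i).toNat) 1, ?_⟩
  rw [Algebra.linearMap_apply, algebraMap_monomial, C_1, map_one, one_mul]
  congr 1
  ext i
  simp [hn i]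

omit [CharZero k] in
lemma laurent_mem_topB (e : τ → ℤ) (i : τ) (hi : 0 ≤ e i) :
    laurent k K e ∈ topB (LinearMap.range (Algebra.linearMap (MvPolynomial τ k) K))
      (varList k τ) := by
  classical
  refine mem_topB_of_mem_topA_erase (mem_varList.2 ⟨i, rfl⟩) ?_
  have he : (varList k τ).erase (X i) = (Finset.univ.toList.erase i).map X :=
    (List.map_erase (X_injective (R := k)) _).symm
  have hz : ∀ n : ℕ, algebraMap (MvPolynomial τ k) K (((varList k τ).erase (X i)).prod ^ n) =
      laurent k K (fun j : τ => if j = i then 0 else (n : ℤ)) := by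
    intro n
    rw [he]
    have h1 : ((Finset.univ.toList.erase i).map X).prod =
        ∏ j ∈ Finset.univ.erase i, (X j : MvPolynomial τ k) := by
      have h2 : (X i : MvPolynomial τ k) * ((Finset.univ.toList.erase i).map X).prod =
          X i * ∏ j ∈ Finset.univ.erase i, (X j : MvPolynomial τ k) := by
        rw [Finset.mul_prod_erase _ _ (Finset.mem_univ i), ← Finset.prod_map_toList,
          ← List.prod_map_erase _ (Finset.mem_toList.2 (Finset.mem_univ i))]
      exact mul_left_cancel₀ (X_ne_zero i) h2
    rw [h1, map_pow, map_prod, laurent, ← Finset.mul_prod_erase _ _ (Finset.mem_univ i),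
      ← Finset.prod_pow]
    simp only [if_true, zpow_zero, one_mul]
    exact Finset.prod_congr rfl fun j hj => by
      rw [if_neg (Finset.ne_of_mem_erase hj), zpow_natCast]
  obtain ⟨n, hn⟩ : ∃ n : ℕ, ∀ i, 0 ≤ (n : ℤ) + e i := by
    refine ⟨∑ i, (e i).natAbs, fun i => ?_⟩
    have : (e i).natAbs ≤ ∑ i, (e i).natAbs :=
      Finset.single_le_sum (f := fun i => (e i).natAbs) (fun _ _ => Nat.zero_le _)
        (Finset.mem_univ i)
    omega
  refine mem_topA_of_prod_pow_smul_mem n ?_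
  rw [Algebra.smul_def, hz, ← laurent_add hinj]
  refine ⟨monomial (Finsupp.equivFunOnFinite.symm fun j =>
    ((if j = i then 0 else (n : ℤ)) + e j).toNat) 1, ?_⟩
  rw [Algebra.linearMap_apply, algebraMap_monomial, C_1, map_one, one_mul]
  congr 1
  ext j
  have := hn j
  by_cases hj : j = i
  · subst hj
    simp [hi]
  · simp [hj, this]

/-- The coinvariants of the top local cohomology of a polynomial ring at the origin. -/
lemma varList_coinvariants (E : ExtDer k τ K) :
    ∃ w : TopQ (LinearMap.range (Algebra.linearMap (MvPolynomial τ k) K)) (varList k τ),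
      ∀ h, ∃ c : k, h - (C c : MvPolynomial τ k) • w ∈
        (topQAction E.action _ E.stable (varList k τ)).imD := by
  classical
  set A₀ := LinearMap.range (Algebra.linearMap (MvPolynomial τ k) K)
  set W := topQAction E.action A₀ E.stable (varList k τ)
  have hm (e) : laurent k K e ∈ topA A₀ (varList k τ) := laurent_mem hinj e
  let w : TopQ A₀ (varList k τ) := TopQ.mk (laurent k K (fun _ : τ => -1)) (hm _)
  have hmono (e : τ → ℤ) : ∃ c : k, TopQ.mk (laurent k K e) (hm e) -
      (C c : MvPolynomial τ k) • w ∈ W.imD := by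
    by_cases h1 : ∃ i, 0 ≤ e i
    · obtain ⟨i, hi⟩ := h1
      refine ⟨0, ?_⟩
      rw [C_0, zero_smul, sub_zero, TopQ.mk_eq_zero.2 (laurent_mem_topB hinj e i hi)]
      exact zero_mem _
    by_cases h2 : ∃ i, e i < -1
    · obtain ⟨i, hi⟩ := h2
      refine ⟨0, ?_⟩
      rw [C_0, zero_smul, sub_zero]
      have h3 := mk_mem_imD E.action A₀ E.stable (varList k τ) i _ (hm (e + Pi.single i 1))
        (topA_stable (E.action.leibniz i) (E.stable i) (hm _))
      have h4 := W.C_smul_mem_imD ((e i + 1 : ℤ) : k)⁻¹ h3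
      convert h4 using 1
      rw [← TopQ.mk_smul]
      congr 1
      rw [E.action_D, der_laurent hinj, Algebra.smul_def, ← mul_assoc]
      have h5 : ((e i + 1 : ℤ) : k) ≠ 0 := by
        rw [Int.cast_ne_zero]
        omega
      have h6 : algebraMap (MvPolynomial τ k) K (C ((e i + 1 : ℤ) : k)⁻¹) * ((e i + 1 : ℤ) : K) =
          1 := by
        rw [← map_intCast (algebraMap (MvPolynomial τ k) K),
          ← map_intCast (C : k →+* MvPolynomial τ k), ← map_mul, ← C_mul, inv_mul_cancel₀ h5,
          C_1, map_one]
      rw [h6, one_mul]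
    · refine ⟨1, ?_⟩
      have h3 : e = fun _ => -1 := by
        push Not at h1 h2
        ext i
        have := h1 i
        have := h2 i
        omega
      subst h3
      rw [C_1, one_smul, sub_self]
      exact zero_mem _
  refine ⟨w, fun h => ?_⟩
  obtain ⟨x, hx, rfl⟩ := h.exists_mk
  obtain ⟨n, hn⟩ := exists_prod_pow_smul_mem_of_mem_topA hx
  obtain ⟨f, hf⟩ := hn n le_rfl
  have hz : algebraMap (MvPolynomial τ k) K ((varList k τ).prod ^ n) =
      laurent k K (fun _ : τ => (n : ℤ)) := by
    rw [varList, Finset.prod_map_toList, map_pow, map_prod, laurent, ← Finset.prod_pow]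
    simp
  have hx' : x = algebraMap (MvPolynomial τ k) K f * laurent k K (fun _ : τ => (-n : ℤ)) := by
    rw [Algebra.smul_def, hz, Algebra.linearMap_apply] at hf
    rw [hf, mul_right_comm, ← laurent_add hinj]
    have : laurent k K ((fun _ : τ => (n : ℤ)) + fun _ => (-n : ℤ)) = 1 := by
      simp [laurent]
    rw [this, one_mul]
  have hmem (f : MvPolynomial τ k) :
      (algebraMap (MvPolynomial τ k) K f * laurent k K (fun _ : τ => (-n : ℤ))) ∈
      topA A₀ (varList k τ) := by
    rw [← Algebra.smul_def]
    exact Submodule.smul_mem _ f (hm _)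
  suffices ∀ f, ∃ c : k, TopQ.mk _ (hmem f) - (C c : MvPolynomial τ k) • w ∈ W.imD by
    obtain ⟨c, hc⟩ := this f
    exact ⟨c, by convert hc⟩
  intro f
  induction f using MvPolynomial.induction_on' with
  | monomial a b =>
    obtain ⟨c, hc⟩ := hmono ((fun i => (a i : ℤ)) + fun _ => (-n : ℤ))
    refine ⟨b * c, ?_⟩
    have h1 := W.C_smul_mem_imD b hc
    rw [smul_sub, ← TopQ.mk_smul, ← mul_smul, ← C_mul] at h1
    convert h1 using 3
    rw [Algebra.smul_def, laurent_add hinj, ← mul_assoc, ← algebraMap_monomial]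
  | add p q hp hq =>
    obtain ⟨c, hc⟩ := hp
    obtain ⟨c', hc'⟩ := hq
    refine ⟨c + c', ?_⟩
    have h1 := add_mem hc hc'
    convert h1 using 1
    rw [C_add, add_smul, sub_add_sub_comm, ← TopQ.mk_add]
    congr 2
    rw [map_add, add_mul]

end LocCohTop

namespace LocCohTop
open MvPolynomial

section Torsion

variable {k : Type} [Field k] {σ : Type} [Fintype σ] {H : Type} [AddCommGroup H]
  [Module (MvPolynomial σ k) H]

lemma exists_varNil_of_forall_pow {h : H}
    (hX : ∀ i, ∃ m, (X i : MvPolynomial σ k) ^ m • h = 0) : ∃ n, VarNil k σ n h := by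
  choose m hm using hX
  exact ⟨_, varNil_of_pow _ h m rfl hm⟩

omit [Fintype σ] in
lemma mem_soc_map {H' : Type} [AddCommGroup H'] [Module (MvPolynomial σ k) H']
    (e : H →ₗ[MvPolynomial σ k] H') {h : H} (hh : h ∈ soc k σ H) : e h ∈ soc k σ H' := fun i => by
  rw [← map_smul, hh i, map_zero]

omit [Fintype σ] in
lemma exists_pow_smul_topQ_eq_zero {K : Type} [AddCommGroup K] [Module (MvPolynomial σ k) K]
    {A₀ : Submodule (MvPolynomial σ k) K} {L : List (MvPolynomial σ k)} (q : TopQ A₀ L)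
    {z : MvPolynomial σ k} (hz : z ∈ (Ideal.span {f | f ∈ L}).radical) : ∃ m, z ^ m • q = 0 := by
  obtain ⟨c, hc, rfl⟩ := q.exists_mk
  obtain ⟨m, hm⟩ := exists_pow_smul_mem_topB_of_mem_radical hc hz
  exact ⟨m, by rw [← TopQ.mk_smul]; exact TopQ.mk_eq_zero.2 hm⟩

end Torsion

section Field

variable {S : Type} [CommRing S] {K : Type} [Field K] [Algebra S K]
  (hinj : Function.Injective (algebraMap S K))
include hinj

lemma bijective_smul_of_ne_zero (f : S) (hf : f ≠ 0) : Function.Bijective fun c : K => f • c := by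
  have hf' : algebraMap S K f ≠ 0 := by rwa [Ne, map_eq_zero_iff _ hinj]
  simp only [Algebra.smul_def]
  exact mulLeft_bijective₀ _ hf'

end Field

variable {k : Type} [Field k] [CharZero k] {τ : Type} [Fintype τ] [Nonempty τ] {K : Type} [Field K]
  [Algebra (MvPolynomial τ k) K]

/-- The coinvariants of the top quotient attached to a system of parameters at the origin are
at most one-dimensional. -/
theorem exists_coinvariant_generator_of_radical_eq
    (hinj : Function.Injective (algebraMap (MvPolynomial τ k) K)) (E : ExtDer k τ K)
    (L : List (MvPolynomial τ k)) (hL : ∀ f ∈ L, f ≠ 0) (hlen : L.length = Fintype.card τ)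
    (hrad : (Ideal.span {f | f ∈ L}).radical =
      (Ideal.span (Set.range (X : τ → MvPolynomial τ k))).radical) :
    ∃ w : TopQ (LinearMap.range (Algebra.linearMap (MvPolynomial τ k) K)) L,
      ∀ h, ∃ c : k, h - (C c : MvPolynomial τ k) • w ∈
        (topQAction E.action _ E.stable L).imD := by
  have hK := bijective_smul_of_ne_zero (K := K) hinj
  have hlen' : (varList k τ).length = Fintype.card τ := by simp [varList]
  have hpos : 0 < Fintype.card τ := Fintype.card_pos
  have hvar : ∀ f ∈ varList k τ, f ≠ 0 := by
    intro f hf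
    obtain ⟨i, rfl⟩ := mem_varList.1 hf
    exact X_ne_zero i
  obtain ⟨e₁⟩ := exists_localCohomology_equiv_of_radical_eq
    (Algebra.linearMap (MvPolynomial τ k) K) hinj hK L hL
    (by rintro rfl; simp at hlen; omega) (Ideal.span (Set.range X))
    (by rw [listIdeal_eq, hrad]) _ hlen.symm
  obtain ⟨e₂⟩ := exists_localCohomology_equiv_of_radical_eq
    (Algebra.linearMap (MvPolynomial τ k) K) hinj hK (varList k τ) hvar
    (by intro h; rw [h] at hlen'; simp at hlen'; omega) (Ideal.span (Set.range X))
    (by rw [listIdeal_eq, setOf_mem_varList]) _ hlen'.symm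
  have htor {L' : List (MvPolynomial τ k)} (hr : (Ideal.span {f | f ∈ L'}).radical =
      (Ideal.span (Set.range (X : τ → MvPolynomial τ k))).radical)
      (h : TopQ (LinearMap.range (Algebra.linearMap (MvPolynomial τ k) K)) L') :
      ∃ n, VarNil k τ n h :=
    exists_varNil_of_forall_pow fun i => exists_pow_smul_topQ_eq_zero h (by
      rw [hr]
      exact Ideal.le_radical (Ideal.subset_span ⟨i, rfl⟩))
  refine exists_coinvariant_generator _ (htor hrad) ?_
  let e := e₁.symm.trans e₂
  suffices ∃ u, ∀ v ∈ soc k τ (TopQ (LinearMap.range (Algebra.linearMap (MvPolynomial τ k) K))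
      (varList k τ)), ∃ c : k, v = (C c : MvPolynomial τ k) • u by
    obtain ⟨u, hu⟩ := this
    refine ⟨e.symm u, fun v hv => ?_⟩
    obtain ⟨c, hc⟩ := hu (e v) (mem_soc_map e.toLinearMap hv)
    exact ⟨c, by rw [← map_smul, ← hc, e.symm_apply_apply]⟩
  by_cases h0 : ∃ h : TopQ (LinearMap.range (Algebra.linearMap (MvPolynomial τ k) K))
      (varList k τ), h ≠ 0
  · obtain ⟨w, hw⟩ := varList_coinvariants hinj E
    obtain ⟨u, -, -, -, hu⟩ := exists_soc_generator _
      (htor (by rw [setOf_mem_varList])) w hw h0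
    exact ⟨u, hu⟩
  · push Not at h0
    exact ⟨0, fun v _ => ⟨0, by rw [h0 v, smul_zero]⟩⟩

end LocCohTop

namespace LocCohTop
open MvPolynomial

section Bombieri

variable {σ : Type} [Fintype σ]

/-- The factorial of a multi-index. -/
def multiFactorial (a : σ →₀ ℕ) : ℚ := ∏ i, ((a i).factorial : ℚ)

lemma multiFactorial_pos (a : σ →₀ ℕ) : 0 < multiFactorial a :=
  Finset.prod_pos fun i _ => by exact_mod_cast Nat.factorial_pos _

lemma multiFactorial_add_single (a : σ →₀ ℕ) (i : σ) :
    multiFactorial (a + Finsupp.single i 1) = (a i + 1) * multiFactorial a := by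
  classical
  rw [multiFactorial, multiFactorial, ← Finset.mul_prod_erase _ _ (Finset.mem_univ i),
    ← Finset.mul_prod_erase _ (fun i => ((a i).factorial : ℚ)) (Finset.mem_univ i), ← mul_assoc]
  congr 1
  · simp [Nat.factorial_succ]
  · exact Finset.prod_congr rfl fun j hj => by
      simp [Finsupp.single_eq_of_ne (Finset.ne_of_mem_erase hj)]

/-- The Bombieri form on polynomials with rational coefficients. -/
noncomputable def bombieri : MvPolynomial σ ℚ →ₗ[ℚ] MvPolynomial σ ℚ →ₗ[ℚ] ℚ :=
  (basisMonomials σ ℚ).constr ℚ fun a => multiFactorial a • lcoeff ℚ a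

lemma bombieri_monomial (a : σ →₀ ℕ) (g : MvPolynomial σ ℚ) :
    bombieri (monomial a 1) g = multiFactorial a * coeff a g := by
  have h : bombieri (monomial a (1 : ℚ)) = multiFactorial a • lcoeff ℚ a := by
    have := (basisMonomials σ ℚ).constr_basis ℚ (fun a => multiFactorial a • lcoeff ℚ a) a
    rwa [coe_basisMonomials] at this
  rw [h]
  rfl

omit [Fintype σ] in
lemma bombieri_ext {F G : MvPolynomial σ ℚ →ₗ[ℚ] ℚ} (h : ∀ a, F (monomial a 1) = G (monomial a 1))
    (f : MvPolynomial σ ℚ) : F f = G f := by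
  have : F = G := (basisMonomials σ ℚ).ext fun a => by simpa using h a
  rw [this]

lemma bombieri_symm (f g : MvPolynomial σ ℚ) : bombieri f g = bombieri g f := by
  classical
  refine bombieri_ext (F := bombieri.flip g) (G := bombieri g) (fun a => ?_) f
  refine bombieri_ext (F := bombieri (monomial a 1)) (G := bombieri.flip (monomial a 1))
    (fun b => ?_) g
  rw [LinearMap.flip_apply, bombieri_monomial, bombieri_monomial, coeff_monomial, coeff_monomial]
  by_cases h : a = b
  · subst h; rfl
  · rw [if_neg h, if_neg (Ne.symm h), mul_zero, mul_zero]

lemma bombieri_self (f : MvPolynomial σ ℚ) (hf : f ≠ 0) : 0 < bombieri f f := by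
  have h : bombieri f f = ∑ a ∈ f.support, multiFactorial a * (coeff a f) ^ 2 := by
    conv_lhs => enter [1, 2]; rw [f.as_sum]
    rw [map_sum, LinearMap.sum_apply]
    refine Finset.sum_congr rfl fun a _ => ?_
    rw [← mul_one (coeff a f), ← smul_eq_mul, ← smul_monomial, map_smul, LinearMap.smul_apply,
      bombieri_monomial, smul_eq_mul, smul_eq_mul, mul_one]
    ring
  rw [h]
  refine Finset.sum_pos (fun a ha => mul_pos (multiFactorial_pos a) ?_) (support_nonempty.2 hf)
  exact sq_pos_iff.2 (mem_support_iff.1 ha)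

lemma bombieri_X_mul (i : σ) (f g : MvPolynomial σ ℚ) :
    bombieri (X i * f) g = bombieri f (pderiv i g) := by
  refine bombieri_ext (F := bombieri.flip g ∘ₗ LinearMap.mulLeft ℚ (X i))
    (G := bombieri.flip (pderiv i g)) (fun a => ?_) f
  have h : X i * monomial a (1 : ℚ) = monomial (a + Finsupp.single i 1) 1 := by
    rw [X, monomial_mul, one_mul, add_comm]
  simp only [LinearMap.comp_apply, LinearMap.mulLeft_apply, LinearMap.flip_apply]
  rw [h, bombieri_monomial, bombieri_monomial, coeff_pderiv, multiFactorial_add_single]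
  ring

end Bombieri

section Polarization

variable {k : Type} [Field k] {ι κ : Type} [Fintype κ]

/-- The polarization operators on functions on matrices. -/
noncomputable def polar (k : Type) [Field k] {ι κ : Type} [Fintype κ] (i j : ι) :
    Derivation k (MvPolynomial (ι × κ) k) (MvPolynomial (ι × κ) k) :=
  ∑ l, (X (i, l) : MvPolynomial (ι × κ) k) • pderiv (j, l)

lemma polar_apply (i j : ι) (f : MvPolynomial (ι × κ) k) :
    polar k i j f = ∑ l, X (i, l) * pderiv (j, l) f := by
  rw [polar, ← Derivation.coeFnAddMonoidHom_apply, map_sum, Finset.sum_apply]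
  rfl

lemma polar_X [DecidableEq ι] (i j a : ι) (l : κ) :
    polar k i j (X (a, l)) = if a = j then X (i, l) else 0 := by
  classical
  rw [polar_apply]
  simp only [pderiv_X, Pi.single_apply, Prod.mk.injEq, mul_ite, mul_one, mul_zero]
  by_cases h : a = j
  · simp [h]
  · simp [h]

/-- Invariance under the special linear Lie algebra. -/
def IsInv (f : MvPolynomial (ι × κ) k) : Prop := ∀ i j, i ≠ j → polar k i j f = 0

lemma isHomogeneous_polar (i j : ι) {f : MvPolynomial (ι × κ) k} {n : ℕ} (hf : f.IsHomogeneous n) :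
    (polar k i j f).IsHomogeneous n := by
  rw [polar_apply]
  refine IsHomogeneous.sum _ _ _ fun l _ => ?_
  rcases Nat.eq_zero_or_pos n with rfl | hn
  · obtain ⟨c, rfl⟩ : ∃ c, f = C c :=
    ⟨_, totalDegree_eq_zero_iff_eq_C.1 (hf.totalDegree_le.antisymm bot_le)⟩
    rw [pderiv_C, mul_zero]
    exact isHomogeneous_zero _ _ _
  · have := (isHomogeneous_X k (i, l)).mul (hf.pderiv (i := (j, l)))
    rwa [Nat.add_sub_cancel' hn] at this

variable [Fintype ι]

lemma bombieri_polar (i j : ι) (f g : MvPolynomial (ι × κ) ℚ) :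
    bombieri (polar ℚ i j f) g = bombieri f (polar ℚ j i g) := by
  rw [polar_apply, polar_apply, map_sum, map_sum, LinearMap.sum_apply]
  refine Finset.sum_congr rfl fun l _ => ?_
  rw [bombieri_X_mul, bombieri_symm, bombieri_symm f, bombieri_X_mul]

lemma IsInv.bombieri_eq_zero {f : MvPolynomial (ι × κ) ℚ} (hf : IsInv f) {i j : ι} (hij : i ≠ j)
    (g : MvPolynomial (ι × κ) ℚ) : bombieri f (polar ℚ i j g) = 0 := by
  rw [← bombieri_polar, hf j i hij.symm, map_zero, LinearMap.zero_apply]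

/-- The span of the images of the nilpotent polarization operators. -/
noncomputable def imPolar (k : Type) [Field k] (ι κ : Type) [Fintype κ] :
    Submodule k (MvPolynomial (ι × κ) k) :=
  Submodule.span k {x | ∃ i j f, i ≠ j ∧ polar k i j f = x}

omit [Fintype ι] in
lemma polar_mem_imPolar {i j : ι} (hij : i ≠ j) (f : MvPolynomial (ι × κ) k) :
    polar k i j f ∈ imPolar k ι κ := Submodule.subset_span ⟨i, j, f, hij, rfl⟩

omit [Fintype ι] in
lemma IsInv.mul_mem_imPolar {b x : MvPolynomial (ι × κ) k} (hb : IsInv b)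
    (hx : x ∈ imPolar k ι κ) : b * x ∈ imPolar k ι κ := by
  induction hx using Submodule.span_induction with
  | mem x hx =>
    obtain ⟨i, j, f, hij, rfl⟩ := hx
    have := polar_mem_imPolar hij (b * f)
    rwa [Derivation.leibniz, hb i j hij, smul_zero, add_zero, smul_eq_mul] at this
  | zero => rw [mul_zero]; exact zero_mem _
  | add x y _ _ hx hy => rw [mul_add]; exact add_mem hx hy
  | smul c x _ hx => rw [mul_smul_comm]; exact Submodule.smul_mem _ c hx

lemma IsInv.eq_zero_of_mem_imPolar {b : MvPolynomial (ι × κ) ℚ} (hb : IsInv b)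
    (hx : b ∈ imPolar ℚ ι κ) : b = 0 := by
  by_contra h
  have h0 : ∀ x ∈ imPolar ℚ ι κ, bombieri b x = 0 := fun x hx => by
    induction hx using Submodule.span_induction with
    | mem x hx =>
      obtain ⟨i, j, f, hij, rfl⟩ := hx
      exact hb.bombieri_eq_zero hij f
    | zero => exact map_zero _
    | add x y _ _ hx hy => rw [map_add, hx, hy, add_zero]
    | smul c x _ hx => rw [map_smul, hx, smul_zero]
  exact (bombieri_self b h).ne' (h0 b hx)

lemma exists_isInv_sub_mem_rat {f : MvPolynomial (ι × κ) ℚ} {n : ℕ} (hf : f.IsHomogeneous n) :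
    ∃ b, IsInv b ∧ b.IsHomogeneous n ∧ f - b ∈ imPolar ℚ ι κ := by
  let V := homogeneousSubmodule (ι × κ) ℚ n
  let W : Submodule ℚ (MvPolynomial (ι × κ) ℚ) :=
    Submodule.span ℚ {x | ∃ i j, ∃ f ∈ V, i ≠ j ∧ polar ℚ i j f = x}
  have hWV : W ≤ V := Submodule.span_le.2 (by
    rintro _ ⟨i, j, f, hf, -, rfl⟩
    exact isHomogeneous_polar i j hf)
  have hVfin : V ≤ restrictTotalDegree (ι × κ) ℚ n := fun g hg => by
    rw [mem_restrictTotalDegree]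
    exact IsHomogeneous.totalDegree_le hg
  have : FiniteDimensional ℚ W := Submodule.finiteDimensional_of_le (hWV.trans hVfin)
  let T : W →ₗ[ℚ] Module.Dual ℚ W := (bombieri.domRestrict₁₂ W W)
  have hT : Function.Injective T := by
    rw [injective_iff_map_eq_zero]
    intro w hw
    by_contra h
    refine (bombieri_self w.1 (by simpa using h)).ne' ?_
    exact congrArg (fun F : Module.Dual ℚ W => F w) hw
  have hTs : Function.Surjective T :=
    (LinearMap.injective_iff_surjective_of_finrank_eq_finrank Subspace.dual_finrank_eq.symm).1 hT
  obtain ⟨w, hw⟩ := hTs ((bombieri f).domRestrict W)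
  have hb (x) (hx : x ∈ W) : bombieri (f - w.1) x = 0 := by
    rw [map_sub, LinearMap.sub_apply, sub_eq_zero]
    exact (congrArg (fun F : Module.Dual ℚ W => F ⟨x, hx⟩) hw).symm
  have hbV : f - w.1 ∈ V := sub_mem hf (hWV w.2)
  refine ⟨f - w.1, fun i j hij => ?_, hbV, ?_⟩
  · by_contra h
    refine (bombieri_self _ h).ne' ?_
    rw [bombieri_polar]
    exact hb _ (Submodule.subset_span
      ⟨j, i, _, isHomogeneous_polar i j hbV, hij.symm, rfl⟩)
  · rw [sub_sub_cancel]
    refine Submodule.span_mono ?_ w.2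
    rintro _ ⟨i, j, f, -, hij, rfl⟩
    exact ⟨i, j, f, hij, rfl⟩

omit [Fintype ι] in
lemma map_polar {k' : Type} [Field k'] (φ : k →+* k') (i j : ι) (f : MvPolynomial (ι × κ) k) :
    map φ (polar k i j f) = polar k' i j (map φ f) := by
  simp only [polar_apply, map_sum, map_mul, map_X, pderiv_map]

omit [Fintype ι] in
lemma IsInv.map {k' : Type} [Field k'] (φ : k →+* k') {f : MvPolynomial (ι × κ) k} (hf : IsInv f) :
    IsInv (MvPolynomial.map φ f) := fun i j hij => by
  rw [← map_polar, hf i j hij, map_zero]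

omit [Fintype ι] in
lemma map_mem_imPolar {k' : Type} [Field k'] (φ : k →+* k') {f : MvPolynomial (ι × κ) k}
    (hf : f ∈ imPolar k ι κ) : map φ f ∈ imPolar k' ι κ := by
  induction hf using Submodule.span_induction with
  | mem x hx =>
    obtain ⟨i, j, f, hij, rfl⟩ := hx
    rw [map_polar]
    exact polar_mem_imPolar hij _
  | zero => rw [map_zero]; exact zero_mem _
  | add x y _ _ hx hy => rw [map_add]; exact add_mem hx hy
  | smul c x _ hx =>
    rw [smul_eq_C_mul, map_mul, map_C, ← smul_eq_C_mul]
    exact Submodule.smul_mem _ _ hx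

omit [Fintype ι] in
lemma IsInv.sum {α : Type*} (s : Finset α) {F : α → MvPolynomial (ι × κ) k}
    (h : ∀ a ∈ s, IsInv (F a)) : IsInv (∑ a ∈ s, F a) := fun i j hij => by
  rw [map_sum]
  exact Finset.sum_eq_zero fun a ha => h a ha i j hij

omit [Fintype ι] in
lemma IsInv.smul {f : MvPolynomial (ι × κ) k} (hf : IsInv f) (c : k) : IsInv (c • f) :=
  fun i j hij => by rw [Derivation.map_smul, hf i j hij, smul_zero]

/-- Complete reducibility: every homogeneous polynomial is invariant up to the image of the
polarization operators. -/
lemma exists_isInv_sub_mem [CharZero k] {f : MvPolynomial (ι × κ) k} {n : ℕ}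
    (hf : f.IsHomogeneous n) : ∃ b, IsInv b ∧ b.IsHomogeneous n ∧ f - b ∈ imPolar k ι κ := by
  have h (a : ι × κ →₀ ℕ) (ha : a ∈ f.support) : ∃ b : MvPolynomial (ι × κ) k,
      IsInv b ∧ b.IsHomogeneous n ∧ monomial a (coeff a f) - b ∈ imPolar k ι κ := by
    have ha' : a.degree = n := by
      rw [Finsupp.degree_eq_weight_one]
      exact hf (mem_support_iff.1 ha)
    obtain ⟨b, hb, hbn, hab⟩ := exists_isInv_sub_mem_rat (isHomogeneous_monomial (1 : ℚ) ha')
    refine ⟨coeff a f • map (algebraMap ℚ k) b, (hb.map _).smul _,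
      (homogeneousSubmodule _ _ _).smul_mem _ (hbn.map _), ?_⟩
    have h1 := Submodule.smul_mem _ (coeff a f) (map_mem_imPolar (algebraMap ℚ k) hab)
    rwa [map_sub, smul_sub, map_monomial, map_one, smul_monomial, smul_eq_mul, mul_one] at h1
  choose! b hb hbn hab using h
  refine ⟨∑ a ∈ f.support, b a, IsInv.sum _ hb, IsHomogeneous.sum _ _ _ hbn, ?_⟩
  nth_rewrite 1 [f.as_sum]
  rw [← Finset.sum_sub_distrib]
  exact Submodule.sum_mem _ hab

end Polarization

end LocCohTop

namespace LocCohTop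
open MvPolynomial

lemma derivation_intertwine {k σ A : Type*} [Field k] [CommRing A] (γ : MvPolynomial σ k →+* A)
    (d : Derivation ℤ A A) (δ : Derivation k (MvPolynomial σ k) (MvPolynomial σ k))
    (hC : ∀ c, d (γ (C c)) = 0) (hX : ∀ i, d (γ (X i)) = γ (δ (X i))) (f : MvPolynomial σ k) :
    d (γ f) = γ (δ f) := by
  induction f using MvPolynomial.induction_on with
  | C a => rw [hC, derivation_C, map_zero]
  | add p q hp hq => simp only [map_add, hp, hq]
  | mul_X p i hp =>
    rw [map_mul, Derivation.leibniz, Derivation.leibniz, hp, hX, smul_eq_mul, smul_eq_mul,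
      smul_eq_mul, smul_eq_mul, map_add, map_mul, map_mul]

section

variable {k : Type} [Field k] {ι κ : Type} [Fintype κ] [Fintype ι]

omit [Fintype ι] in
lemma polar_comm_sub (i j : ι) (hij : i ≠ j) (f : MvPolynomial (ι × κ) k) :
    polar k i j (polar k j i f) - polar k j i (polar k i j f) =
      polar k i i f - polar k j j f := by
  classical
  have h : ⁅polar (κ := κ) k i j, polar (κ := κ) k j i⁆ = polar (κ := κ) k i i -
      polar (κ := κ) k j j := by
    apply derivation_ext
    rintro ⟨a, l⟩
    rw [Derivation.commutator_apply, Derivation.sub_apply, polar_X, polar_X, polar_X, polar_X]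
    by_cases h1 : a = i
    · subst h1
      simp [hij, polar_X]
    · by_cases h2 : a = j
      · subst h2
        simp [hij.symm, polar_X]
      · simp [h1, h2]
  have h1 := congrArg (fun d => d f) h
  simpa only [Derivation.commutator_apply, Derivation.sub_apply] using h1

lemma sum_polar_self {f : MvPolynomial (ι × κ) k} {n : ℕ} (hf : f.IsHomogeneous n) :
    ∑ i, polar k i i f = n • f := by
  rw [← hf.sum_X_mul_pderiv, Fintype.sum_prod_type]
  exact Finset.sum_congr rfl fun i _ => polar_apply i i f

lemma IsInv.card_smul_polar_self {f : MvPolynomial (ι × κ) k} {n : ℕ} (hf : IsInv f)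
    (hn : f.IsHomogeneous n) (i : ι) : Fintype.card ι • polar k i i f = n • f := by
  have h (j) : polar k j j f = polar k i i f := by
    by_cases hij : j = i
    · rw [hij]
    · have := polar_comm_sub j i hij f
      rw [hf j i hij, hf i j (Ne.symm hij), map_zero, map_zero, sub_zero] at this
      exact (sub_eq_zero.1 this.symm)
  rw [← sum_polar_self hn, Finset.sum_congr rfl fun j _ => h j, Finset.sum_const,
    Finset.card_univ]

omit [Fintype ι] in
lemma coeff_polar_self (i : ι) (f : MvPolynomial (ι × κ) k) (a : ι × κ →₀ ℕ) :
    coeff a (polar k i i f) = (∑ l, a (i, l) : ℕ) * coeff a f := by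
  classical
  rw [polar_apply, coeff_sum, Nat.cast_sum, Finset.sum_mul]
  refine Finset.sum_congr rfl fun l _ => ?_
  rw [coeff_X_mul']
  split_ifs with h
  · rw [coeff_pderiv]
    have h1 : Finsupp.single (i, l) 1 ≤ a := by
      rw [Finsupp.single_le_iff]
      exact Nat.one_le_iff_ne_zero.2 (Finsupp.mem_support_iff.1 h)
    have h2 : a (i, l) = (a - Finsupp.single (i, l) 1 : ι × κ →₀ ℕ) (i, l) + 1 := by
      rw [Finsupp.tsub_apply, Finsupp.single_eq_same]
      have := Nat.one_le_iff_ne_zero.2 (Finsupp.mem_support_iff.1 h)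
      omega
    rw [tsub_add_cancel_of_le h1]
    conv_rhs => rw [h2]
    push_cast
    ring
  · rw [Finsupp.notMem_support_iff.1 h]
    simp

variable [CharZero k]

/-- The degree of an invariant in each row. -/
lemma IsInv.card_mul_rowDegree {f : MvPolynomial (ι × κ) k} {n : ℕ} (hf : IsInv f)
    (hn : f.IsHomogeneous n) {a : ι × κ →₀ ℕ} (ha : a ∈ f.support) (i : ι) :
    Fintype.card ι * ∑ l, a (i, l) = n := by
  have h := congrArg (coeff a) (hf.card_smul_polar_self hn i)
  rw [coeff_smul, coeff_smul, coeff_polar_self, nsmul_eq_mul, nsmul_eq_mul, ← mul_assoc,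
    mul_eq_mul_right_iff] at h
  rcases h with h | h
  · exact_mod_cast h
  · exact absurd h (mem_support_iff.1 ha)

variable {F : Type} [Field F] [Algebra k F] [DecidableEq ι]

/-- The value of a function at a matrix. -/
noncomputable abbrev evalMat (N : Matrix ι κ F) : MvPolynomial (ι × κ) k →ₐ[k] F :=
  aeval fun p => N p.1 p.2

lemma IsInv.evalMat_diagonal_mul {f : MvPolynomial (ι × κ) k} {w : ℕ} [Nonempty ι] (hf : IsInv f)
    (hn : f.IsHomogeneous (Fintype.card ι * w)) (v : ι → F) (N : Matrix ι κ F) :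
    evalMat (Matrix.diagonal v * N) f = (∏ i, v i) ^ w * evalMat N f := by
  rw [aeval_eq_eval₂Hom, aeval_eq_eval₂Hom, coe_eval₂Hom, coe_eval₂Hom, eval₂_eq', eval₂_eq',
    Finset.mul_sum]
  refine Finset.sum_congr rfl fun a ha => ?_
  have h1 (i) : ∑ l, a (i, l) = w :=
    Nat.eq_of_mul_eq_mul_left Fintype.card_pos (hf.card_mul_rowDegree hn ha i)
  have h2 : ∏ p : ι × κ, (Matrix.diagonal v * N) p.1 p.2 ^ a p =
      (∏ i, v i) ^ w * ∏ p : ι × κ, N p.1 p.2 ^ a p := by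
    simp only [Matrix.diagonal_mul, mul_pow]
    rw [Finset.prod_mul_distrib]
    congr 1
    rw [Fintype.prod_prod_type, ← Finset.prod_pow]
    refine Finset.prod_congr rfl fun i _ => ?_
    change ∏ l, v i ^ a (i, l) = v i ^ w
    rw [Finset.prod_pow_eq_pow_sum, h1]
  rw [h2]
  ring

lemma IsInv.evalMat_transvection_mul {f : MvPolynomial (ι × κ) k} (hf : IsInv f) {i j : ι}
    (hij : i ≠ j) (c : F) (N : Matrix ι κ F) :
    evalMat (Matrix.transvection i j c * N) f = evalMat N f := by
  have : CharZero F := charZero_of_injective_algebraMap (algebraMap k F).injective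
  let γ : MvPolynomial (ι × κ) k →ₐ[k] Polynomial F := aeval fun p =>
    Polynomial.C (N p.1 p.2) + if p.1 = i then Polynomial.X * Polynomial.C (N j p.2) else 0
  have hγ (t : F) : (Polynomial.aeval t (γ f) : F) = evalMat (Matrix.transvection i j t * N) f := by
    have : ((Polynomial.aeval t : Polynomial F →ₐ[F] F).restrictScalars k).comp γ =
        evalMat (Matrix.transvection i j t * N) := by
      apply algHom_ext
      rintro ⟨a, l⟩
      simp only [γ, AlgHom.comp_apply, aeval_X, AlgHom.restrictScalars_apply, map_add,
        Polynomial.aeval_C]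
      by_cases h : a = i
      · subst h
        simp
        ring
      · rw [Matrix.transvection_mul_apply_of_ne _ _ _ _ h]
        simp [h]
    exact congrArg (fun e => e f) this
  have hd : Polynomial.derivative (γ f) = 0 := by
    have h1 := derivation_intertwine γ.toRingHom
      ((Polynomial.derivative' (R := F)).restrictScalars ℤ) (polar k j i) (fun c => ?_)
      (fun p => ?_) f
    · rw [hf j i hij.symm, map_zero] at h1
      exact h1
    · change Polynomial.derivative (γ (C c)) = 0
      rw [algHom_C, IsScalarTower.algebraMap_apply k F (Polynomial F)]
      exact Polynomial.derivative_C
    · obtain ⟨a, l⟩ := p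
      change Polynomial.derivative (γ (X (a, l))) = γ (polar k j i (X (a, l)))
      rw [polar_X]
      by_cases h : a = i
      · subst h
        simp [γ, hij.symm]
      · simp [γ, h]
  have hconst := Polynomial.derivative_eq_zero.1 hd
  obtain ⟨x, hx⟩ := Polynomial.natDegree_eq_zero.1 hconst
  have h0 := hγ 0
  rw [Matrix.transvection_zero, Matrix.one_mul] at h0
  rw [← h0, ← hγ c, ← hx, Polynomial.aeval_C, Polynomial.aeval_C]

/-- Semi-invariance of the invariants under the general linear group. -/
theorem IsInv.evalMat_mul [Nonempty ι] {f : MvPolynomial (ι × κ) k} {w : ℕ} (hf : IsInv f)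
    (hn : f.IsHomogeneous (Fintype.card ι * w)) (g : Matrix ι ι F) (N : Matrix ι κ F) :
    evalMat (g * N) f = g.det ^ w * evalMat N f := by
  refine Matrix.diagonal_transvection_induction
    (fun g => ∀ N : Matrix ι κ F, evalMat (g * N) f = g.det ^ w * evalMat N f) g
    (fun D _ N => ?_) (fun t N => ?_) (fun A B hA hB N => ?_) N
  · rw [hf.evalMat_diagonal_mul hn, Matrix.det_diagonal]
  · rw [t.det, one_pow, one_mul]
    exact hf.evalMat_transvection_mul t.hij t.c N
  · rw [Matrix.mul_assoc, hA, hB, Matrix.det_mul, mul_pow, mul_assoc]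

end

end LocCohTop

namespace LocCohTop
open MvPolynomial

section Minors

variable {r s : ℕ} {T : Type*} [CommRing T]

lemma minorSum_zero (hrs : r ≤ s) (M : Matrix (Fin r) (Fin s) T) :
    minorSum M 0 = (M.submatrix id (Fin.castLE hrs)).det := by
  have h : (Finset.univ.filter fun S : Fin r ↪o Fin s =>
      ∑ i, (S i : ℕ) = 0 + ∑ i : Fin r, (i : ℕ)) = {Fin.castLEOrderEmb hrs} := by
    ext S
    simp only [Finset.mem_filter, Finset.mem_univ, true_and, zero_add, Finset.mem_singleton]
    constructor
    · intro h
      ext i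
      rw [coe_orderEmb_of_sum_eq S h i]
      rfl
    · rintro rfl
      rfl
  rw [minorSum, h, Finset.sum_singleton]
  rfl

lemma minorSum_mul (g : Matrix (Fin r) (Fin r) T) (N : Matrix (Fin r) (Fin s) T) (t : ℕ) :
    minorSum (g * N) t = g.det * minorSum N t := by
  rw [minorSum, minorSum, Finset.mul_sum]
  refine Finset.sum_congr rfl fun S _ => ?_
  rw [← Matrix.det_mul]
  rfl

/-- The matrix with an identity block in the first columns. -/
def stdMat (y : Fin r → {j : Fin s // r ≤ j} → T) : Matrix (Fin r) (Fin s) T := fun i j =>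
  if h : r ≤ j then y i ⟨j, h⟩ else if (i : ℕ) = j then 1 else 0

lemma stdMat_submatrix (hrs : r ≤ s) (y : Fin r → {j : Fin s // r ≤ j} → T) :
    (stdMat y).submatrix id (Fin.castLE hrs) = 1 := by
  ext i j
  have := j.2
  simp [stdMat, Matrix.one_apply, Fin.ext_iff]

lemma minorSum_stdMat_zero (hrs : r ≤ s) (y : Fin r → {j : Fin s // r ≤ j} → T) :
    minorSum (stdMat y) 0 = 1 := by
  rw [minorSum_zero hrs, stdMat_submatrix hrs, Matrix.det_one]

lemma minorSum_stdMat_of_eq_zero {t : ℕ} (ht : 1 ≤ t) :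
    minorSum (stdMat (0 : Fin r → {j : Fin s // r ≤ j} → T)) t = 0 := by
  refine Finset.sum_eq_zero fun S hS => ?_
  rw [Finset.mem_filter] at hS
  obtain ⟨i, hi⟩ : ∃ i, r ≤ (S i : ℕ) := by
    by_contra! hc
    have h1 : ∀ i : Fin r, (S i : ℕ) ≤ i := by
      intro i
      have := orderEmb_le (OrderEmbedding.ofStrictMono
        (fun i : Fin r => (⟨S i, hc i⟩ : Fin r)) fun a b hab => S.strictMono hab) i
      rw [Nat.sub_self, zero_add] at this
      exact this
    have h2 := Finset.sum_le_sum fun i (_ : i ∈ Finset.univ) => h1 i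
    omega
  exact Matrix.det_eq_zero_of_column_eq_zero i fun a => by simp [stdMat, hi]

lemma stdMat_map {U : Type*} [CommRing U] (f : T →+* U)
    (y : Fin r → {j : Fin s // r ≤ j} → T) :
    (stdMat y).map f = stdMat fun i j => f (y i j) := by
  ext i j
  simp only [Matrix.map_apply, stdMat]
  split_ifs <;> simp

end Minors

section Polynomials

variable {k : Type} [Field k] {ι κ : Type} [Fintype κ] [Fintype ι] [DecidableEq ι]

omit [Fintype κ] in
lemma isHomogeneous_det_X (S : ι → κ) :
    (Matrix.of fun i j => (X (i, S j) : MvPolynomial (ι × κ) k)).det.IsHomogeneous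
      (Fintype.card ι) := by
  rw [Matrix.det_apply]
  refine IsHomogeneous.sum _ _ _ fun σ _ => ?_
  have h : (∏ i, (Matrix.of fun i j => (X (i, S j) : MvPolynomial (ι × κ) k)) (σ i) i).IsHomogeneous
      (Fintype.card ι) := by
    have := IsHomogeneous.prod Finset.univ
      (fun i => (Matrix.of fun i j => (X (i, S j) : MvPolynomial (ι × κ) k)) (σ i) i) (fun _ => 1)
      fun i _ => isHomogeneous_X _ _
    simpa using this
  rw [Units.smul_def, ← Int.cast_smul_eq_zsmul k]
  exact (homogeneousSubmodule _ _ _).smul_mem _ h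

lemma isInv_det_X (S : ι → κ) :
    IsInv (Matrix.of fun i j => (X (i, S j) : MvPolynomial (ι × κ) k)).det := by
  intro i j hij
  let γ : MvPolynomial (ι × κ) k →ₐ[k] Polynomial (MvPolynomial (ι × κ) k) := aeval fun p =>
    Polynomial.C (X p) + if p.1 = j then Polynomial.X * Polynomial.C (X (i, p.2)) else 0
  set f := (Matrix.of fun i j => (X (i, S j) : MvPolynomial (ι × κ) k)).det with hf
  have h1 : γ f = Polynomial.C f := by
    rw [hf, AlgHom.map_det, RingHom.map_det]
    have h2 : γ.mapMatrix (Matrix.of fun i j => (X (i, S j) : MvPolynomial (ι × κ) k)) =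
        Matrix.transvection j i Polynomial.X *
          Polynomial.C.mapMatrix (Matrix.of fun i j => (X (i, S j) : MvPolynomial (ι × κ) k)) := by
      ext1 a b
      by_cases h : a = j
      · subst h
        simp [γ]
      · rw [Matrix.transvection_mul_apply_of_ne _ _ _ _ h]
        simp [γ, h]
    rw [h2, Matrix.det_mul, Matrix.det_transvection_of_ne _ _ hij.symm, one_mul]
  have h3 := derivation_intertwine γ.toRingHom
      ((Polynomial.derivative' (R := MvPolynomial (ι × κ) k)).restrictScalars ℤ) (polar k i j)
      (fun c => ?_) (fun p => ?_) f
  · change Polynomial.derivative (γ f) = γ (polar k i j f) at h3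
    rw [h1, Polynomial.derivative_C] at h3
    have h4 : ((Polynomial.aeval (0 : MvPolynomial (ι × κ) k)).restrictScalars k).comp γ =
        AlgHom.id k _ := by
      apply algHom_ext
      rintro ⟨a, l⟩
      by_cases h : a = j
      · simp [γ, h]
      · simp [γ, h]
    have h5 := congrArg (fun e => e (polar k i j f)) h4
    simp only [AlgHom.comp_apply, ← h3, map_zero, AlgHom.id_apply] at h5
    exact h5.symm
  · change Polynomial.derivative (γ (C c)) = 0
    rw [algHom_C, IsScalarTower.algebraMap_apply k (MvPolynomial (ι × κ) k) (Polynomial _)]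
    exact Polynomial.derivative_C
  · obtain ⟨a, l⟩ := p
    change Polynomial.derivative (γ (X (a, l))) = γ (polar k i j (X (a, l)))
    rw [polar_X]
    by_cases h : a = j
    · subst h
      simp [γ, hij]
    · simp [γ, h]

variable (k) {r s : ℕ} (t : ℕ)

lemma isInv_minorSum : IsInv (minorSum (genericMatrix k r s) t) :=
  IsInv.sum _ fun S _ => isInv_det_X S

lemma isHomogeneous_minorSum : (minorSum (genericMatrix k r s) t).IsHomogeneous r :=
  IsHomogeneous.sum _ _ _ fun S _ => by
    have h := isHomogeneous_det_X (k := k) S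
    rw [Fintype.card_fin] at h
    exact h

end Polynomials

end LocCohTop

namespace LocCohTop
open MvPolynomial

section CoinvariantsInField

variable {k : Type} [Field k] {σ : Type} {K : Type} [AddCommGroup K]
  [Module (MvPolynomial σ k) K]

/-- The elements representing sums of derivatives in the top quotient. -/
noncomputable def imK (W : WeylAction k σ K) (A₀ : Submodule (MvPolynomial σ k) K)
    (L : List (MvPolynomial σ k)) : Submodule ℤ K :=
  (topB A₀ L).restrictScalars ℤ ⊔ ⨆ i, ((topA A₀ L).restrictScalars ℤ).map (W.D i)

variable (W : WeylAction k σ K) (A₀ : Submodule (MvPolynomial σ k) K)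
    (hA₀ : ∀ i, ∀ c ∈ A₀, W.D i c ∈ A₀) (L : List (MvPolynomial σ k))

variable {W A₀ L} in
lemma mem_imK_of_mem_topB {c : K} (hc : c ∈ topB A₀ L) : c ∈ imK W A₀ L :=
  Submodule.mem_sup_left hc

variable {A₀ L} in
lemma D_mem_imK (i : σ) {c : K} (hc : c ∈ topA A₀ L) : W.D i c ∈ imK W A₀ L :=
  Submodule.mem_sup_right (Submodule.mem_iSup_of_mem i ⟨c, hc, rfl⟩)

lemma mk_mem_imD_iff {c : K} (hc : c ∈ topA A₀ L) :
    TopQ.mk c hc ∈ (topQAction W A₀ hA₀ L).imD ↔ c ∈ imK W A₀ L := by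
  constructor
  · intro h
    obtain ⟨c', hc', h1, h2⟩ : ∃ c' hc', TopQ.mk c hc = TopQ.mk (A₀ := A₀) (L := L) c' hc' ∧
        c' ∈ imK W A₀ L := by
      refine Submodule.iSup_induction (fun i => LinearMap.range ((topQAction W A₀ hA₀ L).D i))
        (motive := fun q => ∃ c' hc', q = TopQ.mk (A₀ := A₀) (L := L) c' hc' ∧ c' ∈ imK W A₀ L)
        h ?_ ⟨0, zero_mem _, ((TopQ.mk_eq_zero).2 (zero_mem _)).symm, zero_mem _⟩ ?_
      · rintro i _ ⟨q, rfl⟩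
        obtain ⟨e, he, rfl⟩ := q.exists_mk
        exact ⟨_, _, topQAction_mk W A₀ hA₀ L i e he, D_mem_imK W i he⟩
      · rintro _ _ ⟨a, ha, rfl, ha'⟩ ⟨b, hb, rfl, hb'⟩
        exact ⟨a + b, add_mem ha hb, (TopQ.mk_add ha hb).symm, add_mem ha' hb'⟩
    have h3 := mem_imK_of_mem_topB (W := W) (TopQ.mk_eq_mk.1 h1)
    have := add_mem h3 h2
    rwa [sub_add_cancel] at this
  · intro h
    suffices ∀ c ∈ imK W A₀ L, ∃ hc, TopQ.mk c hc ∈ (topQAction W A₀ hA₀ L).imD from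
      (this c h).2
    intro c hc
    obtain ⟨a, ha, b, hb, rfl⟩ := Submodule.mem_sup.1 hc
    have h1 : ∃ hb, TopQ.mk (A₀ := A₀) (L := L) b hb ∈ (topQAction W A₀ hA₀ L).imD := by
      refine Submodule.iSup_induction _ (motive := fun b => ∃ hb,
        TopQ.mk (A₀ := A₀) (L := L) b hb ∈ (topQAction W A₀ hA₀ L).imD) hb ?_ ?_ ?_
      · rintro i _ ⟨e, he, rfl⟩
        exact ⟨topA_stable (W.leibniz i) (hA₀ i) he, mk_mem_imD W A₀ hA₀ L i e he _⟩
      · refine ⟨zero_mem _, ?_⟩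
        rw [TopQ.mk_eq_zero.2 (zero_mem _)]
        exact zero_mem _
      · rintro x y ⟨hx, hx'⟩ ⟨hy, hy'⟩
        refine ⟨add_mem hx hy, ?_⟩
        rw [TopQ.mk_add hx hy]
        exact add_mem hx' hy'
    obtain ⟨hb, hb'⟩ := h1
    have haA := topB_le_topA A₀ L ha
    refine ⟨add_mem haA hb, ?_⟩
    rw [TopQ.mk_add haA hb, TopQ.mk_eq_zero.2 ha, zero_add]
    exact hb'

/-- The coinvariants are generated by one element. -/
lemma exists_coinvariant_generator_iff :
    (∃ w : TopQ A₀ L, ∀ h, ∃ c : k, h - (C c : MvPolynomial σ k) • w ∈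
        (topQAction W A₀ hA₀ L).imD) ↔
      ∃ w ∈ topA A₀ L, ∀ e ∈ topA A₀ L, ∃ c : k,
        e - (C c : MvPolynomial σ k) • w ∈ imK W A₀ L := by
  constructor
  · rintro ⟨w, hw⟩
    obtain ⟨w, hwA, rfl⟩ := w.exists_mk
    refine ⟨w, hwA, fun e he => ?_⟩
    obtain ⟨c, hc⟩ := hw (TopQ.mk e he)
    rw [← TopQ.mk_smul, ← TopQ.mk_sub, mk_mem_imD_iff] at hc
    exact ⟨c, hc⟩
  · rintro ⟨w, hwA, hw⟩
    refine ⟨TopQ.mk w hwA, fun h => ?_⟩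
    obtain ⟨e, he, rfl⟩ := h.exists_mk
    obtain ⟨c, hc⟩ := hw e he
    refine ⟨c, ?_⟩
    rwa [← TopQ.mk_smul, ← TopQ.mk_sub, mk_mem_imD_iff]

end CoinvariantsInField

end LocCohTop

namespace LocCohTop
open MvPolynomial

/-- The columns beyond the first `r`. -/
abbrev Cols (r s : ℕ) : Type := {j : Fin s // r ≤ j}

section Chart

variable (k : Type) [Field k] (r s : ℕ)

/-- The coordinate ring of the affine chart of matrices with an identity block. -/
abbrev chartRing : Type := MvPolynomial (Fin r × Cols r s) k

/-- The matrix of coordinates on the chart. -/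
noncomputable abbrev chartMatrix : Matrix (Fin r) (Fin s) (chartRing k r s) :=
  stdMat fun i j => X (i, j)

/-- Restriction of polynomials to the chart. -/
noncomputable def toChart : detPolyRing k r s →ₐ[k] chartRing k r s :=
  aeval fun p => chartMatrix k r s p.1 p.2

variable {k r s}

lemma toChart_minorSum (t : ℕ) :
    toChart k r s (minorSum (genericMatrix k r s) t) = minorSum (chartMatrix k r s) t := by
  have h := map_minorSum (toChart k r s).toRingHom (genericMatrix k r s) t
  change toChart k r s _ = _ at h
  rw [h]
  congr 1
  ext1 i j
  exact aeval_X _ _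

lemma stdMat_eq_of_submatrix {T : Type*} [CommRing T] (hrs : r ≤ s)
    {N : Matrix (Fin r) (Fin s) T} (hN : N.submatrix id (Fin.castLE hrs) = 1) :
    stdMat (fun i j => N i j) = N := by
  ext1 i j
  unfold stdMat
  split_ifs with h1 h2
  · rfl
  · have := congrFun (congrFun hN i) i
    rw [Matrix.one_apply_eq] at this
    rw [← this, Matrix.submatrix_apply]
    congr 1
    exact Fin.ext h2
  · have := congrFun (congrFun hN i) ⟨j, by omega⟩
    rw [Matrix.one_apply_ne (by simpa [Fin.ext_iff] using h2)] at this
    rw [← this, Matrix.submatrix_apply]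
    rfl

variable (K : Type) [Field K] [Algebra (detPolyRing k r s) K]

variable (k r s) in
/-- The generic matrix over the field of fractions. -/
noncomputable abbrev matK : Matrix (Fin r) (Fin s) K :=
  (genericMatrix k r s).map (algebraMap (detPolyRing k r s) K)

variable (k) in
/-- The first square block of the generic matrix. -/
noncomputable abbrev blockK (hrs : r ≤ s) : Matrix (Fin r) (Fin r) K :=
  (matK k r s K).submatrix id (Fin.castLE hrs)

variable (k) in
/-- The generic matrix normalised by its first square block. -/
noncomputable abbrev normK (hrs : r ≤ s) : Matrix (Fin r) (Fin s) K :=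
  (blockK k K hrs)⁻¹ * matK k r s K

variable [Algebra k K]

variable (k) in
/-- The inclusion of functions on the chart as row-invariant rational functions. -/
noncomputable def ofChart (hrs : r ≤ s) : chartRing k r s →ₐ[k] K :=
  aeval fun q => normK k K hrs q.1 q.2

variable [IsFractionRing (detPolyRing k r s) K] (hrs : r ≤ s)

variable {K}

omit [Algebra k K] [IsFractionRing (detPolyRing k r s) K] in
lemma det_blockK :
    (blockK k K hrs).det = algebraMap _ K (minorSum (genericMatrix k r s) 0) := by
  rw [minorSum_zero hrs, RingHom.map_det]
  rfl

omit [Algebra k K] in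
lemma det_blockK_ne_zero : (blockK k K hrs).det ≠ 0 := by
  rw [det_blockK hrs]
  intro h
  exact minorSum_genericMatrix_ne_zero k hrs 0 (Nat.zero_le _)
    ((IsFractionRing.to_map_eq_zero_iff).1 h)

omit [Algebra k K] in
lemma normK_submatrix : (normK k K hrs).submatrix id (Fin.castLE hrs) = 1 := by
  have h : (blockK k K hrs)⁻¹ * blockK k K hrs = 1 :=
    Matrix.nonsing_inv_mul _ (Ne.isUnit (det_blockK_ne_zero hrs))
  rw [← h]
  rfl

omit [Algebra k K] in
lemma blockK_mul_normK : blockK k K hrs * normK k K hrs = matK k r s K :=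
  Matrix.mul_nonsing_inv_cancel_left _ _ (Ne.isUnit (det_blockK_ne_zero hrs))

lemma ofChart_toChart (f : detPolyRing k r s) :
    ofChart k K hrs (toChart k r s f) = evalMat (normK k K hrs) f := by
  have h : (ofChart k K hrs).comp (toChart k r s) = evalMat (normK k K hrs) := by
    apply algHom_ext
    rintro ⟨a, b⟩
    rw [AlgHom.comp_apply, toChart, aeval_X, aeval_X]
    have h1 := stdMat_eq_of_submatrix hrs (normK_submatrix (k := k) (K := K) hrs)
    have h2 := stdMat_map (ofChart k K hrs).toRingHom
      (fun (i : Fin r) (j : Cols r s) => (X (i, j) : chartRing k r s))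
    have h3 : (ofChart k K hrs) (chartMatrix k r s a b) =
        stdMat (fun i (j : Cols r s) => ofChart k K hrs (X (i, j))) a b :=
      congrFun (congrFun h2 a) b
    rw [h3]
    conv_rhs => rw [← h1]
    congr 1
    ext i j
    exact aeval_X _ _
  exact congrArg (fun e => e f) h

variable [IsScalarTower k (detPolyRing k r s) K]

omit [IsFractionRing (detPolyRing k r s) K] in
lemma evalMat_matK (f : detPolyRing k r s) :
    evalMat (matK k r s K) f = algebraMap (detPolyRing k r s) K f := by
  have h : evalMat (matK k r s K) = IsScalarTower.toAlgHom k (detPolyRing k r s) K := by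
    apply algHom_ext
    rintro ⟨a, b⟩
    rw [aeval_X]
    rfl
  exact congrArg (fun e => e f) h

omit [IsScalarTower k (detPolyRing k r s) K] in
lemma algebraMap_minorSum (t : ℕ) :
    algebraMap (detPolyRing k r s) K (minorSum (genericMatrix k r s) t) =
      algebraMap _ K (minorSum (genericMatrix k r s) 0) *
        ofChart k K hrs (minorSum (chartMatrix k r s) t) := by
  have h1 := map_minorSum (algebraMap (detPolyRing k r s) K) (genericMatrix k r s) t
  rw [h1]
  change minorSum (matK k r s K) t = _
  rw [← blockK_mul_normK hrs, minorSum_mul, det_blockK hrs]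
  congr 1
  have h2 := map_minorSum (ofChart k K hrs).toRingHom (chartMatrix k r s) t
  refine Eq.trans ?_ h2.symm
  congr 1
  rw [stdMat_map]
  conv_lhs => rw [← stdMat_eq_of_submatrix hrs (normK_submatrix (k := k) (K := K) hrs)]
  congr 1
  ext i j
  exact (aeval_X (fun q : Fin r × Cols r s => normK k K hrs q.1 q.2) (i, j)).symm

lemma algebraMap_eq_of_isInv [CharZero k] (hr : 0 < r) {b : detPolyRing k r s} {w : ℕ}
    (hb : IsInv b) (hw : b.IsHomogeneous (r * w)) :
    algebraMap (detPolyRing k r s) K b =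
      algebraMap _ K (minorSum (genericMatrix k r s) 0) ^ w *
        ofChart k K hrs (toChart k r s b) := by
  have : Nonempty (Fin r) := ⟨⟨0, hr⟩⟩
  rw [ofChart_toChart (K := K) hrs b, ← evalMat_matK (K := K) b, ← blockK_mul_normK hrs,
    hb.evalMat_mul (w := w)
    (by rwa [Fintype.card_fin]), det_blockK hrs]

/-- Clearing denominators on the chart. -/
lemma exists_ofChart_mul_pow_eq (h : chartRing k r s) :
    ∃ (n : ℕ) (a : detPolyRing k r s),
      algebraMap _ K (minorSum (genericMatrix k r s) 0) ^ n * ofChart k K hrs h =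
        algebraMap _ K a ∧ toChart k r s a = h := by
  have h0 : toChart k r s (minorSum (genericMatrix k r s) 0) = 1 := by
    rw [toChart_minorSum, minorSum_stdMat_zero hrs]
  induction h using MvPolynomial.induction_on with
  | C c =>
    refine ⟨0, C c, ?_, ?_⟩
    · rw [pow_zero, one_mul]
      exact ((ofChart k K hrs).commutes c).trans (IsScalarTower.algebraMap_apply k _ K c)
    · exact (toChart k r s).commutes c
  | add p q hp hq =>
    obtain ⟨n, a, h1, h2⟩ := hp
    obtain ⟨m, b, h3, h4⟩ := hq
    refine ⟨n + m, minorSum (genericMatrix k r s) 0 ^ m * a +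
      minorSum (genericMatrix k r s) 0 ^ n * b, ?_, ?_⟩
    · rw [map_add, map_add, map_mul, map_mul, ← h1, ← h3, map_pow, map_pow]
      ring
    · rw [map_add, map_mul, map_mul, map_pow, map_pow, h0, h2, h4, one_pow, one_pow, one_mul,
        one_mul]
  | mul_X p q hp =>
    obtain ⟨n, a, h1, h2⟩ := hp
    let b : detPolyRing k r s := (((genericMatrix k r s).submatrix id
      (Fin.castLE hrs)).adjugate * genericMatrix k r s) q.1 q.2
    refine ⟨n + 1, a * b, ?_, ?_⟩
    · have h5 : algebraMap _ K b = algebraMap _ K (minorSum (genericMatrix k r s) 0) *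
          ofChart k K hrs (X q) := by
        have h6 : algebraMap _ K b = ((blockK k K hrs).adjugate * matK k r s K) q.1 q.2 := by
          change ((((genericMatrix k r s).submatrix id
            (Fin.castLE hrs)).adjugate * genericMatrix k r s).map (algebraMap _ K)) q.1 q.2 = _
          rw [Matrix.map_mul]
          exact congrArg (fun A => (A * matK k r s K) q.1 q.2) (RingHom.map_adjugate
            (algebraMap (detPolyRing k r s) K)
            ((genericMatrix k r s).submatrix id (Fin.castLE hrs)))
        rw [h6, ofChart, aeval_X, ← det_blockK hrs, normK, Matrix.inv_def, Matrix.smul_mul,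
          Matrix.smul_apply, Ring.inverse_eq_inv', smul_eq_mul,
          mul_inv_cancel_left₀ (det_blockK_ne_zero hrs)]
      rw [map_mul, map_mul, ← h1, h5]
      ring
    · rw [map_mul, h2]
      congr 1
      have h6 : toChart k r s b = ((((genericMatrix k r s).submatrix id
            (Fin.castLE hrs)).adjugate * genericMatrix k r s).map (toChart k r s)) q.1 q.2 := rfl
      have h7 : (genericMatrix k r s).map (toChart k r s) = chartMatrix k r s := by
        ext1 i j
        exact aeval_X _ _
      have h8 : (((genericMatrix k r s).submatrix id
            (Fin.castLE hrs)).adjugate).map (toChart k r s) = 1 := by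
        have h9 := RingHom.map_adjugate (toChart k r s).toRingHom
          ((genericMatrix k r s).submatrix id (Fin.castLE hrs))
        refine Eq.trans h9 ?_
        have h10 : (toChart k r s).toRingHom.mapMatrix
            ((genericMatrix k r s).submatrix id (Fin.castLE hrs)) = 1 := by
          rw [← stdMat_submatrix hrs (fun i (j : Cols r s) => (X (i, j) : chartRing k r s))]
          change ((genericMatrix k r s).map (toChart k r s)).submatrix id _ = _
          rw [h7]
        rw [h10, Matrix.adjugate_one]
      rw [h6]
      have h11 := Matrix.map_mul (L := ((genericMatrix k r s).submatrix id
            (Fin.castLE hrs)).adjugate) (M := genericMatrix k r s) (f := (toChart k r s).toRingHom)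
      refine (congrFun (congrFun h11 q.1) q.2).trans ?_
      change ((((genericMatrix k r s).submatrix id
            (Fin.castLE hrs)).adjugate).map (toChart k r s) *
              (genericMatrix k r s).map (toChart k r s)) q.1 q.2 = _
      rw [h8, h7, Matrix.one_mul]
      exact dif_pos q.2.2

lemma ofChart_injective : Function.Injective (ofChart k K hrs) := by
  rw [injective_iff_map_eq_zero]
  intro h hh
  obtain ⟨n, a, h1, h2⟩ := exists_ofChart_mul_pow_eq (K := K) hrs h
  rw [hh, mul_zero] at h1
  have h3 : a = 0 := (IsFractionRing.to_map_eq_zero_iff (K := K)).1 h1.symm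
  rw [← h2, h3, map_zero]

end Chart

end LocCohTop

namespace LocCohTop
open MvPolynomial

section ChartDerivation

variable {k : Type} [Field k] {r s : ℕ} {K : Type} [Field K] [Algebra (detPolyRing k r s) K]

lemma extDer_matK (E : ExtDer k (Fin r × Fin s) K) (i : Fin r) (j : Fin s) (a : Fin r) (b : Fin s) :
    E.D (i, j) (matK k r s K a b) = if i = a ∧ b = j then 1 else 0 := by
  change E.D (i, j) (algebraMap _ K (X (a, b))) = _
  rw [E.map, pderiv_X, Pi.single_apply]
  split_ifs with h1 h2 h2
  · exact map_one _
  · exact absurd ⟨(congrArg Prod.fst h1).symm, congrArg Prod.snd h1⟩ h2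
  · exact absurd (Prod.ext h2.1.symm h2.2) h1
  · exact map_zero _

/-- The polarisation of a column in the chart by a column of the first block. -/
noncomputable def chartDer (hrs : r ≤ s) (E : ExtDer k (Fin r × Fin s) K) (q : Fin r × Cols r s) :
    Derivation ℤ K K :=
  ∑ l, matK k r s K l (Fin.castLE hrs q.1) • E.D (l, q.2)

variable (hrs : r ≤ s) (E : ExtDer k (Fin r × Fin s) K)

lemma chartDer_apply (q : Fin r × Cols r s) (c : K) :
    chartDer hrs E q c = ∑ l, matK k r s K l (Fin.castLE hrs q.1) * E.D (l, q.2) c := by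
  have h := congrArg (fun d : K → K => d c)
      (map_sum (Derivation.coeFnAddMonoidHom (R := ℤ) (A := K) (M := K))
    (fun l => matK k r s K l (Fin.castLE hrs q.1) • E.D (l, q.2)) Finset.univ)
  refine h.trans ?_
  rw [Finset.sum_apply]
  rfl

lemma chartDer_apply' (q : Fin r × Cols r s) (c : K) :
    chartDer hrs E q c = ∑ l, E.D (l, q.2) (matK k r s K l (Fin.castLE hrs q.1) * c) := by
  rw [chartDer_apply]
  refine Finset.sum_congr rfl fun l _ => ?_
  have h : E.D (l, q.2) (matK k r s K l (Fin.castLE hrs q.1)) = 0 := by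
    rw [extDer_matK, if_neg]
    rintro ⟨-, hh⟩
    have h1 := congrArg Fin.val hh
    have h2 := q.1.2
    have h3 := q.2.2
    simp only [Fin.val_castLE] at h1
    omega
  rw [Derivation.leibniz, h, smul_zero, add_zero, smul_eq_mul]

lemma chartDer_matK (q : Fin r × Cols r s) (a : Fin r) (b : Fin s) :
    chartDer hrs E q (matK k r s K a b) =
      if b = q.2 then matK k r s K a (Fin.castLE hrs q.1) else 0 := by
  rw [chartDer_apply]
  have h (l : Fin r) := extDer_matK E l q.2 a b
  simp only [h]
  split_ifs with h1
  · simp [h1]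
  · simp [h1]

lemma chartDer_matK_castLE (q : Fin r × Cols r s) (a i : Fin r) :
    chartDer hrs E q (matK k r s K a (Fin.castLE hrs i)) = 0 := by
  rw [chartDer_matK, if_neg]
  intro h
  have h1 := congrArg Fin.val h
  have := q.2.2
  have := i.2
  simp only [Fin.val_castLE] at h1
  omega

lemma chartDer_C (q : Fin r × Cols r s) (c : k) :
    chartDer hrs E q (algebraMap (detPolyRing k r s) K (C c)) = 0 := by
  rw [chartDer_apply]
  refine Finset.sum_eq_zero fun l _ => ?_
  rw [E.map, pderiv_C, map_zero, mul_zero]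

lemma chartDer_det (q : Fin r × Cols r s) :
    chartDer hrs E q (blockK k K hrs).det = 0 := by
  let γ : MvPolynomial (Fin r × Fin r) ℤ →+* K :=
    (aeval fun p => matK k r s K p.1 (Fin.castLE hrs p.2) : _ →ₐ[ℤ] K).toRingHom
  have hγ (p) : γ (X p) = matK k r s K p.1 (Fin.castLE hrs p.2) :=
    aeval_X (fun p : Fin r × Fin r => matK k r s K p.1 (Fin.castLE hrs p.2)) p
  have h1 (f) : chartDer hrs E q (γ f) = 0 := by
    induction f using MvPolynomial.induction_on with
    | C a =>
      rw [show γ (C a) = (a : K) from map_intCast (γ.comp C) a]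
      exact (chartDer hrs E q).map_algebraMap a
    | add p p' hp hp' => rw [map_add, map_add, hp, hp', add_zero]
    | mul_X p i hp =>
      rw [map_mul, Derivation.leibniz, hp, hγ, chartDer_matK_castLE, smul_zero, smul_zero, add_zero]
  have h2 : (blockK k K hrs).det = γ (Matrix.of fun i j => (X (i, j))).det := by
    rw [RingHom.map_det]
    congr 1
    ext i j
    exact (hγ (i, j)).symm
  rw [h2, h1]

variable [IsFractionRing (detPolyRing k r s) K]

lemma chartDer_normK (q : Fin r × Cols r s) (a : Fin r) (b : Fin s) :
    chartDer hrs E q (normK k K hrs a b) = if a = q.1 ∧ b = q.2 then 1 else 0 := by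
  have h1 : Matrix.mulVec (blockK k K hrs) (fun c => chartDer hrs E q (normK k K hrs c b)) =
      Matrix.mulVec (blockK k K hrs) (fun c => if c = q.1 ∧ b = q.2 then 1 else 0) := by
    ext a
    have h2 := congrFun (congrFun (blockK_mul_normK (k := k) (K := K) hrs) a) b
    rw [Matrix.mul_apply] at h2
    have h3 := congrArg (chartDer hrs E q) h2
    rw [map_sum, chartDer_matK] at h3
    simp only [Derivation.leibniz, Matrix.submatrix_apply, id_eq, chartDer_matK_castLE,
      smul_eq_mul, mul_zero, add_zero] at h3
    refine Eq.trans h3 ?_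
    rw [Matrix.mulVec, dotProduct]
    split_ifs with h4
    · simp [h4]
    · simp [h4]
  have h2 := congrArg (Matrix.mulVec (blockK k K hrs)⁻¹) h1
  rw [Matrix.mulVec_mulVec, Matrix.mulVec_mulVec,
    Matrix.nonsing_inv_mul _ (Ne.isUnit (det_blockK_ne_zero hrs)), Matrix.one_mulVec,
    Matrix.one_mulVec] at h2
  exact congrFun h2 a

variable [Algebra k K] [IsScalarTower k (detPolyRing k r s) K]

lemma chartDer_ofChart (q : Fin r × Cols r s) (f : chartRing k r s) :
    chartDer hrs E q (ofChart k K hrs f) = ofChart k K hrs (pderiv q f) := by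
  refine derivation_intertwine (ofChart k K hrs).toRingHom (chartDer hrs E q) (pderiv q)
    (fun c => ?_) (fun p => ?_) f
  · have h : (ofChart k K hrs).toRingHom (C c) = algebraMap (detPolyRing k r s) K (C c) :=
      ((ofChart k K hrs).commutes c).trans (IsScalarTower.algebraMap_apply k _ K c)
    rw [h, chartDer_C]
  · have h1 : (ofChart k K hrs).toRingHom (X p) = normK k K hrs p.1 p.2 :=
      aeval_X (fun q : Fin r × Cols r s => normK k K hrs q.1 q.2) p
    rw [h1, chartDer_normK, pderiv_X, Pi.single_apply]
    have h2 : (p.1 = q.1 ∧ (p.2 : Fin s) = q.2) ↔ p = q := by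
      rw [Prod.ext_iff, Subtype.ext_iff]
    simp only [h2]
    split_ifs
    · exact (map_one _).symm
    · exact (map_zero _).symm

omit [Algebra k K] [IsScalarTower k (detPolyRing k r s) K] in
lemma chartDer_comm (q q' : Fin r × Cols r s) (c : K) :
    chartDer hrs E q (chartDer hrs E q' c) = chartDer hrs E q' (chartDer hrs E q c) := by
  have h : ⁅chartDer hrs E q, chartDer hrs E q'⁆ = 0 := by
    refine derivation_eq_of_algebraMap (R := detPolyRing k r s) fun f => ?_
    refine (derivation_intertwine (algebraMap (detPolyRing k r s) K)
      ⁅chartDer hrs E q, chartDer hrs E q'⁆ 0 (fun c => ?_) (fun p => ?_) f).trans ?_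
    · rw [Derivation.commutator_apply, chartDer_C, chartDer_C, map_zero, map_zero, sub_zero]
    · have h1 (q q' : Fin r × Cols r s) :
          chartDer hrs E q (chartDer hrs E q' (matK k r s K p.1 p.2)) = 0 := by
        rw [chartDer_matK]
        split_ifs
        · exact chartDer_matK_castLE hrs E q _ _
        · exact map_zero _
      have h2 : algebraMap (detPolyRing k r s) K (X p) = matK k r s K p.1 p.2 := rfl
      rw [Derivation.commutator_apply, h2, h1, h1, sub_zero, Derivation.zero_apply, map_zero]
    · rw [Derivation.zero_apply, map_zero, Derivation.zero_apply]
  have := DFunLike.congr_fun h c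
  rwa [Derivation.commutator_apply, Derivation.zero_apply, sub_eq_zero] at this

/-- The polarisations as derivations extending the partial derivatives of the chart. -/
noncomputable def chartExtDer [Algebra (chartRing k r s) K]
    (hY : ∀ f, algebraMap (chartRing k r s) K f = ofChart k K hrs f) :
    ExtDer k (Fin r × Cols r s) K where
  D := chartDer hrs E
  map q f := by rw [hY, hY, chartDer_ofChart]
  comm := chartDer_comm hrs E

end ChartDerivation

end LocCohTop

namespace LocCohTop
open MvPolynomial

section ImK

variable {k : Type} [Field k] {σ : Type} {K : Type} [AddCommGroup K]
  [Module (MvPolynomial σ k) K] {W : WeylAction k σ K} {A₀ : Submodule (MvPolynomial σ k) K}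
  {L : List (MvPolynomial σ k)}

lemma mem_topA_of_mem_imK (hA₀ : ∀ i, ∀ c ∈ A₀, W.D i c ∈ A₀) {c : K} (hc : c ∈ imK W A₀ L) :
    c ∈ topA A₀ L := by
  have : imK W A₀ L ≤ (topA A₀ L).restrictScalars ℤ := by
    refine sup_le (fun x hx => topB_le_topA _ _ hx) (iSup_le fun i => ?_)
    rintro _ ⟨x, hx, rfl⟩
    exact topA_stable (W.leibniz i) (hA₀ i) hx
  exact this hc

lemma C_smul_mem_imK (hA₀ : ∀ i, ∀ c ∈ A₀, W.D i c ∈ A₀) (a : k) {c : K}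
    (hc : c ∈ imK W A₀ L) : (C a : MvPolynomial σ k) • c ∈ imK W A₀ L := by
  have h := mem_topA_of_mem_imK hA₀ hc
  replace hc := (mk_mem_imD_iff W A₀ hA₀ L h).2 hc
  refine (mk_mem_imD_iff W A₀ hA₀ L ((topA A₀ L).smul_mem _ h)).1 ?_
  rw [TopQ.mk_smul _ h]
  exact WeylAction.C_smul_mem_imD _ a hc

end ImK

section Numerators

variable {k : Type} [Field k] {ι κ : Type} [Fintype ι] [Fintype κ] {K : Type} [Field K]
  [Algebra (MvPolynomial (ι × κ) k) K] (E : ExtDer k (ι × κ) K)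
  (L : List (MvPolynomial (ι × κ) k))


/-- Fractions whose denominator is a power of the product of a list. -/
noncomputable def fracL (K : Type) [Field K] [Algebra (MvPolynomial (ι × κ) k) K]
    (L : List (MvPolynomial (ι × κ) k)) (n : ℕ) (f : MvPolynomial (ι × κ) k) : K :=
  (algebraMap (MvPolynomial (ι × κ) k) K (L.prod ^ n))⁻¹ * algebraMap (MvPolynomial (ι × κ) k) K f

variable {L} (hp : algebraMap (MvPolynomial (ι × κ) k) K L.prod ≠ 0) (n : ℕ)

include hp

omit [Fintype ι] [Fintype κ] in
lemma mul_fracL (f : MvPolynomial (ι × κ) k) :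
    algebraMap (MvPolynomial (ι × κ) k) K (L.prod ^ n) * fracL K L n f =
      algebraMap (MvPolynomial (ι × κ) k) K f :=
  mul_inv_cancel_left₀ (by rw [map_pow]; exact pow_ne_zero _ hp) _

omit [Fintype ι] [Fintype κ] in
lemma fracL_mem_topA (f : MvPolynomial (ι × κ) k) :
    fracL K L n f ∈ topA (LinearMap.range (Algebra.linearMap (MvPolynomial (ι × κ) k) K)) L := by
  refine mem_topA_of_prod_pow_smul_mem n ?_
  rw [Algebra.smul_def, mul_fracL hp]
  exact ⟨f, rfl⟩

omit [Fintype ι] in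
lemma fracL_polar_mem_imK (hL : ∀ f ∈ L, IsInv f) {i j : ι} (hij : i ≠ j)
    (f : MvPolynomial (ι × κ) k) :
    fracL K L n (polar k i j f) ∈
      imK E.action (LinearMap.range (Algebra.linearMap (MvPolynomial (ι × κ) k) K)) L := by
  set c := fracL K L n f with hc
  have hP : polar k i j (L.prod ^ n) = 0 := by
    have h1 : ∀ l : List (MvPolynomial (ι × κ) k), (∀ f ∈ l, IsInv f) → polar k i j l.prod = 0 := by
      intro l hl
      induction l with
      | nil => exact (polar k i j).map_one_eq_zero
      | cons f l ih =>
        rw [List.prod_cons, Derivation.leibniz, ih fun g hg => hl g (List.mem_cons_of_mem _ hg),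
          hl f List.mem_cons_self i j hij, smul_zero, smul_zero, add_zero]
    rw [Derivation.leibniz_pow, h1 L hL, smul_zero, smul_zero]
  have h2 : ∑ l, algebraMap (MvPolynomial (ι × κ) k) K (X (i, l)) * E.D (j, l) c =
      fracL K L n (polar k i j f) := by
    have h3 : algebraMap (MvPolynomial (ι × κ) k) K (L.prod ^ n) *
        ∑ l, algebraMap (MvPolynomial (ι × κ) k) K (X (i, l)) * E.D (j, l) c +
        c * algebraMap (MvPolynomial (ι × κ) k) K (polar k i j (L.prod ^ n)) =
          algebraMap (MvPolynomial (ι × κ) k) K (polar k i j f) := by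
      rw [polar_apply, polar_apply, map_sum, map_sum, Finset.mul_sum, Finset.mul_sum,
        ← Finset.sum_add_distrib]
      refine Finset.sum_congr rfl fun l _ => ?_
      rw [map_mul, map_mul, ← E.map, ← E.map, ← mul_fracL hp n f, ← hc, Derivation.leibniz,
        smul_eq_mul, smul_eq_mul]
      ring
    rw [hP, map_zero, mul_zero, add_zero] at h3
    rw [fracL, ← h3, inv_mul_cancel_left₀ (by rw [map_pow]; exact pow_ne_zero _ hp)]
  rw [← h2]
  refine sum_mem fun l _ => ?_
  have h4 : algebraMap (MvPolynomial (ι × κ) k) K (X (i, l)) * E.D (j, l) c =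
      E.action.D (j, l) ((X (i, l) : (MvPolynomial (ι × κ) k)) • c) := by
    classical
    rw [ExtDer.action_D, Algebra.smul_def, Derivation.leibniz, E.map, pderiv_X_of_ne, map_zero,
      smul_zero, add_zero, smul_eq_mul]
    intro h
    exact hij (congrArg Prod.fst h)
  rw [h4]
  exact D_mem_imK _ _ ((topA _ _).smul_mem _ (fracL_mem_topA hp n f))

lemma fracL_mem_imK_of_isHomogeneous [CharZero k] {f : (MvPolynomial (ι × κ) k)} {m M : ℕ}
    (hf : f.IsHomogeneous m)
    (hP : (L.prod ^ n).IsHomogeneous M) (hM : Fintype.card (ι × κ) + m ≠ M) :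
    fracL K L n f ∈ imK E.action (LinearMap.range (Algebra.linearMap (MvPolynomial (ι × κ) k) K))
      L := by
  set c := fracL K L n f with hc
  have h1 : ∑ p, algebraMap (MvPolynomial (ι × κ) k) K (X p) * E.D p c = ((m : K) - M) * c := by
    have h3 : algebraMap (MvPolynomial (ι × κ) k) K (L.prod ^ n) *
        ∑ p, algebraMap (MvPolynomial (ι × κ) k) K (X p) * E.D p c +
        c * algebraMap (MvPolynomial (ι × κ) k) K (M • (L.prod ^ n)) =
          algebraMap (MvPolynomial (ι × κ) k) K (m • f) := by
      rw [← hf.sum_X_mul_pderiv, ← hP.sum_X_mul_pderiv, map_sum, map_sum, Finset.mul_sum,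
        Finset.mul_sum, ← Finset.sum_add_distrib]
      refine Finset.sum_congr rfl fun l _ => ?_
      rw [map_mul, map_mul, ← E.map, ← E.map, ← mul_fracL hp n f, ← hc, Derivation.leibniz,
        smul_eq_mul, smul_eq_mul]
      ring
    rw [nsmul_eq_mul, nsmul_eq_mul, map_mul, map_mul, map_natCast, map_natCast,
      ← mul_fracL hp n f, ← hc] at h3
    have h5 : algebraMap (MvPolynomial (ι × κ) k) K (L.prod ^ n) ≠ 0 := by
      rw [map_pow]; exact pow_ne_zero _ hp
    apply mul_left_cancel₀ h5
    linear_combination h3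
  have h2 : ∑ p, E.action.D p ((X p : (MvPolynomial (ι × κ) k)) • c) =
      ((Fintype.card (ι × κ) : K) + m - M) * c := by
    have h3 (p : ι × κ) :
        E.action.D p ((X p : (MvPolynomial (ι × κ) k)) • c) =
          c + algebraMap (MvPolynomial (ι × κ) k) K (X p) * E.D p c := by
      classical
      rw [ExtDer.action_D, Algebra.smul_def, Derivation.leibniz, E.map, pderiv_X_self, map_one,
        smul_eq_mul, smul_eq_mul, mul_one, add_comm]
    simp only [h3]
    rw [Finset.sum_add_distrib, h1, Finset.sum_const, Finset.card_univ, nsmul_eq_mul]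
    ring
  have h4 : ((Fintype.card (ι × κ) : k) + m - M) ≠ 0 := by
    rw [sub_ne_zero]
    exact_mod_cast hM
  have h5 : c = (C ((Fintype.card (ι × κ) : k) + m - M)⁻¹ : (MvPolynomial (ι × κ) k)) •
      ∑ p, E.action.D p ((X p : (MvPolynomial (ι × κ) k)) • c) := by
    have h6 : ((Fintype.card (ι × κ) : K) + m - M) =
        algebraMap (MvPolynomial (ι × κ) k) K (C ((Fintype.card (ι × κ) : k) + m - M)) := by
      simp only [map_add, map_sub, map_natCast]
    rw [h2, h6, Algebra.smul_def, ← mul_assoc, ← map_mul, ← C_mul, inv_mul_cancel₀ h4, C_1,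
      map_one, one_mul]
  rw [h5]
  refine C_smul_mem_imK E.stable _ (sum_mem fun p _ => D_mem_imK _ _ ((topA _ _).smul_mem _
    (fracL_mem_topA hp n f)))

end Numerators

end LocCohTop

namespace LocCohTop
open MvPolynomial

section Transfer

variable {R Y K : Type} [CommRing R] [CommRing Y] [Field K] [Algebra R K] [Algebra Y K] {Δ : R}

lemma sat_transfer {f : R} {f' : Y} (hf : algebraMap R K f = algebraMap R K Δ * algebraMap Y K f')
    {A : Submodule R K} {A' : Submodule Y K} (h : ∀ e ∈ A', e ∈ sat Δ A) {e : K}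
    (he : e ∈ sat f' A') : e ∈ sat Δ (sat f A) := by
  obtain ⟨m, hm⟩ := he
  obtain ⟨n, hn⟩ := h _ hm
  refine ⟨n, m, ?_⟩
  have h1 : f ^ m • Δ ^ n • e = Δ ^ m • (Δ ^ n • (f' ^ m • e)) := by
    simp only [Algebra.smul_def, map_pow, hf]
    ring
  rw [h1]
  exact A.smul_mem _ hn

lemma inv_pow_mul_mem_sat (hΔ : algebraMap R K Δ ≠ 0) {A : Submodule R K} {e : K}
    (he : e ∈ sat Δ A) (j : ℕ) : (algebraMap R K Δ ^ j)⁻¹ * e ∈ sat Δ A := by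
  obtain ⟨n, hn⟩ := he
  refine ⟨n + j, ?_⟩
  have h : Δ ^ (n + j) • ((algebraMap R K Δ ^ j)⁻¹ * e) = Δ ^ n • e := by
    simp only [Algebra.smul_def, map_pow]
    rw [pow_add, mul_assoc, mul_inv_cancel_left₀ (pow_ne_zero _ hΔ)]
  rwa [h]

variable {A₀ : Submodule R K} {A₀' : Submodule Y K} (h₀ : ∀ e ∈ A₀', e ∈ sat Δ A₀)
  {L : List R} {L' : List Y}
  (hL : List.Forall₂ (fun f f' => algebraMap R K f = algebraMap R K Δ * algebraMap Y K f') L L')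

include h₀ hL

lemma topA_transfer : ∀ e ∈ topA A₀' L', e ∈ sat Δ (topA A₀ L) := by
  induction hL with
  | nil => exact h₀
  | cons hf _ ih => exact fun e he => sat_transfer hf ih he

lemma topB_transfer : ∀ e ∈ topB A₀' L', e ∈ sat Δ (topB A₀ L) := by
  induction hL with
  | nil =>
    intro e he
    rw [(Submodule.mem_bot Y).1 he]
    exact zero_mem _
  | cons hf hL ih =>
    intro e he
    obtain ⟨a, ha, b, hb, rfl⟩ := Submodule.mem_sup.1 he
    exact add_mem (sat_mono _ le_sup_left (sat_transfer hf ih ha))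
      (sat_mono _ le_sup_right (topA_transfer h₀ hL b hb))

end Transfer

section Coinvariants

variable {k : Type} [Field k] [CharZero k] {r s : ℕ} {K : Type} [Field K]
  [Algebra (detPolyRing k r s) K]
  [IsFractionRing (detPolyRing k r s) K] [Algebra k K] [IsScalarTower k (detPolyRing k r s) K]

omit [CharZero k] in
lemma sub_C_mem_span_range_X {σ : Type} (f : MvPolynomial σ k) :
    f - C ((aeval (fun _ => 0) : MvPolynomial σ k →ₐ[k] k) f) ∈
      Ideal.span (Set.range (X : σ → MvPolynomial σ k)) := by
  induction f using MvPolynomial.induction_on with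
  | C a => simp
  | add p q hp hq =>
    rw [map_add, C_add, add_sub_add_comm]
    exact add_mem hp hq
  | mul_X p i _ =>
    rw [map_mul, aeval_X, mul_zero, C_0, sub_zero]
    exact Ideal.mul_mem_left _ _ (Ideal.subset_span ⟨i, rfl⟩)

lemma card_cols (hrs : r ≤ s) : Fintype.card (Cols r s) = s - r := by
  rw [Fintype.card_subtype]
  have h := Finset.card_add_card_compl (Finset.univ.filter fun j : Fin s => r ≤ (j : ℕ))
  have h1 : (Finset.univ.filter fun j : Fin s => r ≤ (j : ℕ))ᶜ =
      Finset.univ.map (Fin.castLEEmb hrs) := by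
    ext j
    simp only [Finset.mem_compl, Finset.mem_filter, Finset.mem_univ, true_and, not_le,
      Finset.mem_map, Fin.castLEEmb_apply]
    exact ⟨fun h => ⟨⟨j, h⟩, rfl⟩, by rintro ⟨i, rfl⟩; exact i.2⟩
  rw [h1, Finset.card_map, Finset.card_univ, Fintype.card_fin, Fintype.card_fin] at h
  omega

omit [CharZero k] in
/-- The radical of the tail of the minor sums on the chart. -/
lemma radical_tailSums_chartMatrix (hrs : r ≤ s) :
    (Ideal.span {f | f ∈ tailSums (chartMatrix k r s)}).radical =
      (Ideal.span (Set.range (X : Fin r × Cols r s → chartRing k r s))).radical := by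
  apply le_antisymm
  · rw [Ideal.radical_le_radical_iff]
    refine le_trans ?_ Ideal.le_radical
    rw [Ideal.span_le]
    intro f hf
    obtain ⟨t, h1, h2, rfl⟩ := mem_tailSums.1 hf
    have h3 : (aeval (fun _ => 0 : Fin r × Cols r s → k) : chartRing k r s →ₐ[k] k)
        (minorSum (chartMatrix k r s) t) = 0 := by
      have h4 := map_minorSum (aeval (fun _ => 0) : chartRing k r s →ₐ[k] k).toRingHom
        (chartMatrix k r s) t
      refine Eq.trans h4 ?_
      rw [stdMat_map]
      have h5 : (fun (i : Fin r) (j : Cols r s) =>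
          (aeval (fun _ => 0) : chartRing k r s →ₐ[k] k).toRingHom (X (i, j))) = 0 := by
        funext i j
        exact aeval_X (fun _ => 0) (i, j)
      rw [h5]
      exact minorSum_stdMat_of_eq_zero h1
    have h4 := sub_C_mem_span_range_X (minorSum (chartMatrix k r s) t)
    rwa [h3, C_0, sub_zero] at h4
  · rw [Ideal.radical_le_radical_iff, Ideal.span_le]
    rintro _ ⟨⟨i, j⟩, rfl⟩
    have h := entry_mul_minorSum_mem_radical (chartMatrix k r s) i j j.2
    have h1 : chartMatrix k r s i j = X (i, j) := dif_pos j.2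
    rwa [minorSum_stdMat_zero hrs, mul_one, h1] at h

theorem exists_coinvariant_generator_minorSum (hr : 0 < r) (hrs : r < s)
    (E : ExtDer k (Fin r × Fin s) K) :
    ∃ w ∈ topA (LinearMap.range (Algebra.linearMap (detPolyRing k r s) K))
        (minorSum (genericMatrix k r s) 0 :: tailSums (genericMatrix k r s)),
      ∀ e ∈ topA (LinearMap.range (Algebra.linearMap (detPolyRing k r s) K))
        (minorSum (genericMatrix k r s) 0 :: tailSums (genericMatrix k r s)),
      ∃ c : k, e - (C c : detPolyRing k r s) • w ∈ imK E.action
        (LinearMap.range (Algebra.linearMap (detPolyRing k r s) K))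
        (minorSum (genericMatrix k r s) 0 :: tailSums (genericMatrix k r s)) := by
  let _ : Algebra (chartRing k r s) K := (ofChart k K hrs.le).toRingHom.toAlgebra
  have hY (f : chartRing k r s) : algebraMap (chartRing k r s) K f = ofChart k K hrs.le f := rfl
  have hinj : Function.Injective (algebraMap (chartRing k r s) K) := ofChart_injective hrs.le
  have : Nonempty (Fin r × Cols r s) := ⟨⟨⟨0, hr⟩, ⟨⟨r, hrs⟩, le_rfl⟩⟩⟩
  set Δ := minorSum (genericMatrix k r s) 0 with hΔ_def
  set A := LinearMap.range (Algebra.linearMap (detPolyRing k r s) K) with hA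
  set A' := LinearMap.range (Algebra.linearMap (chartRing k r s) K) with hA'
  set T := tailSums (genericMatrix k r s) with hT
  set T' := tailSums (chartMatrix k r s) with hT'
  have hΔ : algebraMap (detPolyRing k r s) K Δ ≠ 0 := by
    rw [hΔ_def, ← det_blockK hrs.le]
    exact det_blockK_ne_zero (k := k) (K := K) hrs.le
  have hne (t : ℕ) (ht : t ≤ r * (s - r)) : minorSum (chartMatrix k r s) t ≠ 0 := by
    intro h
    have h1 := algebraMap_minorSum (k := k) (K := K) hrs.le t
    rw [h, map_zero, mul_zero] at h1
    exact minorSum_genericMatrix_ne_zero k hrs.le t ht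
      ((IsFractionRing.to_map_eq_zero_iff (K := K)).1 h1)
  have hcard : Fintype.card (Fin r × Cols r s) = r * (s - r) := by
    rw [Fintype.card_prod, Fintype.card_fin, card_cols hrs.le]
  obtain ⟨w, hwA, hw⟩ := (exists_coinvariant_generator_iff _ _ _ _).1
    (exists_coinvariant_generator_of_radical_eq hinj (chartExtDer hrs.le E hY) T'
      (by
        intro f hf
        obtain ⟨t, h1, h2, rfl⟩ := mem_tailSums.1 hf
        exact hne t h2)
      (by rw [hT', length_tailSums, hcard])
      (radical_tailSums_chartMatrix hrs.le))
  have h₀ : ∀ e ∈ A', e ∈ sat Δ A := by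
    rintro _ ⟨h, rfl⟩
    obtain ⟨n, a, h1, -⟩ := exists_ofChart_mul_pow_eq (K := K) hrs.le h
    refine ⟨n, a, ?_⟩
    rw [Algebra.smul_def, map_pow]
    exact h1.symm
  have hTT' : List.Forall₂ (fun f f' => algebraMap (detPolyRing k r s) K f =
      algebraMap (detPolyRing k r s) K Δ * algebraMap (chartRing k r s) K f') T T' := by
    rw [hT, hT', tailSums, tailSums, List.forall₂_map_left_iff, List.forall₂_map_right_iff,
      List.forall₂_same]
    exact fun t _ => algebraMap_minorSum hrs.le (t + 1)
  let θ (e : K) : K := (algebraMap (detPolyRing k r s) K Δ ^ s)⁻¹ * e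
  have hθA (e) (he : e ∈ topA A' T') : θ e ∈ topA A (Δ :: T) :=
    inv_pow_mul_mem_sat hΔ (topA_transfer h₀ hTT' e he) s
  have hθB (e) (he : e ∈ topB A' T') : θ e ∈ topB A (Δ :: T) :=
    Submodule.mem_sup_left (inv_pow_mul_mem_sat hΔ (topB_transfer h₀ hTT' e he) s)
  have hθadd (e e') : θ (e + e') = θ e + θ e' := mul_add _ _ _
  have hC (c : k) (e : K) : (C c : chartRing k r s) • e = (C c : detPolyRing k r s) • e := by
    rw [Algebra.smul_def, Algebra.smul_def]
    congr 1
    exact ((ofChart k K hrs.le).commutes c).trans (IsScalarTower.algebraMap_apply k _ K c)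
  have hθim (e) (he : e ∈ imK (chartExtDer hrs.le E hY).action A' T') :
      θ e ∈ imK E.action A (Δ :: T) := by
    have hle : imK (chartExtDer hrs.le E hY).action A' T' ≤
        (imK E.action A (Δ :: T)).comap
          (AddMonoidHom.mulLeft (algebraMap (detPolyRing k r s) K Δ ^ s)⁻¹).toIntLinearMap := by
      refine sup_le (fun x hx => mem_imK_of_mem_topB (hθB x hx)) (iSup_le fun q => ?_)
      rintro _ ⟨x, hx, rfl⟩
      change (algebraMap (detPolyRing k r s) K Δ ^ s)⁻¹ * chartDer hrs.le E q x ∈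
        imK E.action A (Δ :: T)
      have h1 : (algebraMap (detPolyRing k r s) K Δ ^ s)⁻¹ * chartDer hrs.le E q x =
          chartDer hrs.le E q (θ x) := by
        have h2 : chartDer hrs.le E q (algebraMap (detPolyRing k r s) K Δ) = 0 := by
          rw [hΔ_def, ← det_blockK hrs.le, chartDer_det]
        have h3 : algebraMap (detPolyRing k r s) K Δ ^ s * θ x = x :=
          mul_inv_cancel_left₀ (pow_ne_zero _ hΔ) x
        have h4 := congrArg (chartDer hrs.le E q) h3
        rw [Derivation.leibniz, Derivation.leibniz_pow, h2, smul_zero, smul_zero, smul_zero,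
          add_zero, smul_eq_mul] at h4
        rw [← h4, inv_mul_cancel_left₀ (pow_ne_zero _ hΔ)]
      rw [h1, chartDer_apply']
      refine sum_mem fun l _ => ?_
      have h5 : matK k r s K l (Fin.castLE hrs.le q.1) * θ x =
          (X (l, Fin.castLE hrs.le q.1) : detPolyRing k r s) • θ x := by
        rw [Algebra.smul_def]
        rfl
      rw [h5]
      exact D_mem_imK E.action (l, (q.2 : Fin s)) ((topA A (Δ :: T)).smul_mem _ (hθA x hx))
    exact hle he
  refine ⟨θ w, hθA w hwA, fun e he => ?_⟩
  have hp0 : ∀ f ∈ Δ :: T, IsInv f := by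
    intro f hf
    rcases List.mem_cons.1 hf with rfl | hf
    · exact isInv_minorSum k 0
    · obtain ⟨t, -, -, rfl⟩ := mem_tailSums.1 hf
      exact isInv_minorSum k t
  have hprodK : algebraMap (detPolyRing k r s) K (Δ :: T).prod =
      algebraMap (detPolyRing k r s) K Δ ^ (r * (s - r) + 1) *
        algebraMap (chartRing k r s) K T'.prod := by
    have h1 : ∀ (l : List (detPolyRing k r s)) (l' : List (chartRing k r s)),
        List.Forall₂ (fun f f' => algebraMap (detPolyRing k r s) K f =
          algebraMap (detPolyRing k r s) K Δ * algebraMap (chartRing k r s) K f') l l' →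
        algebraMap (detPolyRing k r s) K l.prod =
          algebraMap (detPolyRing k r s) K Δ ^ l.length *
            algebraMap (chartRing k r s) K l'.prod := by
      intro l l' h
      induction h with
      | nil => simp
      | cons h1 _ ih =>
        rw [List.prod_cons, List.prod_cons, map_mul, map_mul, h1, ih, List.length_cons]
        ring
    rw [List.prod_cons, map_mul, h1 T T' hTT', hT, length_tailSums]
    ring
  have hT'0 : algebraMap (chartRing k r s) K T'.prod ≠ 0 := by
    rw [map_ne_zero_iff _ hinj]
    intro h
    rw [List.prod_eq_zero_iff] at h
    obtain ⟨t, h1, h2, h3⟩ := mem_tailSums.1 h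
    exact hne t h2 h3
  have hp : algebraMap (detPolyRing k r s) K (Δ :: T).prod ≠ 0 := by
    rw [hprodK]
    exact mul_ne_zero (pow_ne_zero _ hΔ) hT'0
  have hhom (n : ℕ) : ((Δ :: T).prod ^ n).IsHomogeneous (r * (r * (s - r) + 1) * n) := by
    have h1 : ∀ l : List (detPolyRing k r s), (∀ f ∈ l, f.IsHomogeneous r) →
        l.prod.IsHomogeneous (r * l.length) := by
      intro l hl
      induction l with
      | nil => exact isHomogeneous_one _ _
      | cons f l ih =>
        rw [List.prod_cons, List.length_cons, mul_add, mul_one, add_comm]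
        exact (hl f List.mem_cons_self).mul (ih fun g hg => hl g (List.mem_cons_of_mem _ hg))
    have h2 := h1 (Δ :: T) (by
      intro f hf
      rcases List.mem_cons.1 hf with rfl | hf
      · exact isHomogeneous_minorSum k 0
      · obtain ⟨t, -, -, rfl⟩ := mem_tailSums.1 hf
        exact isHomogeneous_minorSum k t)
    rw [List.length_cons, hT, length_tailSums] at h2
    exact h2.pow n
  let Good (x : K) : Prop := ∃ c : k, x - (C c : detPolyRing k r s) • θ w ∈ imK E.action A (Δ :: T)
  have hGadd (x y) (hx : Good x) (hy : Good y) : Good (x + y) := by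
    obtain ⟨a, ha⟩ := hx
    obtain ⟨b, hb⟩ := hy
    refine ⟨a + b, ?_⟩
    rw [C_add, add_smul, add_sub_add_comm]
    exact add_mem ha hb
  have hGim (x) (hx : x ∈ imK E.action A (Δ :: T)) : Good x :=
    ⟨0, by rwa [C_0, zero_smul, sub_zero]⟩
  obtain ⟨N, hN⟩ := exists_prod_pow_smul_mem_of_mem_topA he
  obtain ⟨n, hnN, hns⟩ : ∃ n, N ≤ n ∧ s ≤ (r * (s - r) + 1) * n :=
    ⟨max N s, le_max_left _ _, by nlinarith [le_max_right N s]⟩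
  obtain ⟨a, ha⟩ := hN n hnN
  have hea : e = fracL K (Δ :: T) n a := by
    have ha' : algebraMap (detPolyRing k r s) K a = _ := ha
    rw [fracL, ha', Algebra.smul_def, inv_mul_cancel_left₀]
    rw [map_pow]
    exact pow_ne_zero _ hp
  have hfadd (x y) : fracL K (Δ :: T) n (x + y) = fracL K (Δ :: T) n x + fracL K (Δ :: T) n y := by
    simp only [fracL, map_add, mul_add]
  have hfC (c : k) (x) : fracL K (Δ :: T) n (c • x) =
      (C c : detPolyRing k r s) • fracL K (Δ :: T) n x := by
    rw [fracL, fracL, smul_eq_C_mul, map_mul, Algebra.smul_def, mul_left_comm]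
  have hinv (b : detPolyRing k r s) (hb : IsInv b)
      (hw' : b.IsHomogeneous (r * ((r * (s - r) + 1) * n - s))) :
      Good (fracL K (Δ :: T) n b) := by
    set e' : K := (algebraMap (chartRing k r s) K T'.prod ^ n)⁻¹ *
      algebraMap (chartRing k r s) K (toChart k r s b) with he'
    have h1 : fracL K (Δ :: T) n b = θ e' := by
      rw [fracL, map_pow, hprodK, algebraMap_eq_of_isInv (K := K) hrs.le hr hb hw', ← hY]
      have h2 : algebraMap (detPolyRing k r s) K Δ ^ ((r * (s - r) + 1) * n) =
          algebraMap (detPolyRing k r s) K Δ ^ ((r * (s - r) + 1) * n - s) *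
            algebraMap (detPolyRing k r s) K Δ ^ s := by
        rw [← pow_add, Nat.sub_add_cancel hns]
      change _ = (algebraMap (detPolyRing k r s) K Δ ^ s)⁻¹ * e'
      rw [he', mul_pow, ← pow_mul, h2, mul_inv, mul_inv]
      have h3 (u v x y : K) (hu : u ≠ 0) : u⁻¹ * v⁻¹ * x * (u * y) = v⁻¹ * (x * y) := by
        rw [mul_comm u⁻¹, mul_assoc, mul_assoc, mul_left_comm x, inv_mul_cancel_left₀ hu]
      exact h3 _ _ _ _ (pow_ne_zero _ hΔ)
    have h2 : e' ∈ topA A' T' := by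
      refine mem_topA_of_prod_pow_smul_mem n ⟨toChart k r s b, ?_⟩
      rw [Algebra.smul_def, map_pow, he', mul_inv_cancel_left₀ (pow_ne_zero _ hT'0)]
      rfl
    obtain ⟨c, hc⟩ := hw e' h2
    refine ⟨c, ?_⟩
    rw [h1]
    have h3 := hθim _ hc
    rw [hC] at h3
    have h4 : θ (e' - (C c : detPolyRing k r s) • w) =
        θ e' - (C c : detPolyRing k r s) • θ w := by
      simp only [θ, mul_sub, mul_smul_comm]
    rwa [h4] at h3
  have hA₀ : ∀ i, ∀ c ∈ A, E.action.D i c ∈ A := E.stable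
  have hpol (x : detPolyRing k r s) (hx : x ∈ imPolar k (Fin r) (Fin s)) :
      fracL K (Δ :: T) n x ∈ imK E.action A (Δ :: T) := by
    induction hx using Submodule.span_induction with
    | mem x hx =>
      obtain ⟨i, j, f, hij, rfl⟩ := hx
      exact fracL_polar_mem_imK E hp n hp0 hij f
    | zero =>
      rw [fracL, map_zero, mul_zero]
      exact zero_mem _
    | add x y _ _ hx hy =>
      rw [hfadd]
      exact add_mem hx hy
    | smul c x _ hx =>
      rw [hfC]
      exact C_smul_mem_imK hA₀ c hx
  have hGhom (m : ℕ) (f : detPolyRing k r s) (hf : f.IsHomogeneous m) :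
      Good (fracL K (Δ :: T) n f) := by
    by_cases hm : Fintype.card (Fin r × Fin s) + m = r * (r * (s - r) + 1) * n
    · obtain ⟨b, hb, hbm, hx⟩ := exists_isInv_sub_mem hf
      rw [← add_sub_cancel b f, hfadd]
      refine hGadd _ _ (hinv b hb ?_) (hGim _ (hpol _ hx))
      have h1 : m = r * ((r * (s - r) + 1) * n - s) := by
        rw [Fintype.card_prod, Fintype.card_fin, Fintype.card_fin] at hm
        rw [Nat.mul_sub, ← mul_assoc, ← hm]
        omega
      rwa [← h1]
    · exact hGim _ (fracL_mem_imK_of_isHomogeneous E hp n hf (hhom n) hm)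
  have hGsum (t : Finset ℕ) (f : ℕ → detPolyRing k r s) (hf : ∀ m, (f m).IsHomogeneous m) :
      Good (fracL K (Δ :: T) n (∑ m ∈ t, f m)) := by
    induction t using Finset.induction_on with
    | empty =>
      rw [Finset.sum_empty, fracL, map_zero, mul_zero]
      exact hGim _ (zero_mem _)
    | insert m t hm ih =>
      rw [Finset.sum_insert hm, hfadd]
      exact hGadd _ _ (hGhom m _ (hf m)) ih
  rw [hea, ← sum_homogeneousComponent a]
  exact hGsum _ _ fun m => homogeneousComponent_isHomogeneous m a

end Coinvariants

end LocCohTop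

namespace LocCohTop
open MvPolynomial

section Descent

variable {k : Type} [Field k] [CharZero k] {σ : Type}

/-- Coefficientwise application of a linear functional. -/
noncomputable def coeffwise (l : k →ₗ[ℚ] ℚ) (f : MvPolynomial σ k) : MvPolynomial σ ℚ :=
  ∑ a ∈ f.support, monomial a (l (coeff a f))

lemma coeff_coeffwise (l : k →ₗ[ℚ] ℚ) (f : MvPolynomial σ k) (a : σ →₀ ℕ) :
    coeff a (coeffwise l f) = l (coeff a f) := by
  classical
  rw [coeffwise, coeff_sum]
  simp only [coeff_monomial]
  rw [Finset.sum_ite_eq']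
  split_ifs with h
  · rfl
  · rw [notMem_support_iff.1 h, map_zero]

lemma coeffwise_add (l : k →ₗ[ℚ] ℚ) (f g : MvPolynomial σ k) :
    coeffwise l (f + g) = coeffwise l f + coeffwise l g := by
  ext a
  simp only [coeff_coeffwise, coeff_add, map_add]

lemma coeffwise_zero (l : k →ₗ[ℚ] ℚ) : coeffwise l (0 : MvPolynomial σ k) = 0 := by
  ext a
  simp only [coeff_coeffwise, coeff_zero, map_zero]

lemma coeffwise_sum (l : k →ₗ[ℚ] ℚ) {α : Type*} (s : Finset α) (f : α → MvPolynomial σ k) :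
    coeffwise l (∑ a ∈ s, f a) = ∑ a ∈ s, coeffwise l (f a) :=
  map_sum (⟨⟨coeffwise l, coeffwise_zero l⟩, coeffwise_add l⟩ :
    MvPolynomial σ k →+ MvPolynomial σ ℚ) f s

lemma coeffwise_X_mul (l : k →ₗ[ℚ] ℚ) (i : σ) (f : MvPolynomial σ k) :
    coeffwise l (X i * f) = X i * coeffwise l f := by
  classical
  ext a
  rw [coeff_coeffwise, coeff_X_mul', coeff_X_mul']
  split_ifs
  · rw [coeff_coeffwise]
  · exact map_zero l

lemma coeffwise_pderiv (l : k →ₗ[ℚ] ℚ) (i : σ) (f : MvPolynomial σ k) :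
    coeffwise l (pderiv i f) = pderiv i (coeffwise l f) := by
  ext a
  rw [coeff_coeffwise, coeff_pderiv, coeff_pderiv, coeff_coeffwise]
  have h : coeff (a + Finsupp.single i 1) f * ((a i : k) + 1) =
      (a i + 1) • coeff (a + Finsupp.single i 1) f := by
    rw [nsmul_eq_mul, mul_comm, Nat.cast_add, Nat.cast_one]
  rw [h, map_nsmul, nsmul_eq_mul, mul_comm, Nat.cast_add, Nat.cast_one]

lemma exists_linear_ne_zero {x : k} (hx : x ≠ 0) : ∃ l : k →ₗ[ℚ] ℚ, l x ≠ 0 := by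
  by_contra! h
  exact hx ((Module.forall_dual_apply_eq_zero_iff ℚ x).1 h)

variable {ι κ : Type} [Fintype κ]

lemma coeffwise_polar (l : k →ₗ[ℚ] ℚ) (i j : ι) (f : MvPolynomial (ι × κ) k) :
    coeffwise l (polar k i j f) = polar ℚ i j (coeffwise l f) := by
  rw [polar_apply, polar_apply, coeffwise_sum]
  exact Finset.sum_congr rfl fun _ _ => by rw [coeffwise_X_mul, coeffwise_pderiv]

lemma coeffwise_mem_imPolar (l : k →ₗ[ℚ] ℚ) {f : MvPolynomial (ι × κ) k}
    (hf : f ∈ imPolar k ι κ) : coeffwise l f ∈ imPolar ℚ ι κ := by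
  have h (c : k) : coeffwise l (c • f) ∈ imPolar ℚ ι κ := by
    induction hf using Submodule.span_induction generalizing c with
    | mem x hx =>
      obtain ⟨i, j, f, hij, rfl⟩ := hx
      rw [← Derivation.map_smul, coeffwise_polar]
      exact polar_mem_imPolar hij _
    | zero => rw [smul_zero, coeffwise_zero]; exact zero_mem _
    | add x y _ _ hx hy => rw [smul_add, coeffwise_add]; exact add_mem (hx c) (hy c)
    | smul a x _ hx => rw [smul_smul]; exact hx _
  simpa using h 1

/-- A nonzero invariant is never in the image of the polarization operators. -/
lemma IsInv.eq_zero_of_mem_imPolar_of_charZero [Fintype ι] {b : MvPolynomial (ι × κ) k}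
    (hb : IsInv b) (hx : b ∈ imPolar k ι κ) : b = 0 := by
  ext a
  by_contra h
  obtain ⟨l, hl⟩ := exists_linear_ne_zero h
  have h1 : coeffwise l b = 0 := IsInv.eq_zero_of_mem_imPolar
    (fun i j hij => by rw [← coeffwise_polar, hb i j hij, coeffwise_zero])
    (coeffwise_mem_imPolar l hx)
  rw [← coeff_coeffwise, h1, coeff_zero] at hl
  exact hl rfl

/-- Reduction to invariant coefficients. -/
lemma exists_isInv_of_eq_sum_mul [Fintype ι] {α : Type*} (s : Finset α)
    {q : α → MvPolynomial (ι × κ) k} {F : MvPolynomial (ι × κ) k} (hF : IsInv F)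
    (hq : ∀ a ∈ s, IsInv (q a)) (f : α → MvPolynomial (ι × κ) k) (h : F = ∑ a ∈ s, f a * q a) :
    ∃ b : α → MvPolynomial (ι × κ) k, (∀ a, IsInv (b a)) ∧ F = ∑ a ∈ s, b a * q a := by
  have h1 (f : MvPolynomial (ι × κ) k) : ∃ b, IsInv b ∧ f - b ∈ imPolar k ι κ := by
    have h2 (m : ℕ) := exists_isInv_sub_mem (homogeneousComponent_isHomogeneous m f)
    choose b hb _ hb' using h2
    refine ⟨∑ m ∈ Finset.range (f.totalDegree + 1), b m, IsInv.sum _ fun m _ => hb m, ?_⟩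
    nth_rewrite 1 [← sum_homogeneousComponent f]
    rw [← Finset.sum_sub_distrib]
    exact sum_mem fun m _ => hb' m
  choose b hb hb' using fun a => h1 (f a)
  refine ⟨b, hb, sub_eq_zero.1 (IsInv.eq_zero_of_mem_imPolar_of_charZero ?_ ?_)⟩
  · intro i j hij
    rw [map_sub, hF i j hij, map_sum, Finset.sum_eq_zero, sub_zero]
    intro a ha
    rw [Derivation.leibniz, hb a i j hij, hq a ha i j hij, smul_zero, smul_zero, add_zero]
  · rw [h, ← Finset.sum_sub_distrib]
    refine sum_mem fun a ha => ?_
    rw [← sub_mul, mul_comm]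
    exact (hq a ha).mul_mem_imPolar (hb' a)

end Descent

section Trace

lemma exists_smul_eq_sum_of_finite {P L F : Type} [CommRing P] [IsDomain P]
    [IsIntegrallyClosed P] [CharZero P] [Field L] [Algebra P L] [IsFractionRing P L] [Field F]
    [Algebra L F] [Algebra P F] [IsScalarTower P L F] [FiniteDimensional L F]
    {σ : Type} [Fintype σ] (x : P) (q : σ → P) (b : σ → F) (hb : ∀ i, IsIntegral P (b i))
    (h : algebraMap P F x = ∑ i, b i * algebraMap P F (q i)) :
    ∃ (m : ℕ) (c : σ → P), 0 < m ∧ m • x = ∑ i, c i * q i := by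
  have : CharZero L := charZero_of_injective_algebraMap (IsFractionRing.injective P L)
  have h1 (i) : ∃ c : P, algebraMap P L c = Algebra.trace L F (b i) :=
    IsIntegrallyClosed.isIntegral_iff.1 (Algebra.isIntegral_trace (hb i))
  choose c hc using h1
  refine ⟨Module.finrank L F, c, Module.finrank_pos, IsFractionRing.injective P L ?_⟩
  have h2 : algebraMap L F (algebraMap P L x) = ∑ i, algebraMap P L (q i) • b i := by
    rw [← IsScalarTower.algebraMap_apply, h]
    refine Finset.sum_congr rfl fun i _ => ?_
    rw [Algebra.smul_def, ← IsScalarTower.algebraMap_apply, mul_comm]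
  have h3 := congrArg (Algebra.trace L F) h2
  rw [Algebra.trace_algebraMap, map_sum] at h3
  rw [map_nsmul, h3, map_sum]
  refine Finset.sum_congr rfl fun i _ => ?_
  rw [map_smul, smul_eq_mul, ← hc, map_mul, mul_comm]

lemma exists_smul_eq_sum_of_isIntegral {P K : Type} [CommRing P] [IsDomain P]
    [IsIntegrallyClosed P] [CharZero P] [Field K] [Algebra P K] [FaithfulSMul P K]
    {σ : Type} [Fintype σ] (x : P) (q : σ → P) (b : σ → K) (hb : ∀ i, IsIntegral P (b i))
    (h : algebraMap P K x = ∑ i, b i * algebraMap P K (q i)) :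
    ∃ (m : ℕ) (c : σ → P), 0 < m ∧ m • x = ∑ i, c i * q i := by
  let _ : Algebra (FractionRing P) K := FractionRing.liftAlgebra P K
  have : FiniteDimensional (FractionRing P)
      (IntermediateField.adjoin (FractionRing P) (Set.range b)) :=
    IntermediateField.finiteDimensional_adjoin (by
      rintro _ ⟨i, rfl⟩
      exact (hb i).tower_top)
  let b' (i : σ) : IntermediateField.adjoin (FractionRing P) (Set.range b) :=
    ⟨b i, IntermediateField.subset_adjoin _ _ ⟨i, rfl⟩⟩
  have hPK (y : P) : algebraMap (IntermediateField.adjoin (FractionRing P) (Set.range b)) K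
      (algebraMap P _ y) = algebraMap P K y := by
    rw [IsScalarTower.algebraMap_apply P (FractionRing P)
      (IntermediateField.adjoin (FractionRing P) (Set.range b)),
      IsScalarTower.algebraMap_apply P (FractionRing P) K]
    rfl
  refine exists_smul_eq_sum_of_finite (L := FractionRing P)
    (F := IntermediateField.adjoin (FractionRing P) (Set.range b)) x q b' (fun i => ?_) ?_
  · obtain ⟨f, hf, hf0⟩ := hb i
    refine ⟨f, hf, Subtype.val_injective ?_⟩
    have h1 := Polynomial.hom_eval₂ f (algebraMap P _)
      (algebraMap (IntermediateField.adjoin (FractionRing P) (Set.range b)) K) (b' i)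
    refine Eq.trans h1 (Eq.trans ?_ hf0)
    congr 1
  · apply (algebraMap (IntermediateField.adjoin (FractionRing P) (Set.range b)) K).injective
    rw [hPK, h, map_sum]
    refine Finset.sum_congr rfl fun i _ => ?_
    rw [map_mul, hPK]
    rfl

lemma smul_prod_X_pow_ne_sum {k : Type} [Field k] [CharZero k] {σ : Type} [Fintype σ]
    {m n : ℕ} (hm : 0 < m) (hn : 0 < n) (c : σ → MvPolynomial σ k) :
    m • (∏ i, (X i : MvPolynomial σ k)) ^ (n - 1) ≠ ∑ i, c i * X i ^ n := by
  classical
  intro h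
  have h5 := congrArg (coeff (Finsupp.equivFunOnFinite.symm fun _ => n - 1)) h
  rw [coeff_sum, Finset.sum_eq_zero, coeff_smul] at h5
  · have h6 : (∏ i, (X i : MvPolynomial σ k)) ^ (n - 1) =
        monomial (Finsupp.equivFunOnFinite.symm fun _ => n - 1) 1 := by
      rw [monomial_eq, Finsupp.prod_fintype _ _ (fun i => pow_zero _), ← Finset.prod_pow]
      simp
    rw [h6, coeff_monomial, if_pos rfl, nsmul_eq_mul, mul_one, Nat.cast_eq_zero] at h5
    exact hm.ne' h5
  · intro i _
    rw [X_pow_eq_monomial, coeff_mul_monomial', if_neg]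
    intro h7
    have := h7 i
    simp at this
    omega

/-- A product relation cannot be produced by integral coefficients. -/
theorem prod_pow_ne_sum_of_isIntegral {k : Type} [Field k] [CharZero k] {K : Type} [Field K]
    [Algebra k K] {σ : Type} [Fintype σ] {p : σ → K}
    (hp : AlgebraicIndependent k p) (b : σ → K)
    (hb : ∀ i, IsIntegral (Algebra.adjoin k (Set.range p)) (b i)) {n : ℕ} (hn : 0 < n) :
    (∏ i, p i) ^ (n - 1) ≠ ∑ i, b i * p i ^ n := by
  intro heq
  let _ : Algebra (MvPolynomial σ k) K := (aeval p).toRingHom.toAlgebra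
  have halg (f : MvPolynomial σ k) : algebraMap (MvPolynomial σ k) K f = aeval p f := rfl
  have : FaithfulSMul (MvPolynomial σ k) K := (faithfulSMul_iff_algebraMap_injective _ K).2 hp
  obtain ⟨m, c, hm, h⟩ :=
    exists_smul_eq_sum_of_isIntegral ((∏ i, (X i : MvPolynomial σ k)) ^ (n - 1))
    (fun i => X i ^ n) b (by
      intro i
      obtain ⟨f, hf, hf0⟩ := hb i
      let e : Algebra.adjoin k (Set.range p) →+* MvPolynomial σ k :=
        hp.aevalEquiv.symm.toAlgHom.toRingHom
      refine ⟨f.map e, hf.map e, ?_⟩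
      rw [Polynomial.eval₂_map, ← hf0]
      have h1 : (algebraMap (MvPolynomial σ k) K).comp e = algebraMap _ K := by
        refine RingHom.ext fun x => ?_
        have := hp.algebraMap_aevalEquiv (hp.aevalEquiv.symm x)
        rw [AlgEquiv.apply_symm_apply] at this
        exact this.symm
      rw [h1]) (by
      simp only [halg, map_pow, map_prod, aeval_X]
      exact heq)
  exact smul_prod_X_pow_ne_sum hm hn c h

end Trace

end LocCohTop

namespace LocCohTop
open MvPolynomial

section Cramer

variable {r s : ℕ}

lemma submatrix_updateCol {T : Type*} (M : Matrix (Fin r) (Fin s) T) (e : Fin r → Fin s)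
    (i : Fin r) (j : Fin s) :
    (M.submatrix id e).updateCol i (fun a => M a j) = M.submatrix id (Function.update e i j) := by
  ext a b
  rw [Matrix.updateCol_apply, Matrix.submatrix_apply, Matrix.submatrix_apply]
  split_ifs with h
  · rw [h, Function.update_self]
    rfl
  · rw [Function.update_of_ne h]

lemma inv_submatrix_mul_apply {K : Type*} [Field K] (M : Matrix (Fin r) (Fin s) K)
    (e : Fin r → Fin s) (he : (M.submatrix id e).det ≠ 0) (i : Fin r) (j : Fin s) :
    (M.submatrix id e).det * ((M.submatrix id e)⁻¹ * M) i j =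
      (M.submatrix id (Function.update e i j)).det := by
  have h := Matrix.det_smul_inv_mulVec_eq_cramer (M.submatrix id e) (fun a => M a j)
    (Ne.isUnit he)
  have h1 := congrFun h i
  rw [Matrix.cramer_apply, submatrix_updateCol] at h1
  exact h1

lemma det_ne_zero_injective {K : Type*} [Field K] {M : Matrix (Fin r) (Fin s) K}
    {e : Fin r → Fin s} (he : (M.submatrix id e).det ≠ 0) : Function.Injective e := by
  intro i j hij
  by_contra h
  refine he (Matrix.det_zero_of_column_eq h fun a => ?_)
  rw [Matrix.submatrix_apply, Matrix.submatrix_apply, hij]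

/-- A matrix whose minor sums lie in a valuation ring factors through a matrix with entries in the
valuation ring. -/
lemma exists_factor_of_minorSum_mem {K : Type} [Field K] (V : ValuationSubring K)
    (M : Matrix (Fin r) (Fin s) K) (hM : ∃ e : Fin r → Fin s, (M.submatrix id e).det ≠ 0)
    (hV : ∀ t ≤ r * (s - r), minorSum M t ∈ V) :
    ∃ (g : Matrix (Fin r) (Fin r) K) (N : Matrix (Fin r) (Fin s) K),
      M = g * N ∧ g.det ∈ V ∧ ∀ i j, N i j ∈ V := by
  obtain ⟨e₀, he₀⟩ := hM
  obtain ⟨e, -, he⟩ := Finset.exists_max_image Finset.univ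
    (fun e : Fin r → Fin s => V.valuation (M.submatrix id e).det) ⟨e₀, Finset.mem_univ _⟩
  set B := M.submatrix id e with hB
  have hdet : B.det ≠ 0 := by
    rw [← V.valuation.ne_zero_iff] at he₀ ⊢
    exact (lt_of_lt_of_le (zero_lt_iff.2 he₀) (he e₀ (Finset.mem_univ _))).ne'
  have hBN : B * (B⁻¹ * M) = M := by
    rw [← Matrix.mul_assoc, Matrix.mul_nonsing_inv _ (Ne.isUnit hdet), Matrix.one_mul]
  have hN (i j) : (B⁻¹ * M) i j ∈ V := by
    rw [← V.valuation_le_one_iff]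
    have h := congrArg V.valuation (inv_submatrix_mul_apply M e hdet i j)
    rw [map_mul] at h
    have h1 := he (Function.update e i j) (Finset.mem_univ _)
    rw [← h] at h1
    have h2 : 0 < V.valuation B.det := zero_lt_iff.2 ((V.valuation.ne_zero_iff).2 hdet)
    exact (mul_le_iff_le_one_right h2).1 h1
  refine ⟨B, B⁻¹ * M, hBN.symm, ?_, hN⟩
  let N : Matrix (Fin r) (Fin s) V := fun i j => ⟨(B⁻¹ * M) i j, hN i j⟩
  have hNmap : N.map (algebraMap V K) = B⁻¹ * M := rfl
  have hNe : N.submatrix id e = 1 := by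
    have h1 : (B⁻¹ * M).submatrix id e = 1 := by
      have h2 : (B⁻¹ * M).submatrix id e = B⁻¹ * B := rfl
      rw [h2, Matrix.nonsing_inv_mul _ (Ne.isUnit hdet)]
    ext i j
    have h2 := congrFun (congrFun h1 i) j
    refine Eq.trans h2 ?_
    rw [Matrix.one_apply, Matrix.one_apply]
    split_ifs <;> rfl
  let f := IsLocalRing.residue V
  have hNf : ((N.map f).submatrix id e).det ≠ 0 := by
    have h1 : (N.map f).submatrix id e = (N.submatrix id e).map f := rfl
    rw [h1, hNe, Matrix.map_one f (map_zero f) (map_one f), Matrix.det_one]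
    exact one_ne_zero
  obtain ⟨t, ht, ht0⟩ := exists_minorSum_ne_zero (N.map f)
    (exists_orderEmb_of_embedding (N.map f) (Function.Embedding.refl _)
      ⟨e, det_ne_zero_injective hNf⟩ hNf)
  rw [← map_minorSum] at ht0
  have hunit : IsUnit (minorSum N t) := by
    by_contra h
    exact ht0 ((IsLocalRing.residue_eq_zero_iff _).2 h)
  have h1 : V.valuation (minorSum (B⁻¹ * M) t) = 1 := by
    rw [← hNmap, ← map_minorSum]
    exact (V.valuation_eq_one_iff _).1 hunit
  have h2 := hV t ht
  rw [← hBN, minorSum_mul, ← V.valuation_le_one_iff, map_mul, h1, mul_one] at h2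
  exact (V.valuation_le_one_iff _).1 h2

end Cramer

section Integral

variable {k : Type} [Field k] [CharZero k] {r s : ℕ} {K : Type} [Field K]
  [Algebra (detPolyRing k r s) K] [Algebra k K]

/-- The algebra generated by the minor sums of the generic matrix. -/
noncomputable abbrev minorSumAlg (k : Type) [Field k] (r s : ℕ) (K : Type) [Field K]
    [Algebra (detPolyRing k r s) K] [Algebra k K] : Subalgebra k K :=
  Algebra.adjoin k (Set.range fun t : Fin (r * (s - r) + 1) =>
    algebraMap (detPolyRing k r s) K (minorSum (genericMatrix k r s) t))

variable [IsFractionRing (detPolyRing k r s) K] [IsScalarTower k (detPolyRing k r s) K]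

lemma isIntegral_of_isInv_of_isHomogeneous (hr : 0 < r) (hrs : r ≤ s) {b : detPolyRing k r s}
    {n : ℕ} (hb : IsInv b) (hn : b.IsHomogeneous n) :
    IsIntegral (minorSumAlg k r s K) (algebraMap (detPolyRing k r s) K b) := by
  by_cases hb0 : b = 0
  · rw [hb0, map_zero]
    exact isIntegral_zero
  have : Nonempty (Fin r) := ⟨⟨0, hr⟩⟩
  obtain ⟨a, ha⟩ := support_nonempty.2 hb0
  have hw := hb.card_mul_rowDegree hn ha ⟨0, hr⟩
  set w := ∑ l, a (⟨0, hr⟩, l)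
  rw [← hw] at hn
  by_contra hni
  obtain ⟨V, hV, hbV⟩ := Subring.exists_le_valuationSubring_of_isIntegrallyClosedIn
    (R := (integralClosure (minorSumAlg k r s K) K).toSubring) hni
  have hPV (x : K) (hx : x ∈ minorSumAlg k r s K) : x ∈ V :=
    hV (isIntegral_algebraMap (A := K) (x := (⟨x, hx⟩ : minorSumAlg k r s K)))
  have hkV (c : k) : algebraMap k K c ∈ V := hPV _ (Subalgebra.algebraMap_mem _ c)
  obtain ⟨g, N, h1, h2, h3⟩ := exists_factor_of_minorSum_mem V (matK k r s K)
    ⟨Fin.castLE hrs, det_blockK_ne_zero (k := k) (K := K) hrs⟩ (by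
      intro t ht
      refine hPV _ (Algebra.subset_adjoin ⟨⟨t, by omega⟩, ?_⟩)
      exact map_minorSum (algebraMap (detPolyRing k r s) K) (genericMatrix k r s) t)
  have h4 := evalMat_matK (K := K) b
  rw [h1, hb.evalMat_mul (w := w) hn] at h4
  apply hbV
  rw [← h4]
  refine mul_mem (pow_mem h2 w) ?_
  rw [aeval_eq_eval₂Hom, coe_eval₂Hom, eval₂_eq']
  exact sum_mem fun m _ => mul_mem (hkV _) (prod_mem fun p _ => pow_mem (h3 _ _) _)

omit [CharZero k] in
lemma IsInv.homogeneousComponent {ι κ : Type} [Fintype κ]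
    {b : MvPolynomial (ι × κ) k} (hb : IsInv b) (n : ℕ) :
    IsInv (MvPolynomial.homogeneousComponent n b) := by
  intro i j hij
  have h := congrArg (MvPolynomial.homogeneousComponent n) (hb i j hij)
  nth_rewrite 1 [← sum_homogeneousComponent b] at h
  rw [map_sum, map_sum, map_zero] at h
  have h1 (m : ℕ) := homogeneousComponent_of_mem (m := n) ((mem_homogeneousSubmodule _ _).2
    (isHomogeneous_polar i j (homogeneousComponent_isHomogeneous m b)))
  rw [Finset.sum_congr rfl fun m _ => h1 m, Finset.sum_ite_eq] at h
  split_ifs at h with h2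
  · exact h
  · rw [homogeneousComponent_eq_zero, map_zero]
    rw [Finset.mem_range] at h2
    omega

lemma isIntegral_of_isInv (hr : 0 < r) (hrs : r ≤ s) {b : detPolyRing k r s} (hb : IsInv b) :
    IsIntegral (minorSumAlg k r s K) (algebraMap (detPolyRing k r s) K b) := by
  rw [← sum_homogeneousComponent b, map_sum]
  exact IsIntegral.sum _ fun m _ => isIntegral_of_isInv_of_isHomogeneous hr hrs
    (hb.homogeneousComponent m) (homogeneousComponent_isHomogeneous m b)

end Integral

section Transcendence

theorem algebraicIndependent_of_algebra_isIntegral {k A ι ι' : Type} [Field k] [CommRing A]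
    [IsDomain A] [Algebra k A] [Fintype ι] [Fintype ι'] (p : ι → A) (c : ι' → A)
    (hc : AlgebraicIndependent k c) (hcard : Fintype.card ι ≤ Fintype.card ι')
    (h_int : Algebra.IsIntegral (Algebra.adjoin k (Set.range p)) A) :
    AlgebraicIndependent k p := by
  have halg : Algebra.IsAlgebraic (Algebra.adjoin k (Set.range p)) A :=
    Algebra.IsIntegral.isAlgebraic
  refine (Algebra.IsAlgebraic.isTranscendenceBasis_of_le_trdeg_of_finite k p ?_).1
  refine le_trans ?_ hc.cardinalMk_le_trdeg
  rw [Cardinal.mk_fintype, Cardinal.mk_fintype]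
  exact_mod_cast hcard

theorem algebraicIndependent_of_isIntegral {k K ι ι' : Type} [Field k] [Field K] [Algebra k K]
    [Fintype ι] [Fintype ι'] (p : ι → K) (c : ι' → K) (hc : AlgebraicIndependent k c)
    (hcard : Fintype.card ι ≤ Fintype.card ι')
    (h_int : ∀ q, IsIntegral (Algebra.adjoin k (Set.range p)) (c q)) :
    AlgebraicIndependent k p := by
  obtain ⟨A, hA⟩ : ∃ A : Subalgebra k K, ∀ x, x ∈ A ↔
      IsIntegral (Algebra.adjoin k (Set.range p)) x :=
    ⟨(integralClosure (Algebra.adjoin k (Set.range p)) K).restrictScalars k, fun x => Iff.rfl⟩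
  have hpA (t : ι) : p t ∈ A := (hA _).2 (isIntegral_algebraMap (A := K)
    (x := (⟨p t, Algebra.subset_adjoin ⟨t, rfl⟩⟩ : Algebra.adjoin k (Set.range p))))
  let p' (t : ι) : A := ⟨p t, hpA t⟩
  let c' (q : ι') : A := ⟨c q, (hA _).2 (h_int q)⟩
  have hj : Function.Injective A.val := Subtype.val_injective
  have hc' : AlgebraicIndependent k c' := by
    have h : ⇑A.val ∘ c' = c := rfl
    rwa [← AlgHom.algebraicIndependent_iff A.val hj, h]
  have hmap : Algebra.adjoin k (Set.range p) = (Algebra.adjoin k (Set.range p')).map A.val := by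
    rw [AlgHom.map_adjoin, ← Set.range_comp]
    rfl
  let g : Algebra.adjoin k (Set.range p) →ₐ[k] Algebra.adjoin k (Set.range p') :=
    ((Algebra.adjoin k (Set.range p')).equivMapOfInjective A.val hj).symm.toAlgHom.comp
      (Subalgebra.equivOfEq _ _ hmap).toAlgHom
  have hg (b) : ((g b : A) : K) = b := by
    have h := congrArg Subtype.val (((Algebra.adjoin k (Set.range p')).equivMapOfInjective A.val
      hj).apply_symm_apply (Subalgebra.equivOfEq _ _ hmap b))
    exact h
  have hI : Algebra.IsIntegral (Algebra.adjoin k (Set.range p')) A := ⟨fun a => by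
    obtain ⟨q, hq, h0⟩ := (hA _).1 a.2
    refine ⟨q.map g.toRingHom, hq.map _, ?_⟩
    apply hj
    rw [Polynomial.eval₂_map, map_zero]
    refine (Polynomial.hom_eval₂ q _ (A.val : A →+* K) a).trans ?_
    rw [← h0]
    congr 1
    ext b
    exact hg b⟩
  have hp : AlgebraicIndependent k p' :=
    algebraicIndependent_of_algebra_isIntegral p' c' hc' hcard hI
  have h := (AlgHom.algebraicIndependent_iff A.val hj).2 hp
  have h2 : ⇑A.val ∘ p' = p := rfl
  rwa [h2] at h

end Transcendence

section Independent

variable {k : Type} [Field k] [CharZero k] {r s : ℕ} (hrs : r ≤ s)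

/-- A family of maximal minors, indexed by the affine coordinates of a cone over the chart. -/
noncomputable def coneMinor (k : Type) [Field k] (hrs : r ≤ s) :
    Option (Fin r × Cols r s) → detPolyRing k r s
  | none => ((genericMatrix k r s).submatrix id (Fin.castLE hrs)).det
  | some q => ((genericMatrix k r s).submatrix id
      (Function.update (Fin.castLE hrs) q.1 (q.2 : Fin s))).det

omit [CharZero k] in
lemma isInv_coneMinor (q) : IsInv (coneMinor k hrs q) := by
  cases q with
  | none => exact isInv_det_X _
  | some q => exact isInv_det_X _

omit [CharZero k] in
lemma evalMat_det_submatrix (N : Matrix (Fin r) (Fin s) k) (e : Fin r → Fin s) :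
    evalMat N ((genericMatrix k r s).submatrix id e).det = (N.submatrix id e).det := by
  rw [AlgHom.map_det]
  congr 1
  ext i j
  exact aeval_X (fun p : Fin r × Fin s => N p.1 p.2) (i, e j)

omit [CharZero k] in
lemma evalMat_coneMinor_none (g : Matrix (Fin r) (Fin r) k) (y : Fin r → Cols r s → k) :
    evalMat (g * stdMat y) (coneMinor k hrs none) = g.det := by
  refine (evalMat_det_submatrix _ _).trans ?_
  have h : (g * stdMat y).submatrix id (Fin.castLE hrs) =
      g * (stdMat y).submatrix id (Fin.castLE hrs) := rfl
  rw [h, stdMat_submatrix hrs y, Matrix.mul_one]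

omit [CharZero k] in
lemma evalMat_coneMinor_some (g : Matrix (Fin r) (Fin r) k) (y : Fin r → Cols r s → k)
    (q : Fin r × Cols r s) :
    evalMat (g * stdMat y) (coneMinor k hrs (some q)) = g.det * y q.1 q.2 := by
  refine (evalMat_det_submatrix _ _).trans ?_
  have h : (g * stdMat y).submatrix id (Function.update (Fin.castLE hrs) q.1 (q.2 : Fin s)) =
      g * (stdMat y).submatrix id (Function.update (Fin.castLE hrs) q.1 (q.2 : Fin s)) := rfl
  rw [h, Matrix.det_mul, ← submatrix_updateCol, stdMat_submatrix hrs y, ← Matrix.cramer_apply,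
    Matrix.cramer_one]
  congr 1
  exact dif_pos q.2.2

lemma algebraicIndependent_coneMinor (hr : 0 < r) : AlgebraicIndependent k (coneMinor k hrs) := by
  classical
  rw [algebraicIndependent_iff]
  intro F hF
  have h : X none * F = 0 := by
    refine MvPolynomial.funext fun v => ?_
    rw [map_mul, eval_X, map_zero]
    by_cases hv : v none = 0
    · rw [hv, zero_mul]
    · let g : Matrix (Fin r) (Fin r) k :=
        Matrix.diagonal (Function.update (fun _ => 1) ⟨0, hr⟩ (v none))
      have hg : g.det = v none := by
        rw [Matrix.det_diagonal, Finset.prod_update_of_mem (Finset.mem_univ _)]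
        simp
      have h1 := congrArg (evalMat (g * stdMat fun i j => (v none)⁻¹ * v (some (i, j)))) hF
      rw [← AlgHom.comp_apply, comp_aeval, map_zero] at h1
      have h2 : (fun q => evalMat (g * stdMat fun i j => (v none)⁻¹ * v (some (i, j)))
          (coneMinor k hrs q)) = v := by
        funext q
        cases q with
        | none => rw [evalMat_coneMinor_none, hg]
        | some q => rw [evalMat_coneMinor_some, hg, mul_inv_cancel_left₀ hv]
      rw [h2] at h1
      have h3 : eval v F = 0 := h1
      rw [h3, mul_zero]
  exact (mul_eq_zero.1 h).resolve_left (X_ne_zero _)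

variable {K : Type} [Field K]
  [Algebra (detPolyRing k r s) K] [Algebra k K] [IsFractionRing (detPolyRing k r s) K]
  [IsScalarTower k (detPolyRing k r s) K]

/-- The minor sums of the generic matrix are algebraically independent. -/
theorem algebraicIndependent_minorSum (hr : 0 < r) (hrs : r ≤ s) :
    AlgebraicIndependent k fun t : Fin (r * (s - r) + 1) =>
      algebraMap (detPolyRing k r s) K (minorSum (genericMatrix k r s) t) := by
  refine algebraicIndependent_of_isIntegral _
    (fun q => algebraMap (detPolyRing k r s) K (coneMinor k hrs q)) ?_ ?_
    fun q => isIntegral_of_isInv hr hrs (isInv_coneMinor hrs q)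
  · have h := (AlgHom.algebraicIndependent_iff (IsScalarTower.toAlgHom k (detPolyRing k r s) K)
      (IsFractionRing.injective (detPolyRing k r s) K)).2 (algebraicIndependent_coneMinor hrs hr)
    exact h
  · rw [Fintype.card_option, Fintype.card_fin, Fintype.card_prod, Fintype.card_fin, card_cols hrs]

end Independent

end LocCohTop

namespace LocCohTop

open MvPolynomial

section InvAlgebra

variable {k : Type} [Field k] {ι κ : Type} [Fintype κ]

lemma IsInv.one : IsInv (1 : MvPolynomial (ι × κ) k) := fun i j _ =>
  Derivation.map_one_eq_zero (polar k i j)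

lemma IsInv.mul {f g : MvPolynomial (ι × κ) k} (hf : IsInv f) (hg : IsInv g) : IsInv (f * g) :=
  fun i j hij => by rw [Derivation.leibniz, hf i j hij, hg i j hij, smul_zero, smul_zero, add_zero]

lemma IsInv.pow {f : MvPolynomial (ι × κ) k} (hf : IsInv f) (n : ℕ) : IsInv (f ^ n) := by
  induction n with
  | zero => rw [pow_zero]; exact IsInv.one
  | succ n ih => rw [pow_succ]; exact ih.mul hf

lemma IsInv.prod {α : Type*} (s : Finset α) {F : α → MvPolynomial (ι × κ) k}
    (h : ∀ a ∈ s, IsInv (F a)) : IsInv (∏ a ∈ s, F a) :=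
  Finset.prod_induction F IsInv (fun _ _ => IsInv.mul) IsInv.one h

end InvAlgebra

section Nonvanishing

variable {k : Type} [Field k] [CharZero k] {r s : ℕ}

omit [CharZero k] in
lemma prod_minorSum_cons_tailSums {T : Type*} [CommRing T] (M : Matrix (Fin r) (Fin s) T) :
    (minorSum M 0 :: tailSums M).prod = ∏ t : Fin (r * (s - r) + 1), minorSum M t := by
  rw [Fin.prod_univ_succ, List.prod_cons, tailSums]
  congr 1
  induction r * (s - r) with
  | zero => simp
  | succ n ih =>
    rw [List.range_succ, List.map_append, List.prod_append, ih, Fin.prod_univ_castSucc]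
    simp

/-- A power of the product of the minor sums does not lie in the ideal of higher powers. -/
theorem prod_minorSum_pow_notMem (hr : 0 < r) (hrs : r ≤ s) {n : ℕ} (hn : 0 < n) :
    (∏ t : Fin (r * (s - r) + 1), minorSum (genericMatrix k r s) t) ^ (n - 1) ∉
      Ideal.span (Set.range fun t : Fin (r * (s - r) + 1) =>
        minorSum (genericMatrix k r s) t ^ n) := by
  intro h
  obtain ⟨a, ha⟩ := Ideal.mem_span_range_iff_exists_fun.1 h
  obtain ⟨b, hb, hb'⟩ := exists_isInv_of_eq_sum_mul Finset.univ
    ((IsInv.prod Finset.univ fun t _ => isInv_minorSum (r := r) (s := s)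
      k (t : Fin (r * (s - r) + 1)).val).pow (n - 1))
    (fun t _ => (isInv_minorSum k t.val).pow n) a ha.symm
  let K := FractionRing (detPolyRing k r s)
  refine prod_pow_ne_sum_of_isIntegral (algebraicIndependent_minorSum (k := k) (K := K) hr hrs)
    (fun t => algebraMap _ K (b t)) (fun t => isIntegral_of_isInv hr hrs (hb t)) hn ?_
  have h2 := congrArg (algebraMap (detPolyRing k r s) K) hb'
  rw [map_pow, map_prod, map_sum] at h2
  rw [h2]
  exact Finset.sum_congr rfl fun t _ => by rw [map_mul, map_pow]

variable {K : Type} [Field K] [Algebra (detPolyRing k r s) K]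
  [IsFractionRing (detPolyRing k r s) K]

theorem exists_topQ_minorSum_ne_zero (hr : 0 < r) (hrs : r ≤ s) :
    ∃ q : TopQ (LinearMap.range (Algebra.linearMap (detPolyRing k r s) K))
      (minorSum (genericMatrix k r s) 0 :: tailSums (genericMatrix k r s)), q ≠ 0 := by
  set L := minorSum (genericMatrix k r s) 0 :: tailSums (genericMatrix k r s) with hL
  set P := ∏ t : Fin (r * (s - r) + 1), minorSum (genericMatrix k r s) t with hP
  have hLP : L.prod = P := prod_minorSum_cons_tailSums _
  have hP0 : algebraMap (detPolyRing k r s) K P ≠ 0 := by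
    rw [Ne, IsFractionRing.to_map_eq_zero_iff (K := K), hP, Finset.prod_eq_zero_iff]
    rintro ⟨t, -, ht⟩
    exact minorSum_genericMatrix_ne_zero k hrs t (by omega) ht
  have hA : (algebraMap (detPolyRing k r s) K P)⁻¹ ∈
      topA (LinearMap.range (Algebra.linearMap (detPolyRing k r s) K)) L := by
    refine mem_topA_of_prod_pow_smul_mem 1 ?_
    rw [pow_one, hLP, Algebra.smul_def, mul_inv_cancel₀ hP0]
    exact ⟨1, map_one (algebraMap (detPolyRing k r s) K)⟩
  refine ⟨TopQ.mk _ hA, fun h0 => ?_⟩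
  rw [TopQ.mk_eq_zero] at h0
  obtain ⟨N, hN⟩ := exists_prod_pow_smul_mem_of_mem_topB h0
  have h1 := hN (N + 1) (by omega)
  refine prod_minorSum_pow_notMem (k := k) hr hrs (Nat.succ_pos N) ?_
  have h2 (x : K) (hx : x ∈ Ideal.span {g | ∃ f ∈ L, g = f ^ (N + 1)} •
      LinearMap.range (Algebra.linearMap (detPolyRing k r s) K)) :
      ∃ y ∈ Ideal.span {g | ∃ f ∈ L, g = f ^ (N + 1)}, algebraMap (detPolyRing k r s) K y = x := by
    induction hx using Submodule.smul_induction_on' with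
    | smul a ha x hx =>
      obtain ⟨y, rfl⟩ := hx
      exact ⟨a * y, Ideal.mul_mem_right _ _ ha, by
        rw [map_mul, Algebra.smul_def, Algebra.linearMap_apply]⟩
    | add x _ y _ hx hy =>
      obtain ⟨x', hx', rfl⟩ := hx
      obtain ⟨y', hy', rfl⟩ := hy
      exact ⟨x' + y', add_mem hx' hy', map_add _ _ _⟩
  obtain ⟨y, hy, hy'⟩ := h2 _ h1
  have h3 : y = P ^ N := by
    apply IsFractionRing.injective (detPolyRing k r s) K
    rw [hy', hLP, Algebra.smul_def, map_pow, map_pow, pow_succ, mul_assoc, mul_inv_cancel₀ hP0,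
      mul_one]
  rw [h3] at hy
  refine Ideal.span_mono ?_ hy
  rintro _ ⟨f, hf, rfl⟩
  rcases List.mem_cons.1 hf with rfl | hf
  · exact ⟨0, rfl⟩
  · obtain ⟨t, -, ht, rfl⟩ := mem_tailSums.1 hf
    exact ⟨⟨t, by omega⟩, rfl⟩

end Nonvanishing

end LocCohTop

namespace LocCohTop

open MvPolynomial

section Torsion

variable {k : Type} [Field k] {r s : ℕ}

lemma minorSum_submatrix_perm_ne_zero (k : Type) [Field k] {r s : ℕ} (hrs : r ≤ s)
    (σ : Equiv.Perm (Fin s)) (t : ℕ) (ht : t ≤ r * (s - r)) :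
    minorSum ((genericMatrix k r s).submatrix id σ) t ≠ 0 := by
  have h : (genericMatrix k r s).submatrix id σ =
      (genericMatrix k r s).map (rename (Prod.map id σ) : detPolyRing k r s →ₐ[k] _).toRingHom := by
    ext1 i j
    exact (rename_X (R := k) (Prod.map id σ) (i, j)).symm
  rw [h, ← map_minorSum]
  intro h0
  exact minorSum_genericMatrix_ne_zero k hrs t ht
    (rename_injective _ (Function.injective_id.prodMap σ.injective) (h0.trans (map_zero _).symm))

variable {K : Type} [Field K] [Algebra (detPolyRing k r s) K]
  [IsFractionRing (detPolyRing k r s) K]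

variable (K) in
lemma exists_localCohomology_equiv_topQ_perm (hrs : r ≤ s) (σ : Equiv.Perm (Fin s)) :
    Nonempty ((localCohomology (minorsIdeal (genericMatrix k r s) r) (r * (s - r) + 1)).obj
        (ModuleCat.of (detPolyRing k r s) (detPolyRing k r s)) ≃ₗ[detPolyRing k r s]
      TopQ (LinearMap.range (Algebra.linearMap (detPolyRing k r s) K))
        (minorSum ((genericMatrix k r s).submatrix id σ) 0 ::
          tailSums ((genericMatrix k r s).submatrix id σ))) := by
  have hinj := IsFractionRing.injective (detPolyRing k r s) K
  refine exists_localCohomology_equiv_of_radical_eq _ hinj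
    (bijective_smul_of_ne_zero (K := K) hinj) _ ?_ (List.cons_ne_nil _ _) _ ?_ _ ?_
  · intro f hf
    rcases List.mem_cons.1 hf with rfl | hf
    · exact minorSum_submatrix_perm_ne_zero k hrs σ 0 (Nat.zero_le _)
    · obtain ⟨t, -, ht, rfl⟩ := mem_tailSums.1 hf
      exact minorSum_submatrix_perm_ne_zero k hrs σ t ht
  · rw [listIdeal_eq, ← radical_span_minorSum, minorsIdeal_submatrix_perm]
  · rw [List.length_cons, length_tailSums]

theorem exists_varNil_localCohomology (hrs : r < s)
    (h : (localCohomology (minorsIdeal (genericMatrix k r s) r) (r * (s - r) + 1)).obj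
        (ModuleCat.of (detPolyRing k r s) (detPolyRing k r s))) :
    ∃ n, VarNil k (Fin r × Fin s) n h := by
  refine exists_varNil_of_forall_pow fun p => ?_
  let σ : Equiv.Perm (Fin s) := Equiv.swap p.2 ⟨r, hrs⟩
  obtain ⟨e⟩ := exists_localCohomology_equiv_topQ_perm (FractionRing (detPolyRing k r s))
    (k := k) hrs.le σ
  obtain ⟨c, hc, hce⟩ := (e h).exists_mk
  have hz := entry_mul_minorSum_mem_radical ((genericMatrix k r s).submatrix id σ) p.1 ⟨r, hrs⟩
    le_rfl
  have hp : (genericMatrix k r s).submatrix id σ p.1 ⟨r, hrs⟩ = X p := by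
    change X (p.1, σ ⟨r, hrs⟩) = _
    rw [Equiv.swap_apply_right]
  rw [hp] at hz
  obtain ⟨m, hm⟩ := exists_pow_smul_mem_topB_cons hc hz
  refine ⟨m, e.injective ?_⟩
  rw [map_smul, hce, ← TopQ.mk_smul, map_zero]
  exact TopQ.mk_eq_zero.2 hm

end Torsion

section InjectiveHull

variable {k : Type} [Field k] {σ : Type}

lemma smul_eq_zero_of_mem_soc {H : Type} [AddCommGroup H] [Module (MvPolynomial σ k) H] {u : H}
    (hu : u ∈ soc k σ H) {f : MvPolynomial σ k}
    (hf : f ∈ Ideal.span (Set.range (X : σ → MvPolynomial σ k))) : f • u = 0 := by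
  induction hf using Submodule.span_induction with
  | mem x hx =>
    obtain ⟨i, rfl⟩ := hx
    exact hu i
  | zero => exact zero_smul _ _
  | add x y _ _ hx hy => rw [add_smul, hx, hy, add_zero]
  | smul a x _ hx => rw [smul_assoc, hx, smul_zero]

variable {H : Type} [AddCommGroup H] [Module (MvPolynomial σ k) H]

/-- A torsion module with one-dimensional socle is an essential extension of the residue field. -/
theorem exists_essential_embedding (htor : ∀ h : H, ∃ n, VarNil k σ n h) {u : H}
    (hu : u ∈ soc k σ H) (hu0 : u ≠ 0)
    (h2 : ∀ v ∈ soc k σ H, ∃ c : k, v = (C c : MvPolynomial σ k) • u) :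
    ∃ ι : (MvPolynomial σ k ⧸ Ideal.span (Set.range (X : σ → MvPolynomial σ k)))
        →ₗ[MvPolynomial σ k] H,
      Function.Injective ι ∧
        ∀ N : Submodule (MvPolynomial σ k) H, N ≠ ⊥ → N ⊓ LinearMap.range ι ≠ ⊥ := by
  let ι : (MvPolynomial σ k ⧸ Ideal.span (Set.range (X : σ → MvPolynomial σ k)))
        →ₗ[MvPolynomial σ k] H :=
    Submodule.liftQ _ (LinearMap.toSpanSingleton (MvPolynomial σ k) H u)
      fun f hf => smul_eq_zero_of_mem_soc hu hf
  have hι (f : MvPolynomial σ k) : ι (Submodule.Quotient.mk f) = f • u := rfl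
  refine ⟨ι, (injective_iff_map_eq_zero ι).2 fun q hq => ?_, fun N hN h0 => ?_⟩
  · obtain ⟨f, rfl⟩ := Submodule.Quotient.mk_surjective _ q
    rw [hι] at hq
    rw [Submodule.Quotient.mk_eq_zero]
    have h3 := sub_C_mem_span_range_X f
    have h4 := smul_eq_zero_of_mem_soc hu h3
    rw [sub_smul, hq, zero_sub, neg_eq_zero] at h4
    have h5 : (aeval (fun _ => 0) : MvPolynomial σ k →ₐ[k] k) f = 0 := by
      by_contra hc
      apply hu0
      rw [← one_smul (MvPolynomial σ k) u, ← C_1, ← inv_mul_cancel₀ hc, C_mul, mul_smul, h4,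
        smul_zero]
    rwa [h5, C_0, sub_zero] at h3
  · obtain ⟨h, hh, hh0⟩ := N.exists_mem_ne_zero_of_ne_bot hN
    obtain ⟨n, hn⟩ := htor h
    obtain ⟨v, hv, hvs, hv0⟩ := exists_soc_of_varNil N n hn hh hh0
    obtain ⟨c, rfl⟩ := h2 v hvs
    have : (C c : MvPolynomial σ k) • u ∈ N ⊓ LinearMap.range ι :=
      ⟨hv, Submodule.Quotient.mk (C c), rfl⟩
    rw [h0] at this
    exact hv0 this

end InjectiveHull

end LocCohTop

section

open MvPolynomial LocCohTop

/-- Let `k` be a field of characteristic zero, `X` an `r × s` matrix of indeterminates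
with `r < s`, `R = k[X]`, `I` the ideal of maximal minors, and `d = r(s−r)+1`.  Then
`H^d_I(R)` is isomorphic as an `R`-module to `E_R(k)`, the injective hull of the residue
field `k = R/𝔪` over `R` (an injective module containing `R/𝔪` as an essential
submodule); in particular its socle is one-dimensional. -/
theorem stmt_14 {k : Type} [Field k] [CharZero k] (r s : ℕ) (hr : 0 < r) (hrs : r < s)
    (𝔪 : Ideal (detPolyRing k r s))
    (h𝔪 : 𝔪 = Ideal.span (Set.range MvPolynomial.X)) :
    (∃ (E : Type) (_ : AddCommGroup E) (_ : Module (detPolyRing k r s) E),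
      Module.Injective (detPolyRing k r s) E ∧
      ∃ ι : (detPolyRing k r s ⧸ 𝔪) →ₗ[detPolyRing k r s] E,
        Function.Injective ι ∧
        (∀ N : Submodule (detPolyRing k r s) E, N ≠ ⊥ → N ⊓ LinearMap.range ι ≠ ⊥) ∧
        Nonempty
          (((localCohomology (minorsIdeal (genericMatrix k r s) r) (r * (s - r) + 1)).obj
              (ModuleCat.of (detPolyRing k r s) (detPolyRing k r s)))
            ≃ₗ[detPolyRing k r s] E)) ∧
    -- in particular, the socle of `H^d_I(R)` is a one-dimensional `k`-vector space
    ∃ u : ((localCohomology (minorsIdeal (genericMatrix k r s) r) (r * (s - r) + 1)).obj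
        (ModuleCat.of (detPolyRing k r s) (detPolyRing k r s))),
      u ≠ 0 ∧ (∀ p ∈ 𝔪, p • u = 0) ∧
      ∀ v : ((localCohomology (minorsIdeal (genericMatrix k r s) r) (r * (s - r) + 1)).obj
          (ModuleCat.of (detPolyRing k r s) (detPolyRing k r s))),
        (∀ p ∈ 𝔪, p • v = 0) →
          ∃ c : k, v = (MvPolynomial.C c : detPolyRing k r s) • u := by
  subst h𝔪
  let K := FractionRing (detPolyRing k r s)
  obtain ⟨e⟩ := exists_localCohomology_equiv_topQ_perm K (k := k) hrs.le 1
  have h1 : (genericMatrix k r s).submatrix id ⇑(1 : Equiv.Perm (Fin s)) = genericMatrix k r s :=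
    rfl
  rw [h1] at e
  have htorH := exists_varNil_localCohomology (k := k) hrs
  have htor (q : TopQ (LinearMap.range (Algebra.linearMap (detPolyRing k r s) K))
      (minorSum (genericMatrix k r s) 0 :: tailSums (genericMatrix k r s))) :
      ∃ n, VarNil k (Fin r × Fin s) n q := by
    obtain ⟨n, hn⟩ := htorH (e.symm q)
    refine ⟨n, ?_⟩
    rw [varNil_iff] at hn ⊢
    intro x hx
    rw [← e.apply_symm_apply q, ← map_smul, hn x hx, map_zero]
  obtain ⟨D⟩ := exists_extDer (k := k) (σ := Fin r × Fin s) (K := K)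
  obtain ⟨w, hw⟩ := (exists_coinvariant_generator_iff _ _ D.stable _).2
    (exists_coinvariant_generator_minorSum hr hrs D)
  obtain ⟨u, hu, hu0, hgen, hsoc⟩ := exists_soc_generator _ htor w hw
    (exists_topQ_minorSum_ne_zero hr hrs.le)
  obtain ⟨g⟩ := exists_equiv_coInd _ htor u hu hu0 hgen hsoc
  refine ⟨⟨tor (Ideal.span (Set.range X) : Ideal (detPolyRing k r s)) (CoInd k (Fin r × Fin s)),
    inferInstance, inferInstance, injective_tor _ _, ?_⟩, e.symm u, ?_, ?_, ?_⟩
  · obtain ⟨ι, hι, hess⟩ := exists_essential_embedding (k := k) (σ := Fin r × Fin s) (u := g u)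
      (fun q => by
        obtain ⟨n, hn⟩ := htor (g.symm q)
        refine ⟨n, ?_⟩
        rw [varNil_iff] at hn ⊢
        intro x hx
        rw [← g.apply_symm_apply q, ← map_smul, hn x hx, map_zero])
      (mem_soc_map g.toLinearMap hu) (by rwa [Ne, map_eq_zero_iff g g.injective])
      (fun v hv => by
        obtain ⟨c, hc⟩ := hsoc (g.symm v) (mem_soc_map g.symm.toLinearMap hv)
        exact ⟨c, by rw [← map_smul, ← hc, g.apply_symm_apply]⟩)
    exact ⟨ι, hι, hess, ⟨e.trans g⟩⟩
  · rwa [Ne, map_eq_zero_iff e.symm e.symm.injective]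
  · exact fun p hp => smul_eq_zero_of_mem_soc (mem_soc_map e.symm.toLinearMap hu) hp
  · intro v hv
    obtain ⟨c, hc⟩ := hsoc (e v) (mem_soc_map e.toLinearMap
      fun i => hv _ (Ideal.subset_span ⟨i, rfl⟩))
    exact ⟨c, by rw [← map_smul, ← hc, e.symm_apply_apply]⟩

end
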